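/- Consider the multiple isotonic regression model Y_i = f₀(X_i) + ξ_i, where f₀ and x₀ satisfy Assumption A1 with parameters s and α = (α_1,…,α_d), the design points follow the β-fixed lattice design, and the errors ξ_i are i.i.d. mean-zero with variance σ² ∈ (0,∞). Suppose the maximizer κ_* of ℓ ↦ (Σ_{k=ℓ}^d β_k)/(2 + Σ_{k=ℓ}^s α_k^{−1}) over ℓ ∈ {1,…,d} is unique and satisfies 1 ≤ κ_* ≤ s. Set ω_n = n_*^{−1/(2 + Σ_{k=κ_*}^s α_k^{−1})} with n_* = n^{Σ_{k=κ_*}^d β_k}, and let r_n ∈ ℝ^d have (r_n)_k = 0 for k < κ_*, (r_n)_k = ω_n^{1/α_k} for κ_* ≤ k ≤ s, and (r_n)_k = 1 for s < k ≤ d. Then there exists γ₀ > 0 such that for every γ ≥ γ₀, lim_{c→∞} limsup_{n→∞} P( f̂_n(x₀) ≠ f̂_{n,c}(x₀) ) = 0, where f̂_{n,c}(x₀) = max_{h₁ ∈ [c^{−γ},c]^d} min_{h₂ ∈ [c^{−γ},c]^d} Ȳ|_{[x₀ − h₁⊙r_n, x₀ + h₂⊙r_n]} and ⊙ denotes coordinatewise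 product. -/

import Mathlib

open MeasureTheory Filter

/-- Iterated partial derivative in the `k`-th coordinate (one step). -/
noncomputable def pderiv (d : ℕ) (k : Fin d) (f : (Fin d → ℝ) → ℝ) : (Fin d → ℝ) → ℝ :=
  fun x => fderiv ℝ f x (Pi.single k 1)

/-- `j`-fold iterated partial derivative in the `k`-th coordinate. -/
noncomputable def pderivIter (d : ℕ) (k : Fin d) (j : ℕ) (f : (Fin d → ℝ) → ℝ) :
    (Fin d → ℝ) → ℝ :=
  (pderiv d k)^[j] f

/-- Mixed partial derivative `∂^𝐣 = ∂_1^{j_1} ⋯ ∂_d^{j_d}`. -/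
noncomputable def mixedPDeriv (d : ℕ) (j : Fin d → ℕ) (f : (Fin d → ℝ) → ℝ) :
    (Fin d → ℝ) → ℝ :=
  (List.finRange d).foldr (fun k g => pderivIter d k (j k) g) f

/-- The anisotropic Taylor polynomial of `f` at `x₀` over the multi-index set
`J₀ = {𝐣 : j_k = 0 for k > s, Σ_{k≤s} j_k/α_k ≤ 1}`. -/
noncomputable def taylorJ0 (d s : ℕ) (α : Fin d → ℕ) (f : (Fin d → ℝ) → ℝ)
    (x₀ x : Fin d → ℝ) : ℝ :=
  ∑ j : (∀ k : Fin d, Fin (α k + 1)),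
    if (∀ k : Fin d, s ≤ (k : ℕ) → (j k : ℕ) = 0) ∧
        (∑ k : Fin d, if (k : ℕ) < s then ((j k : ℕ) : ℝ) / (α k : ℝ) else 0) ≤ 1 then
      (mixedPDeriv d (fun k => (j k : ℕ)) f x₀ /
          ∏ k : Fin d, (Nat.factorial (j k : ℕ) : ℝ)) *
        ∏ k : Fin d, (x k - x₀ k) ^ ((j k : ℕ))
    else 0

/-- Anisotropic localization rates: `(r_n)_k = ω^{1/α_k}` for `k ≤ s` and `1` otherwise. -/
noncomputable def rVec (d s : ℕ) (α : Fin d → ℕ) (ωn : ℝ) : Fin d → ℝ :=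
  fun k => if (k : ℕ) < s then ωn ^ ((α k : ℝ)⁻¹) else 1

/-- Assumption A1: local anisotropic smoothness of the isotonic function `f₀` at `x₀`
with intrinsic dimension `s` and smoothness indices `α`. -/
def AssumptionA1 (d s : ℕ) (α : Fin d → ℕ) (f₀ : (Fin d → ℝ) → ℝ)
    (x₀ : Fin d → ℝ) : Prop :=
  s ≤ d ∧
  (∀ k : Fin d, x₀ k ∈ Set.Ioo (0 : ℝ) 1) ∧
  MonotoneOn f₀ (Set.Icc (0 : Fin d → ℝ) 1) ∧
  (∀ k : Fin d, (k : ℕ) < s → 1 ≤ α k) ∧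
  (∃ U : Set (Fin d → ℝ), IsOpen U ∧ x₀ ∈ U ∧
    ContDiffOn ℝ (((Finset.univ.filter (fun k : Fin d => (k : ℕ) < s)).sup α : ℕ)) f₀ U) ∧
  (∀ k : Fin d, (k : ℕ) < s →
    (∀ j : ℕ, 1 ≤ j → j ≤ α k - 1 → pderivIter d k j f₀ x₀ = 0) ∧
      pderivIter d k (α k) f₀ x₀ ≠ 0) ∧
  (∀ L₀ : ℝ, 0 < L₀ → ∀ ω : ℕ → ℝ, (∀ n, 0 < ω n) → Antitone ω →
    Tendsto ω atTop (nhds 0) →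
    Tendsto (fun n =>
      (ω n)⁻¹ * sSup {y : ℝ | ∃ x : Fin d → ℝ, x ∈ Set.Icc (0 : Fin d → ℝ) 1 ∧
        (∀ k : Fin d, |x k - x₀ k| ≤ L₀ * rVec d s α (ω n) k) ∧
        y = |f₀ x - taylorJ0 d s α f₀ x₀ x|}) atTop (nhds 0))

/-- Number of lattice points along dimension `k` at stage `n`: `⌊n^{β_k}⌋`. -/
noncomputable def latticeDim (d : ℕ) (β : Fin d → ℝ) (n : ℕ) (k : Fin d) : ℕ :=
  Nat.floor ((n : ℝ) ^ (β k))

/-- The lattice design point indexed by `v`, with per-dimension starting points `a n`. -/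
noncomputable def latticePt (d : ℕ) (β : Fin d → ℝ) (a : ℕ → Fin d → ℝ) (n : ℕ)
    (v : ∀ k : Fin d, Fin (latticeDim d β n k)) : Fin d → ℝ :=
  fun k => a n k + (v k : ℝ) / (latticeDim d β n k : ℝ)

/-- Average of the observations `Y` over the design points lying in the block `[xu, xv]`
(zero if the block contains no design point). -/
noncomputable def blockAvg {d : ℕ} {ι : Type*} [Fintype ι] (X : ι → (Fin d → ℝ))
    (Y : ι → ℝ) (xu xv : Fin d → ℝ) : ℝ :=
  haveI := Classical.decPred fun i => X i ∈ Set.Icc xu xv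
  (∑ i ∈ Finset.univ.filter (fun i => X i ∈ Set.Icc xu xv), Y i) /
    ((Finset.univ.filter (fun i => X i ∈ Set.Icc xu xv)).card : ℝ)

/-- The max–min block estimator at `x₀`. -/
noncomputable def maxMinEst {d : ℕ} {ι : Type*} [Fintype ι] (X : ι → (Fin d → ℝ))
    (Y : ι → ℝ) (x₀ : Fin d → ℝ) : ℝ :=
  sSup {z : ℝ | ∃ xu : Fin d → ℝ, xu ≤ x₀ ∧
    z = sInf {w : ℝ | ∃ xv : Fin d → ℝ, x₀ ≤ xv ∧ (∃ i : ι, X i ∈ Set.Icc xu xv) ∧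
      w = blockAvg X Y xu xv}}

/-- The local rate `ω_n = n_*^{-1/(2+Σ_{k=κ_*}^s α_k⁻¹)}` for the fixed lattice design. -/
noncomputable def omegaN (d s : ℕ) (α : Fin d → ℕ) (β : Fin d → ℝ) (κ : Fin d)
    (n : ℕ) : ℝ :=
  ((n : ℝ) ^ (∑ k ∈ Finset.Ici κ, β k)) ^
    (-(2 + ∑ k ∈ Finset.Ici κ, if (k : ℕ) < s then ((α k : ℝ))⁻¹ else 0)⁻¹)

/-- The localization rate vector `r_n`: zero below `κ_*`, `ω_n^{1/α_k}` for
`κ_* ≤ k ≤ s`, and `1` above `s`. -/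
noncomputable def rnVec (d s : ℕ) (α : Fin d → ℕ) (β : Fin d → ℝ) (κ : Fin d)
    (n : ℕ) : Fin d → ℝ :=
  fun k => if (k : ℕ) < (κ : ℕ) then 0
    else if (k : ℕ) < s then (omegaN d s α β κ n) ^ ((α k : ℝ)⁻¹) else 1

/-- The localized max–min block estimator `f̂_{n,c}`, with `h₁, h₂` ranging over the
box `[c^{−γ}, c]^d` on the scale of `r_n`. -/
noncomputable def maxMinEstLoc {d : ℕ} {ι : Type*} [Fintype ι] (X : ι → (Fin d → ℝ))
    (Y : ι → ℝ) (x₀ : Fin d → ℝ) (rn : Fin d → ℝ) (c γ : ℝ) : ℝ :=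
  sSup {z : ℝ | ∃ h₁ : Fin d → ℝ, (∀ k, c ^ (-γ) ≤ h₁ k ∧ h₁ k ≤ c) ∧
    z = sInf {w : ℝ | ∃ h₂ : Fin d → ℝ, (∀ k, c ^ (-γ) ≤ h₂ k ∧ h₂ k ≤ c) ∧
      w = blockAvg X Y (fun k => x₀ k - h₁ k * rn k) (fun k => x₀ k + h₂ k * rn k)}}

section
open ProbabilityTheory

lemma clt_aux (μ : Measure ℝ) [IsProbabilityMeasure μ] (σ : ℝ) (hσ : 0 < σ)
    (hmean : ∫ x, x ∂μ = 0) (hvar : ∫ x, x ^ 2 ∂μ = σ ^ 2)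
    (hL2 : Integrable (fun x : ℝ => x ^ 2) μ) (K : ℝ) :
    ∃ p : ℝ, 0 < p ∧ ∃ D0 : ℕ, ∀ D : ℕ, D0 ≤ D →
      p ≤ (Measure.infinitePi (fun _ : ℕ => μ)).real
        {x : ℕ → ℝ | ∑ k ∈ Finset.range D, x k ≤ - K * Real.sqrt D} := by
  have hmem : MemLp (fun x : ℝ => x) 2 μ :=
    (memLp_two_iff_integrable_sq (by fun_prop)).2 hL2
  set Q := Measure.infinitePi (fun _ : ℕ => μ) with hQ
  have hmp : ∀ i : ℕ, MeasurePreserving (fun x : ℕ → ℝ => x i) Q μ := fun i =>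
    measurePreserving_eval_infinitePi (fun _ : ℕ => μ) i
  have hind : iIndepFun (fun (i : ℕ) (x : ℕ → ℝ) => x i) Q :=
    iIndepFun_infinitePi (P := fun _ : ℕ => μ) (X := fun _ x => x) (fun _ => measurable_id)
  have hvar' : Var[fun x : ℕ → ℝ => x 0; Q] = σ ^ 2 := by
    have h1 := (hmp 0).variance_fun_comp (f := fun x : ℝ => x) (by fun_prop)
    rw [h1, variance_eq_integral (by fun_prop)]
    simp [hmean, hvar]
  have hmean' : ∫ x : ℕ → ℝ, x 0 ∂Q = 0 := by
    have h2 := integral_map (μ := Q) (φ := fun x : ℕ → ℝ => x 0) (f := fun x : ℝ => x)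
      (measurable_pi_apply 0).aemeasurable (by fun_prop)
    rw [(hmp 0).map_eq] at h2
    rw [← h2, hmean]
  have hX : MemLp (fun x : ℕ → ℝ => x 0) 2 Q :=
    hmem.comp_measurePreserving (hmp 0)
  have hident : ∀ i : ℕ, IdentDistrib (fun x : ℕ → ℝ => x i) (fun x : ℕ → ℝ => x 0) Q Q :=
    fun i => ⟨(measurable_pi_apply i).aemeasurable, (measurable_pi_apply 0).aemeasurable, by rw [(hmp i).map_eq, (hmp 0).map_eq]⟩
  have hclt := tendstoInDistribution_inv_sqrt_mul_sum_sub (P := Q)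
    (X := fun (i : ℕ) (x : ℕ → ℝ) => x i)
    (P' := gaussianReal 0 Var[fun x : ℕ → ℝ => x 0; Q].toNNReal) (Y := id)
    ⟨by fun_prop, by simp⟩ hX hind hident
  have hlim := ProbabilityMeasure.le_liminf_measure_open_of_tendsto hclt.tendsto
    (isOpen_Iio (a := -K))
  simp only [ProbabilityMeasure.coe_mk, Measure.map_id] at hlim
  have hpos : 0 < gaussianReal 0 Var[fun x : ℕ → ℝ => x 0; Q].toNNReal (Set.Iio (-K)) := by
    rw [pos_iff_ne_zero]
    intro h0
    have hac := gaussianReal_absolutelyContinuous' (v := Var[fun x : ℕ → ℝ => x 0; Q].toNNReal) 0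
      (by rw [hvar']; simp only [ne_eq, Real.toNNReal_eq_zero, not_le]; positivity)
    have := hac h0
    simp at this
  obtain ⟨q, hq0, hq⟩ := ENNReal.lt_iff_exists_nnreal_btwn.1 hpos
  have hev := eventually_lt_of_lt_liminf (lt_of_lt_of_le hq hlim)
  obtain ⟨D0, hD0⟩ := eventually_atTop.1 hev
  refine ⟨q, by exact_mod_cast hq0, max D0 1, fun D hD => ?_⟩
  have h1 := hD0 D (le_trans (le_max_left _ _) hD)
  have hD1 : (1 : ℝ) ≤ D := by exact_mod_cast le_trans (le_max_right _ _) hD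
  rw [Measure.map_apply (by fun_prop) measurableSet_Iio] at h1
  have h2 : Q ((fun x : ℕ → ℝ => (√(D:ℝ))⁻¹ * (∑ k ∈ Finset.range D, x k - D * ∫ x : ℕ → ℝ, x 0 ∂Q)) ⁻¹'
      Set.Iio (-K)) ≤ Q {x : ℕ → ℝ | ∑ k ∈ Finset.range D, x k ≤ - K * Real.sqrt D} := by
    apply measure_mono
    intro x hx
    simp only [Set.mem_preimage, Set.mem_Iio, hmean', mul_zero, sub_zero] at hx
    simp only [Set.mem_ofPred_eq]
    have hs : 0 < √(D:ℝ) := by positivity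
    rw [inv_mul_lt_iff₀ hs] at hx
    linarith
  have h3 := h1.le.trans h2
  rw [measureReal_def, ← ENNReal.toReal_ofReal (r := (q:ℝ)) (by positivity)]
  apply ENNReal.toReal_mono (measure_ne_top _ _)
  simpa using h3

/-- lower bound of the lower tail of sums of i.i.d. noise -/
lemma clt_lower (μ : Measure ℝ) [IsProbabilityMeasure μ] (σ : ℝ) (hσ : 0 < σ)
    (hmean : ∫ x, x ∂μ = 0) (hvar : ∫ x, x ^ 2 ∂μ = σ ^ 2)
    (hL2 : Integrable (fun x : ℝ => x ^ 2) μ) (K : ℝ) :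
    ∃ p : ℝ, 0 < p ∧ ∃ D0 : ℕ, ∀ {Ω : Type*} [MeasurableSpace Ω] (P : Measure Ω)
      [IsProbabilityMeasure P] {ι : Type} [Fintype ι] (ξ : ι → Ω → ℝ)
      (_ : iIndepFun ξ P) (_ : ∀ i, Measurable (ξ i)) (_ : ∀ i, P.map (ξ i) = μ)
      (A : Finset ι), D0 ≤ A.card →
      p ≤ P.real {ω | ∑ i ∈ A, ξ i ω ≤ - K * Real.sqrt A.card} := by
  obtain ⟨p, hp, D0, h⟩ := clt_aux μ σ hσ hmean hvar hL2 K
  refine ⟨p, hp, D0, ?_⟩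
  intro Ω _ P _ ι _ ξ hind hm hlaw A hA
  have h1 := h A.card hA
  refine h1.trans (le_of_eq ?_)
  set D := A.card with hD
  set S : Set (Fin D → ℝ) := {y | ∑ k, y k ≤ -K * Real.sqrt D} with hS
  have hSm : MeasurableSet S := measurableSet_le (by fun_prop) (by fun_prop)
  have e1 : (Measure.infinitePi (fun _ : ℕ => μ)).map (fun (x : ℕ → ℝ) (i : Fin D) => x i) =
      Measure.pi (fun _ => μ) := by
    have hi : iIndepFun (fun (i : ℕ) (x : ℕ → ℝ) => x i) (Measure.infinitePi (fun _ : ℕ => μ)) :=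
      iIndepFun_infinitePi (P := fun _ : ℕ => μ) (X := fun _ x => x) (fun _ => measurable_id)
    have := (iIndepFun_iff_map_fun_eq_pi_map (fun i => (measurable_pi_apply _).aemeasurable)).1 (hi.precomp (g := fun i : Fin D => (i:ℕ))
      Fin.val_injective)
    rw [this]
    congr 1
    ext1 i
    exact (measurePreserving_eval_infinitePi (fun _ : ℕ => μ) i).map_eq
  have e2 : P.map (fun ω (i : Fin D) => ξ (A.equivFin.symm i) ω) =
      Measure.pi (fun _ => μ) := by
    have := (iIndepFun_iff_map_fun_eq_pi_map (fun i => (hm _).aemeasurable)).1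
      (hind.precomp (g := fun i : Fin D => (A.equivFin.symm i : ι))
      (Subtype.val_injective.comp A.equivFin.symm.injective))
    rw [this]
    congr 1
    ext1 i
    exact hlaw _
  have f1 : {x : ℕ → ℝ | ∑ k ∈ Finset.range D, x k ≤ - K * Real.sqrt D} =
      (fun (x : ℕ → ℝ) (i : Fin D) => x i) ⁻¹' S := by
    ext x
    simp [hS, Finset.sum_range]
  have f2 : {ω | ∑ i ∈ A, ξ i ω ≤ - K * Real.sqrt D} =
      (fun ω (i : Fin D) => ξ (A.equivFin.symm i) ω) ⁻¹' S := by
    ext x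
    simp only [hS, Set.mem_ofPred_eq, Set.mem_preimage]
    rw [Equiv.sum_comp A.equivFin.symm (fun i : A => ξ i x), Finset.sum_coe_sort A (fun i => ξ i x)]
  rw [f1, f2, ← map_measureReal_apply (by fun_prop) hSm, ← map_measureReal_apply _ hSm, e1, e2]
  exact measurable_pi_lambda _ (fun i => hm _)


/-- sigma-algebra generated by the noise indexed by `A` -/
@[reducible] def sgA {Ω ι : Type*} (ξ : ι → Ω → ℝ) (A : Set ι) : MeasurableSpace Ω :=
  ⨆ i ∈ A, MeasurableSpace.comap (ξ i) inferInstance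

lemma sgA_le {Ω ι : Type*} [mΩ : MeasurableSpace Ω] (ξ : ι → Ω → ℝ) (hm : ∀ i, Measurable (ξ i))
    (A : Set ι) : sgA ξ A ≤ mΩ :=
  iSup₂_le fun i _ => (hm i).comap_le

lemma sgA_mono {Ω ι : Type*} (ξ : ι → Ω → ℝ) {A B : Set ι} (h : A ⊆ B) : sgA ξ A ≤ sgA ξ B :=
  biSup_mono h

lemma sgA_sum {Ω ι : Type*} (ξ : ι → Ω → ℝ) {A : Set ι} (s : Finset ι) (h : (s : Set ι) ⊆ A) :
    Measurable[sgA ξ A] (fun ω => ∑ i ∈ s, ξ i ω) := by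
  refine Finset.measurable_fun_sum (m := sgA ξ A) s fun i hi => ?_
  have : MeasurableSpace.comap (ξ i) inferInstance ≤ sgA ξ A :=
    le_iSup₂ (f := fun i (_ : i ∈ A) => MeasurableSpace.comap (ξ i) inferInstance) i (h hi)
  exact (comap_measurable (ξ i)).mono this le_rfl

lemma sgA_indep {Ω ι : Type*} [mΩ : MeasurableSpace Ω] {P : Measure Ω} (ξ : ι → Ω → ℝ)
    (hind : iIndepFun ξ P) (hm : ∀ i, Measurable (ξ i)) {A B : Set ι} (hAB : Disjoint A B)
    {E F : Set Ω} (hE : MeasurableSet[sgA ξ A] E) (hF : MeasurableSet[sgA ξ B] F) :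
    P.real (E ∩ F) = P.real E * P.real F := by
  have h : Indep (sgA ξ A) (sgA ξ B) P :=
    indep_iSup_of_disjoint (fun i => (hm i).comap_le) hind hAB
  have := (Indep_iff _ _ _).1 h E F hE hF
  simp [measureReal_def, this]

lemma meas_ex_ge {Ω Θ : Type*} {m : MeasurableSpace Ω} [Countable Θ] (f : Θ → Ω → ℝ)
    (hf : ∀ θ, Measurable[m] (f θ)) (w : Θ → ℝ) :
    MeasurableSet[m] {ω | ∃ θ, w θ ≤ |f θ ω|} := by
  have : {ω | ∃ θ, w θ ≤ |f θ ω|} = ⋃ θ, {ω | w θ ≤ |f θ ω|} := by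
    ext; simp
  rw [this]
  refine MeasurableSet.iUnion fun θ => ?_
  have h1 : Measurable[m] (fun ω => |f θ ω|) := measurable_abs.comp (hf θ)
  exact h1 measurableSet_Ici

section
variable {Ω ι Θ : Type*} [mΩ : MeasurableSpace Ω] {P : Measure Ω} [IsProbabilityMeasure P]
  [DecidableEq ι] [Countable Θ]

lemma etemadi (ξ : ι → Ω → ℝ)
    (hind : iIndepFun ξ P) (hm : ∀ i, Measurable (ξ i))
    (B : ℕ → Finset ι) (hB : Monotone B) (hB0 : B 0 = ∅) (D : Θ → Finset ι) (w : Θ → ℝ)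
    (K : ℝ) (hK : 0 ≤ K)
    (hyp : ∀ i j : ℕ, i ≤ j → ∀ x : ℝ, 0 < x →
      P.real {ω | ∃ θ, x * w θ ≤ |∑ e ∈ (B j \ B i) ∩ D θ, ξ e ω|} ≤ K * (j - i) / x ^ 2)
    (T : ℕ) (x : ℝ) (hx : 0 < x) :
    P.real {ω | ∃ j ≤ T, ∃ θ, 3 * x * w θ ≤ |∑ e ∈ B j ∩ D θ, ξ e ω|} ≤ 2 * K * T / x ^ 2 := by
  set E : ℕ → Set Ω := fun j => {ω | ∃ θ, 3 * x * w θ ≤ |∑ e ∈ B j ∩ D θ, ξ e ω|} with hE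
  set F : ℕ → Set Ω := fun j => E j \ ⋃ i ∈ Finset.range j, E i with hF
  set G : Set Ω := {ω | ∃ θ, x * w θ ≤ |∑ e ∈ (B T \ B 0) ∩ D θ, ξ e ω|} with hG
  set H : ℕ → Set Ω := fun j => {ω | ∃ θ, 2 * x * w θ ≤ |∑ e ∈ (B T \ B j) ∩ D θ, ξ e ω|} with hH
  have hEm : ∀ i j, i ≤ j → MeasurableSet[sgA ξ (B j)] (E i) := by
    intro i j hij
    refine meas_ex_ge _ (fun θ => sgA_sum ξ _ ?_) _
    exact fun a ha => hB hij (Finset.mem_inter.1 (by exact_mod_cast ha)).1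
  have hFm : ∀ j, MeasurableSet[sgA ξ (B j)] (F j) := by
    intro j
    refine MeasurableSet.diff (hEm j j le_rfl) (MeasurableSet.biUnion (Finset.countable_toSet _) ?_)
    intro i hi
    exact hEm i j (by simp at hi; omega)
  have hHm : ∀ j, MeasurableSet[sgA ξ ((B T \ B j : Finset ι) : Set ι)] (H j) := by
    intro j
    refine meas_ex_ge _ (fun θ => sgA_sum ξ _ ?_) _
    exact fun a ha => by exact_mod_cast (Finset.mem_inter.1 (by exact_mod_cast ha)).1
  have hsub : {ω | ∃ j ≤ T, ∃ θ, 3 * x * w θ ≤ |∑ e ∈ B j ∩ D θ, ξ e ω|} ⊆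
      G ∪ ⋃ j ∈ Finset.range (T + 1), (F j ∩ H j) := by
    rintro ω ⟨j0, hj0, hj0E⟩
    classical
    have hex : ∃ j, ω ∈ E j := ⟨j0, hj0E⟩
    set j := Nat.find hex with hj
    have hjE : ω ∈ E j := Nat.find_spec hex
    have hjT : j ≤ T := (Nat.find_min' hex hj0E).trans hj0
    have hjF : ω ∈ F j := by
      refine ⟨hjE, ?_⟩
      simp only [Set.mem_iUnion, not_exists, Finset.mem_range]
      intro i hi
      exact Nat.find_min hex hi
    by_cases hGw : ω ∈ G
    · exact Or.inl hGw
    · right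
      simp only [Set.mem_iUnion]
      refine ⟨j, by simp; omega, hjF, ?_⟩
      obtain ⟨θ, hθ⟩ := hjE
      refine ⟨θ, ?_⟩
      have h1 : ¬ (x * w θ ≤ |∑ e ∈ (B T \ B 0) ∩ D θ, ξ e ω|) := fun h => hGw ⟨θ, h⟩
      rw [hB0, Finset.sdiff_empty] at h1
      have h2 : ∑ e ∈ B T ∩ D θ, ξ e ω = ∑ e ∈ (B T \ B j) ∩ D θ, ξ e ω + ∑ e ∈ B j ∩ D θ, ξ e ω := by
        rw [← Finset.sum_union]
        · congr 1
          ext a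
          have := @hB j T hjT a
          simp only [Finset.mem_inter, Finset.mem_union, Finset.mem_sdiff]
          tauto
        · rw [Finset.disjoint_left]
          intro a
          simp only [Finset.mem_inter, Finset.mem_sdiff]
          tauto
      push Not at h1
      rw [h2] at h1
      have h3 := abs_sub_abs_le_abs_sub (∑ e ∈ B j ∩ D θ, ξ e ω) (-∑ e ∈ (B T \ B j) ∩ D θ, ξ e ω)
      rw [abs_neg, sub_neg_eq_add, add_comm (∑ e ∈ B j ∩ D θ, ξ e ω)] at h3
      linarith
  have hGP : P.real G ≤ K * T / x ^ 2 := by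
    simpa using hyp 0 T (Nat.zero_le _) x hx
  have hHP : ∀ j, j ≤ T → P.real (H j) ≤ K * T / x ^ 2 := by
    intro j hj
    refine (hyp j T hj (2 * x) (by positivity)).trans ?_
    rw [div_le_div_iff₀ (by positivity) (by positivity)]
    have hj' : (0:ℝ) ≤ j := Nat.cast_nonneg j
    have hT' : (j:ℝ) ≤ T := by exact_mod_cast hj
    have : K * (T - j) ≤ K * T := mul_le_mul_of_nonneg_left (by linarith) hK
    have h5 : 0 ≤ K * T := by positivity
    nlinarith [sq_nonneg x]
  have hFsum : ∑ j ∈ Finset.range (T + 1), P.real (F j) ≤ 1 := by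
    rw [← measureReal_biUnion_finset]
    · exact measureReal_le_one
    · intro i _ j _ hij
      rcases lt_or_gt_of_ne hij with h | h
      · refine Set.disjoint_left.2 fun ω h1 h2 => h2.2 ?_
        simp only [Set.mem_iUnion]
        exact ⟨i, by simpa using h, h1.1⟩
      · refine Set.disjoint_left.2 fun ω h1 h2 => h1.2 ?_
        simp only [Set.mem_iUnion]
        exact ⟨j, by simpa using h, h2.1⟩
    · intro j _
      exact sgA_le ξ hm _ _ (hFm j)
  calc _ ≤ P.real (G ∪ ⋃ j ∈ Finset.range (T + 1), (F j ∩ H j)) := measureReal_mono hsub (measure_ne_top _ _)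
    _ ≤ P.real G + P.real (⋃ j ∈ Finset.range (T + 1), (F j ∩ H j)) := measureReal_union_le _ _
    _ ≤ P.real G + ∑ j ∈ Finset.range (T + 1), P.real (F j ∩ H j) := by
        gcongr
        exact measureReal_biUnion_finset_le _ _
    _ ≤ K * T / x ^ 2 + ∑ j ∈ Finset.range (T + 1), P.real (F j) * (K * T / x ^ 2) := by
        gcongr with j hj
        have hj' : j ≤ T := by simp at hj; omega
        rw [sgA_indep ξ hind hm (A := (B j : Set ι)) (B := ((B T \ B j : Finset ι) : Set ι)) ?_
          (hFm j) (hHm j)]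
        · gcongr
          exact hHP j hj'
        · rw [Finset.disjoint_coe]
          exact Finset.disjoint_sdiff
    _ ≤ K * T / x ^ 2 + 1 * (K * T / x ^ 2) := by
        rw [← Finset.sum_mul]
        gcongr
    _ = 2 * K * T / x ^ 2 := by ring

lemma chain_max (ξ : ι → Ω → ℝ)
    (hind : iIndepFun ξ P) (hm : ∀ i, Measurable (ξ i))
    (B : ℕ → Finset ι) (hB : Monotone B) (hB0 : B 0 = ∅) (D : Θ → Finset ι) (w : Θ → ℝ)
    (hw : ∀ θ, 0 ≤ w θ)
    (K : ℝ) (hK : 0 ≤ K)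
    (hyp : ∀ i j : ℕ, i ≤ j → ∀ x : ℝ, 0 < x →
      P.real {ω | ∃ θ, x * w θ ≤ |∑ e ∈ (B j \ B i) ∩ D θ, ξ e ω|} ≤ K * (j - i) / x ^ 2)
    (T : ℕ) (x : ℝ) (hx : 0 < x) (m : ℝ) (hm1 : 1 ≤ m) :
    P.real {ω | ∃ j ≤ T, ∃ θ, x * (w θ * max (j:ℝ) m) ≤ |∑ e ∈ B j ∩ D θ, ξ e ω|} ≤
      144 * K / (m * x ^ 2) := by
  have hm0 : 0 < m := by linarith
  set E : ℕ → Set Ω := fun l => {ω | ∃ j ≤ ⌊2 ^ l * m⌋₊, ∃ θ,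
    3 * (x * 2 ^ l * m / 6) * w θ ≤ |∑ e ∈ B j ∩ D θ, ξ e ω|} with hE
  have hsub : {ω | ∃ j ≤ T, ∃ θ, x * (w θ * max (j:ℝ) m) ≤ |∑ e ∈ B j ∩ D θ, ξ e ω|} ⊆
      ⋃ l ∈ Finset.range (T + 1), E l := by
    rintro ω ⟨j, hj, θ, hθ⟩
    have hex : ∃ l : ℕ, (j : ℝ) ≤ 2 ^ l * m := by
      refine ⟨j, ?_⟩
      have : (j:ℝ) ≤ 2 ^ j := by exact_mod_cast Nat.lt_two_pow_self.le
      nlinarith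
    classical
    set l := Nat.find hex with hl
    have hl1 : (j:ℝ) ≤ 2 ^ l * m := Nat.find_spec hex
    have hlT : l ≤ T := by
      refine (Nat.find_min' hex ?_).trans hj
      have : (j:ℝ) ≤ 2 ^ j := by exact_mod_cast Nat.lt_two_pow_self.le
      nlinarith
    simp only [Set.mem_iUnion]
    refine ⟨l, by simp; omega, j, Nat.le_floor hl1, θ, le_trans ?_ hθ⟩
    have key : 2 ^ l * m / 2 ≤ max (j:ℝ) m := by
      rcases Nat.eq_zero_or_pos l with h0 | h0
      · rw [h0]
        have := le_max_right (j:ℝ) m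
        linarith
      · obtain ⟨l', hl'⟩ : ∃ l', l = l' + 1 := ⟨l - 1, by omega⟩
        have h2 := Nat.find_min hex (m := l') (by omega)
        rw [hl', pow_succ]
        have := le_max_left (j:ℝ) m
        push Not at h2
        linarith
    calc 3 * (x * 2 ^ l * m / 6) * w θ = x * (w θ * (2 ^ l * m / 2)) := by ring
      _ ≤ x * (w θ * max (j:ℝ) m) := by
        gcongr
        exact hw θ
  have hEl : ∀ l, P.real (E l) ≤ (72 * K / (m * x ^ 2)) * (1 / 2) ^ l := by
    intro l
    refine (etemadi ξ hind hm B hB hB0 D w K hK hyp ⌊2 ^ l * m⌋₊ (x * 2 ^ l * m / 6)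
      (by positivity)).trans ?_
    have hfl : (⌊2 ^ l * m⌋₊ : ℝ) ≤ 2 ^ l * m := Nat.floor_le (by positivity)
    calc 2 * K * (⌊2 ^ l * m⌋₊ : ℝ) / (x * 2 ^ l * m / 6) ^ 2
        ≤ 2 * K * (2 ^ l * m) / (x * 2 ^ l * m / 6) ^ 2 := by gcongr
      _ = (72 * K / (m * x ^ 2)) * (1 / 2) ^ l := by
        rw [one_div, inv_pow]
        field_simp
        ring
  calc _ ≤ P.real (⋃ l ∈ Finset.range (T + 1), E l) := measureReal_mono hsub (measure_ne_top _ _)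
    _ ≤ ∑ l ∈ Finset.range (T + 1), P.real (E l) := measureReal_biUnion_finset_le _ _
    _ ≤ ∑ l ∈ Finset.range (T + 1), (72 * K / (m * x ^ 2)) * (1 / 2) ^ l :=
        Finset.sum_le_sum fun l _ => hEl l
    _ ≤ (72 * K / (m * x ^ 2)) * 2 := by
        rw [← Finset.mul_sum]
        gcongr
        have := Summable.sum_le_tsum (Finset.range (T + 1)) (f := fun l : ℕ => ((1:ℝ) / 2) ^ l)
          (fun i _ => by positivity) summable_geometric_two
        rwa [tsum_geometric_two] at this
    _ = 144 * K / (m * x ^ 2) := by ring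
end


lemma cheb_sum {Ω ι : Type*} [mΩ : MeasurableSpace Ω] {P : Measure Ω} [IsProbabilityMeasure P]
    (μ : Measure ℝ) [IsProbabilityMeasure μ] (σ : ℝ)
    (hmean : ∫ x, x ∂μ = 0) (hvar : ∫ x, x ^ 2 ∂μ = σ ^ 2)
    (hL2 : Integrable (fun x : ℝ => x ^ 2) μ) (ξ : ι → Ω → ℝ)
    (hind : iIndepFun ξ P) (hm : ∀ i, Measurable (ξ i)) (hlaw : ∀ i, P.map (ξ i) = μ)
    (A : Finset ι) (x : ℝ) (hx : 0 < x) :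
    P.real {ω | x ≤ |∑ i ∈ A, ξ i ω|} ≤ σ ^ 2 * A.card / x ^ 2 := by
  have hmem : MemLp (fun x : ℝ => x) 2 μ :=
    (memLp_two_iff_integrable_sq (by fun_prop)).2 hL2
  have hmp : ∀ i, MeasurePreserving (ξ i) P μ := fun i => ⟨hm i, hlaw i⟩
  have hmem' : ∀ i, MemLp (ξ i) 2 P := fun i => hmem.comp_measurePreserving (hmp i)
  have hmean' : ∀ i, ∫ ω, ξ i ω ∂P = 0 := by
    intro i
    have h2 := integral_map (μ := P) (φ := ξ i) (f := fun x : ℝ => x)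
      (hm i).aemeasurable (by fun_prop)
    rw [← h2, hlaw i, hmean]
  have hvar' : ∀ i, Var[ξ i; P] = σ ^ 2 := by
    intro i
    have h1 := (hmp i).variance_fun_comp (f := fun x : ℝ => x) (by fun_prop)
    rw [h1, variance_eq_integral (by fun_prop)]
    simp [hmean, hvar]
  have hS : MemLp (∑ i ∈ A, ξ i) 2 P := memLp_finsetSum' A fun i _ => hmem' i
  have hV : Var[∑ i ∈ A, ξ i; P] = σ ^ 2 * A.card := by
    rw [IndepFun.variance_sum (fun i _ => hmem' i) (fun i _ j _ hij => hind.indepFun hij)]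
    simp [hvar', mul_comm]
  have hE : P[∑ i ∈ A, ξ i] = 0 := by
    simp only [Finset.sum_apply]
    rw [integral_finsetSum _ (fun i _ => (hmem' i).integrable (by norm_num))]
    simp [hmean']
  have := meas_ge_le_variance_div_sq hS hx
  rw [hE, hV] at this
  have h3 := ENNReal.toReal_mono (by simp) this
  rw [ENNReal.toReal_ofReal (by positivity)] at h3
  simpa [measureReal_def] using h3

/-- index interval around `v` -/
def ivl {m : ℕ} (v : Fin m) (p q : ℕ) : Finset (Fin m) :=
  Finset.univ.filter (fun i => (v : ℕ) ≤ i + p ∧ (i : ℕ) ≤ v + q)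
def leftc {m : ℕ} (v : Fin m) (p : ℕ) : Finset (Fin m) :=
  Finset.univ.filter (fun i => (i : ℕ) < v ∧ (v : ℕ) ≤ i + p)
def rightc {m : ℕ} (v : Fin m) (q : ℕ) : Finset (Fin m) :=
  Finset.univ.filter (fun i => (v : ℕ) ≤ i ∧ (i : ℕ) < v + q)

lemma ivl_eq {m : ℕ} (v : Fin m) (p q : ℕ) : ivl v p q = leftc v p ∪ rightc v (q + 1) := by
  ext i
  simp only [ivl, leftc, rightc, Finset.mem_filter, Finset.mem_univ, true_and, Finset.mem_union]
  omega

lemma lr_disj {m : ℕ} (v : Fin m) (p q : ℕ) : Disjoint (leftc v p) (rightc v q) := by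
  rw [Finset.disjoint_left]
  intro i
  simp only [leftc, rightc, Finset.mem_filter, Finset.mem_univ, true_and]
  omega

lemma card_le_of_Ico {m : ℕ} (s : Finset (Fin m)) (a b : ℕ) (h : ∀ i ∈ s, a ≤ (i:ℕ) ∧ (i:ℕ) < b) :
    s.card ≤ b - a := by
  have : (s.map Fin.valEmbedding) ⊆ Finset.Ico a b := by
    intro x hx
    simp only [Finset.mem_map, Fin.valEmbedding_apply] at hx
    obtain ⟨i, hi, rfl⟩ := hx
    exact Finset.mem_Ico.2 (h i hi)
  have h2 := Finset.card_le_card this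
  simpa using h2

lemma card_eq_of_Ico {m : ℕ} (s : Finset (Fin m)) (a b : ℕ) (hb : b ≤ m)
    (h : ∀ i : Fin m, i ∈ s ↔ a ≤ (i:ℕ) ∧ (i:ℕ) < b) :
    s.card = b - a := by
  have : (s.map Fin.valEmbedding) = Finset.Ico a b := by
    ext x
    simp only [Finset.mem_map, Fin.valEmbedding_apply, Finset.mem_Ico]
    constructor
    · rintro ⟨i, hi, rfl⟩
      exact (h i).1 hi
    · rintro ⟨h1, h2⟩
      exact ⟨⟨x, by omega⟩, (h _).2 ⟨h1, h2⟩, rfl⟩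
  have h2 := congrArg Finset.card this
  simpa using h2

lemma ivl_card_le {m : ℕ} (v : Fin m) (p q : ℕ) : (ivl v p q).card ≤ p + q + 1 := by
  refine (card_le_of_Ico _ (v - p) (v + q + 1) ?_).trans (by omega)
  intro i hi
  simp only [ivl, Finset.mem_filter, Finset.mem_univ, true_and] at hi
  omega

lemma ivl_card {m : ℕ} (v : Fin m) (p q : ℕ) (hp : p ≤ v) (hq : (v:ℕ) + q < m) :
    (ivl v p q).card = p + q + 1 := by
  rw [card_eq_of_Ico _ (v - p) (v + q + 1) (by omega)]
  · omega
  · intro i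
    simp only [ivl, Finset.mem_filter, Finset.mem_univ, true_and]
    omega

lemma leftc_card {m : ℕ} (v : Fin m) {i j : ℕ} (hij : i ≤ j) :
    (leftc v j \ leftc v i).card ≤ j - i := by
  refine (card_le_of_Ico _ (v - j) (v - i) ?_).trans (by omega)
  intro a ha
  simp only [leftc, Finset.mem_filter, Finset.mem_univ, true_and, Finset.mem_sdiff] at ha
  omega

lemma rightc_card {m : ℕ} (v : Fin m) {i j : ℕ} (hij : i ≤ j) :
    (rightc v j \ rightc v i).card ≤ j - i := by
  refine (card_le_of_Ico _ (v + i) (v + j) ?_).trans (by omega)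
  intro a ha
  simp only [rightc, Finset.mem_filter, Finset.mem_univ, true_and, Finset.mem_sdiff] at ha
  omega

lemma leftc_mono {m : ℕ} (v : Fin m) : Monotone (leftc v) := fun a b hab i hi => by
  simp only [leftc, Finset.mem_filter, Finset.mem_univ, true_and] at hi ⊢; omega
lemma rightc_mono {m : ℕ} (v : Fin m) : Monotone (rightc v) := fun a b hab i hi => by
  simp only [rightc, Finset.mem_filter, Finset.mem_univ, true_and] at hi ⊢; omega
lemma leftc_zero {m : ℕ} (v : Fin m) : leftc v 0 = ∅ := by
  ext i; simp [leftc]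
lemma rightc_zero {m : ℕ} (v : Fin m) : rightc v 0 = ∅ := by
  ext i; simp [rightc]

section
variable {d : ℕ} {N : Fin d → ℕ}

/-- box with coordinates in `J` given by intervals, others by arbitrary finsets -/
def bxJ (v : ∀ k, Fin (N k)) (J : Finset (Fin d)) (A : ∀ k, Finset (Fin (N k))) (p q : Fin d → ℕ) :
    Finset (∀ k, Fin (N k)) :=
  Fintype.piFinset (fun k => if k ∈ J then ivl (v k) (p k) (q k) else A k)

lemma mem_bxJ (v : ∀ k, Fin (N k)) (J : Finset (Fin d)) (A : ∀ k, Finset (Fin (N k)))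
    (p q : Fin d → ℕ) (i : ∀ k, Fin (N k)) :
    i ∈ bxJ v J A p q ↔ ∀ k, (k ∈ J → i k ∈ ivl (v k) (p k) (q k)) ∧ (k ∉ J → i k ∈ A k) := by
  simp only [bxJ, Fintype.mem_piFinset]
  refine forall_congr' fun k => ?_
  by_cases h : k ∈ J <;> simp [h]

lemma mem_bxJ_update (v : ∀ k, Fin (N k)) (J : Finset (Fin d)) (A : ∀ k, Finset (Fin (N k)))
    (p q : Fin d → ℕ) (i : ∀ k, Fin (N k)) (k : Fin d) (hk : k ∉ J) (c : Finset (Fin (N k))) :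
    i ∈ bxJ v J (Function.update A k c) p q ↔ i k ∈ c ∧
      ∀ l, (l ∈ J → i l ∈ ivl (v l) (p l) (q l)) ∧ (l ∉ J → l ≠ k → i l ∈ A l) := by
  rw [mem_bxJ]
  constructor
  · intro h
    refine ⟨by simpa using (h k).2 hk, fun l => ⟨(h l).1, fun h1 h2 => ?_⟩⟩
    have := (h l).2 h1
    rwa [Function.update_of_ne h2] at this
  · rintro ⟨h0, h⟩ l
    refine ⟨(h l).1, fun h1 => ?_⟩
    by_cases hl : l = k
    · subst hl; simpa using h0
    · rw [Function.update_of_ne hl]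
      exact (h l).2 h1 hl

variable {Ω : Type*} [mΩ : MeasurableSpace Ω] {P : Measure Ω} [IsProbabilityMeasure P]

lemma chain_step (ξ : (∀ k, Fin (N k)) → Ω → ℝ)
    (hind : iIndepFun ξ P) (hm : ∀ i, Measurable (ξ i)) (v : ∀ k, Fin (N k)) (M : Fin d → ℝ)
    (hM : ∀ k, 1 ≤ M k) (J : Finset (Fin d)) (k : Fin d) (hk : k ∉ J) (K : ℝ) (hK : 0 ≤ K)
    (A : ∀ k, Finset (Fin (N k)))
    (ih : ∀ c : Finset (Fin (N k)), ∀ x : ℝ, 0 < x →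
      P.real {ω | ∃ θ : (Fin d → ℕ) × (Fin d → ℕ),
        x * ∏ l ∈ J, max ((θ.1 l : ℝ) + θ.2 l + 1) (M l) ≤
          |∑ e ∈ bxJ v J (Function.update A k c) θ.1 θ.2, ξ e ω|} ≤ K * c.card / x ^ 2)
    (ch : ℕ → Finset (Fin (N k))) (hch : Monotone ch) (hch0 : ch 0 = ∅)
    (hcard : ∀ i j, i ≤ j → (ch j \ ch i).card ≤ j - i)
    (x : ℝ) (hx : 0 < x) (T : ℕ) :
    P.real {ω | ∃ j ≤ T, ∃ θ : (Fin d → ℕ) × (Fin d → ℕ),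
        x * ((∏ l ∈ J, max ((θ.1 l : ℝ) + θ.2 l + 1) (M l)) * max (j:ℝ) (M k)) ≤
          |∑ e ∈ bxJ v J (Function.update A k (ch j)) θ.1 θ.2, ξ e ω|} ≤
      144 * K / (M k * x ^ 2) := by
  have key : ∀ (c : Finset (Fin (N k))) (θ : (Fin d → ℕ) × (Fin d → ℕ)),
      bxJ v J (Function.update A k c) θ.1 θ.2 =
        (Finset.univ.filter (fun i : ∀ k, Fin (N k) => i k ∈ c)) ∩
          bxJ v J (Function.update A k Finset.univ) θ.1 θ.2 := by
    intro c θ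
    ext i
    rw [Finset.mem_inter, mem_bxJ_update _ _ _ _ _ _ _ hk, mem_bxJ_update _ _ _ _ _ _ _ hk]
    simp
  have := chain_max ξ hind hm (fun j => Finset.univ.filter (fun i : ∀ k, Fin (N k) => i k ∈ ch j))
    (fun a b hab i hi => by simp at hi ⊢; exact hch hab hi) (by simp [hch0])
    (fun θ : (Fin d → ℕ) × (Fin d → ℕ) => bxJ v J (Function.update A k Finset.univ) θ.1 θ.2)
    (fun θ => ∏ l ∈ J, max ((θ.1 l : ℝ) + θ.2 l + 1) (M l))
    (fun θ => Finset.prod_nonneg fun l _ => le_max_of_le_right (by linarith [hM l])) K hK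
    (fun i j hij x hx => by
      have h1 := ih (ch j \ ch i) x hx
      have e : ∀ θ : (Fin d → ℕ) × (Fin d → ℕ),
        ((Finset.univ.filter (fun e : ∀ k, Fin (N k) => e k ∈ ch j)) \
          (Finset.univ.filter (fun e : ∀ k, Fin (N k) => e k ∈ ch i))) ∩
          bxJ v J (Function.update A k Finset.univ) θ.1 θ.2 =
          bxJ v J (Function.update A k (ch j \ ch i)) θ.1 θ.2 := by
        intro θ
        rw [key (ch j \ ch i)]
        congr 1
        ext; simp
      simp only [e]
      refine h1.trans ?_
      have := hcard i j hij
      have h3 : ((ch j \ ch i).card : ℝ) ≤ (j:ℝ) - i := by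
        rw [← Nat.cast_sub hij]; exact_mod_cast this
      gcongr) T x hx (M k) (hM k)
  simpa only [← key] using this

def chEv (ξ : (∀ k, Fin (N k)) → Ω → ℝ) (v : ∀ k, Fin (N k)) (M : Fin d → ℝ) (J : Finset (Fin d)) (k : Fin d)
    (A : ∀ k, Finset (Fin (N k))) (ch : ℕ → Finset (Fin (N k))) (x : ℝ) : Set Ω :=
  {ω | ∃ j ≤ N k, ∃ θ : (Fin d → ℕ) × (Fin d → ℕ),
        x * ((∏ l ∈ J, max ((θ.1 l : ℝ) + θ.2 l + 1) (M l)) * max (j:ℝ) (M k)) ≤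
          |∑ e ∈ bxJ v J (Function.update A k (ch j)) θ.1 θ.2, ξ e ω|}

lemma J_sub (ξ : (∀ k, Fin (N k)) → Ω → ℝ) (v : ∀ k, Fin (N k)) (M : Fin d → ℝ)
    (hM : ∀ k, 1 ≤ M k) (J : Finset (Fin d)) (k : Fin d) (hk : k ∉ J)
    (A : ∀ k, Finset (Fin (N k))) (x : ℝ) (hx : 0 < x) :
    {ω | ∃ θ : (Fin d → ℕ) × (Fin d → ℕ),
        x * ∏ l ∈ insert k J, max ((θ.1 l : ℝ) + θ.2 l + 1) (M l) ≤
          |∑ e ∈ bxJ v (insert k J) A θ.1 θ.2, ξ e ω|} ⊆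
      chEv ξ v M J k A (leftc (v k)) (x / 2) ∪ chEv ξ v M J k A (rightc (v k)) (x / 2) := by
  rintro ω ⟨θ, hθ⟩
  have hdec : bxJ v (insert k J) A θ.1 θ.2 =
      bxJ v J (Function.update A k (leftc (v k) (min (θ.1 k) (N k)))) θ.1 θ.2 ∪
      bxJ v J (Function.update A k (rightc (v k) (min (θ.2 k + 1) (N k)))) θ.1 θ.2 := by
    have e1 : leftc (v k) (min (θ.1 k) (N k)) = leftc (v k) (θ.1 k) := by
      ext i
      simp only [leftc, Finset.mem_filter, Finset.mem_univ, true_and]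
      omega
    have e2 : rightc (v k) (min (θ.2 k + 1) (N k)) = rightc (v k) (θ.2 k + 1) := by
      ext i
      simp only [rightc, Finset.mem_filter, Finset.mem_univ, true_and]
      omega
    rw [e1, e2]
    ext i
    rw [Finset.mem_union, mem_bxJ_update _ _ _ _ _ _ _ hk, mem_bxJ_update _ _ _ _ _ _ _ hk,
      mem_bxJ, ← or_and_right, ← Finset.mem_union, ← ivl_eq]
    constructor
    · intro h
      refine ⟨(h k).1 (by simp), fun l => ⟨fun hl => (h l).1 (by simp [hl]), fun h1 h2 =>
        (h l).2 (by simp [h1, h2])⟩⟩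
    · rintro ⟨h0, h⟩ l
      refine ⟨fun hl => ?_, fun hl => ?_⟩
      · rcases Finset.mem_insert.1 hl with rfl | h1
        · exact h0
        · exact (h l).1 h1
      · rw [Finset.mem_insert, not_or] at hl
        exact (h l).2 hl.2 hl.1
  have hdisj : Disjoint
      (bxJ v J (Function.update A k (leftc (v k) (min (θ.1 k) (N k)))) θ.1 θ.2)
      (bxJ v J (Function.update A k (rightc (v k) (min (θ.2 k + 1) (N k)))) θ.1 θ.2) := by
    rw [Finset.disjoint_left]
    intro i
    rw [mem_bxJ_update _ _ _ _ _ _ _ hk, mem_bxJ_update _ _ _ _ _ _ _ hk]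
    rintro ⟨h1, _⟩ ⟨h2, _⟩
    exact Finset.disjoint_left.1 (lr_disj _ _ _) h1 h2
  rw [hdec, Finset.sum_union hdisj, Finset.prod_insert hk] at hθ
  set W := ∏ l ∈ J, max ((θ.1 l : ℝ) + θ.2 l + 1) (M l) with hW
  have hW0 : 0 ≤ W := Finset.prod_nonneg fun l _ => le_max_of_le_right (by linarith [hM l])
  set a := ∑ e ∈ bxJ v J (Function.update A k (leftc (v k) (min (θ.1 k) (N k)))) θ.1 θ.2, ξ e ω
  set b := ∑ e ∈ bxJ v J (Function.update A k (rightc (v k) (min (θ.2 k + 1) (N k)))) θ.1 θ.2, ξ e ω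
  set m1 := max ((θ.1 k : ℝ) + θ.2 k + 1) (M k) with hm1
  have hab := abs_add_le a b
  have hor : x / 2 * (W * m1) ≤ |a| ∨ x / 2 * (W * m1) ≤ |b| := by
    by_contra hcon
    push Not at hcon
    have : x * (m1 * W) = x / 2 * (W * m1) + x / 2 * (W * m1) := by ring
    linarith [hcon.1, hcon.2]
  have h0 : (0:ℝ) ≤ θ.1 k := Nat.cast_nonneg _
  have h0' : (0:ℝ) ≤ θ.2 k := Nat.cast_nonneg _
  rcases hor with h | h
  · left
    refine ⟨min (θ.1 k) (N k), min_le_right _ _, θ, le_trans ?_ h⟩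
    refine mul_le_mul_of_nonneg_left (mul_le_mul_of_nonneg_left (max_le_max ?_ le_rfl) hW0) (by linarith)
    have : ((min (θ.1 k) (N k) : ℕ):ℝ) ≤ θ.1 k := by exact_mod_cast min_le_left _ _
    linarith
  · right
    refine ⟨min (θ.2 k + 1) (N k), min_le_right _ _, θ, le_trans ?_ h⟩
    refine mul_le_mul_of_nonneg_left (mul_le_mul_of_nonneg_left (max_le_max ?_ le_rfl) hW0) (by linarith)
    have : ((min (θ.2 k + 1) (N k) : ℕ):ℝ) ≤ (θ.2 k + 1 : ℕ) := by exact_mod_cast min_le_left _ _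
    push_cast at this ⊢
    linarith

lemma master_J (ξ : (∀ k, Fin (N k)) → Ω → ℝ)
    (hind : iIndepFun ξ P) (hm : ∀ i, Measurable (ξ i)) (σ : ℝ)
    (hcheb : ∀ (A : Finset (∀ k, Fin (N k))) (x : ℝ), 0 < x →
      P.real {ω | x ≤ |∑ i ∈ A, ξ i ω|} ≤ σ ^ 2 * A.card / x ^ 2)
    (v : ∀ k, Fin (N k)) (M : Fin d → ℝ) (hM : ∀ k, 1 ≤ M k) (J : Finset (Fin d)) :
    ∀ (A : ∀ k, Finset (Fin (N k))) (x : ℝ), 0 < x →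
      P.real {ω | ∃ θ : (Fin d → ℕ) × (Fin d → ℕ),
        x * ∏ l ∈ J, max ((θ.1 l : ℝ) + θ.2 l + 1) (M l) ≤
          |∑ e ∈ bxJ v J A θ.1 θ.2, ξ e ω|} ≤
      (1152 ^ J.card * σ ^ 2 / ∏ l ∈ J, M l) * (∏ l ∈ Jᶜ, ((A l).card : ℝ)) / x ^ 2 := by
  induction J using Finset.induction_on with
  | empty =>
    intro A x hx
    have := hcheb (bxJ v ∅ A 0 0) x hx
    have e : ∀ θ : (Fin d → ℕ) × (Fin d → ℕ), bxJ v ∅ A θ.1 θ.2 = bxJ v ∅ A 0 0 := by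
      intro θ; simp [bxJ]
    simp only [e, Finset.prod_empty, mul_one, exists_const]
    refine this.trans (le_of_eq ?_)
    simp [bxJ, Fintype.card_piFinset]
  | insert k J hk ih =>
    intro A x hx
    have hMp : ∀ l, 0 < M l := fun l => by linarith [hM l]
    have hJM : 0 < ∏ l ∈ J, M l := Finset.prod_pos fun l _ => hMp l
    set K : ℝ := (1152 ^ J.card * σ ^ 2 / ∏ l ∈ J, M l) * (∏ l ∈ (insert k J)ᶜ, ((A l).card : ℝ)) with hKd
    have hK : 0 ≤ K := mul_nonneg (div_nonneg (mul_nonneg (pow_nonneg (by norm_num) _) (sq_nonneg σ)) hJM.le)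
      (Finset.prod_nonneg fun l _ => Nat.cast_nonneg _)
    have ih' : ∀ c : Finset (Fin (N k)), ∀ x : ℝ, 0 < x →
      P.real {ω | ∃ θ : (Fin d → ℕ) × (Fin d → ℕ),
        x * ∏ l ∈ J, max ((θ.1 l : ℝ) + θ.2 l + 1) (M l) ≤
          |∑ e ∈ bxJ v J (Function.update A k c) θ.1 θ.2, ξ e ω|} ≤ K * c.card / x ^ 2 := by
      intro c x hx
      refine (ih (Function.update A k c) x hx).trans (le_of_eq ?_)
      have h1 : Jᶜ = insert k (insert k J)ᶜ := by
        ext l; simp only [Finset.mem_compl, Finset.mem_insert]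
        by_cases h : l = k
        · subst h; simp [hk]
        · simp [h]
      rw [h1, Finset.prod_insert (by simp)]
      have h2 : ∏ l ∈ (insert k J)ᶜ, ((Function.update A k c l).card : ℝ) =
          ∏ l ∈ (insert k J)ᶜ, ((A l).card : ℝ) := by
        refine Finset.prod_congr rfl fun l hl => ?_
        rw [Function.update_of_ne]
        rintro rfl
        simp at hl
      rw [h2, Function.update_self, hKd]
      ring
    have hL := chain_step ξ hind hm v M hM J k hk K hK A ih' (leftc (v k))
      (leftc_mono _) (leftc_zero _) (fun i j hij => leftc_card _ hij) (x / 2) (by positivity) (N k)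
    have hR := chain_step ξ hind hm v M hM J k hk K hK A ih' (rightc (v k))
      (rightc_mono _) (rightc_zero _) (fun i j hij => rightc_card _ hij) (x / 2) (by positivity) (N k)
    have hsub := J_sub ξ v M hM J k hk A x hx
    set EL := chEv ξ v M J k A (leftc (v k)) (x / 2)
    set ER := chEv ξ v M J k A (rightc (v k)) (x / 2)
    calc _ ≤ P.real (EL ∪ ER) := measureReal_mono hsub (measure_ne_top _ _)
      _ ≤ P.real EL + P.real ER := measureReal_union_le _ _
      _ ≤ 144 * K / (M k * (x / 2) ^ 2) + 144 * K / (M k * (x / 2) ^ 2) := add_le_add hL hR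
      _ = _ := by
        rw [Finset.prod_insert hk, Finset.card_insert_of_notMem hk, hKd, pow_succ (1152:ℝ) J.card]
        generalize (1152:ℝ) ^ J.card = c1
        generalize (∏ l ∈ (insert k J)ᶜ, ((A l).card : ℝ)) = c2
        generalize (∏ l ∈ J, M l) = c3 at hJM
        have := hMp k
        field_simp
        ring

/-- The full box. -/
def bx (v : ∀ k, Fin (N k)) (p q : Fin d → ℕ) : Finset (∀ k, Fin (N k)) :=
  Fintype.piFinset (fun k => ivl (v k) (p k) (q k))

lemma master (ξ : (∀ k, Fin (N k)) → Ω → ℝ)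
    (hind : iIndepFun ξ P) (hm : ∀ i, Measurable (ξ i)) (σ : ℝ)
    (hcheb : ∀ (A : Finset (∀ k, Fin (N k))) (x : ℝ), 0 < x →
      P.real {ω | x ≤ |∑ i ∈ A, ξ i ω|} ≤ σ ^ 2 * A.card / x ^ 2)
    (v : ∀ k, Fin (N k)) (M : Fin d → ℝ) (hM : ∀ k, 1 ≤ M k) (x : ℝ) (hx : 0 < x) :
    P.real {ω | ∃ p q : Fin d → ℕ,
        x * ∏ l, max ((p l : ℝ) + q l + 1) (M l) ≤ |∑ e ∈ bx v p q, ξ e ω|} ≤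
      1152 ^ d * σ ^ 2 / (x ^ 2 * ∏ l, M l) := by
  have h := master_J ξ hind hm σ hcheb v M hM Finset.univ (fun _ => ∅) x hx
  have e : ∀ p q : Fin d → ℕ, bxJ v Finset.univ (fun _ => ∅) p q = bx v p q := by
    intro p q; simp [bxJ, bx]
  simp only [e, Prod.exists] at h
  refine h.trans (le_of_eq ?_)
  simp only [Finset.card_univ, Fintype.card_fin, Finset.compl_univ, Finset.prod_empty, mul_one]
  have : 0 < ∏ l, M l := Finset.prod_pos fun l _ => by linarith [hM l]
  field_simp
end


section
variable {d : ℕ} {N : Fin d → ℕ}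

lemma mem_ivl {m : ℕ} (v : Fin m) (p q : ℕ) (i : Fin m) :
    i ∈ ivl v p q ↔ (v : ℕ) ≤ i + p ∧ (i : ℕ) ≤ v + q := by
  simp only [ivl, Finset.mem_filter, Finset.mem_univ, true_and]

lemma mem_bx (v : ∀ k, Fin (N k)) (p q : Fin d → ℕ) (e : ∀ k, Fin (N k)) :
    e ∈ bx v p q ↔ ∀ k, (v k : ℕ) ≤ e k + p k ∧ (e k : ℕ) ≤ v k + q k := by
  simp only [bx, Fintype.mem_piFinset, mem_ivl]

/-- layer `(T', T]` in direction `k`, box in the others -/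
def lay (v : ∀ k, Fin (N k)) (k : Fin d) (T T' : ℕ) (p q : Fin d → ℕ) : Finset (∀ k, Fin (N k)) :=
  Finset.univ.filter (fun e => ((v k : ℕ) + T' < e k ∧ (e k : ℕ) ≤ v k + T) ∧
    ∀ j, j ≠ k → (v j : ℕ) ≤ e j + p j ∧ (e j : ℕ) ≤ v j + q j)

lemma mem_lay (v : ∀ k, Fin (N k)) (k : Fin d) (T T' : ℕ) (p q : Fin d → ℕ) (e : ∀ k, Fin (N k)) :
    e ∈ lay v k T T' p q ↔ ((v k : ℕ) + T' < e k ∧ (e k : ℕ) ≤ v k + T) ∧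
    ∀ j, j ≠ k → (v j : ℕ) ≤ e j + p j ∧ (e j : ℕ) ≤ v j + q j := by
  simp only [lay, Finset.mem_filter, Finset.mem_univ, true_and]

lemma mem_bx_update (v : ∀ k, Fin (N k)) (k : Fin d) (T : ℕ) (p q : Fin d → ℕ) (e : ∀ k, Fin (N k)) :
    e ∈ bx v p (Function.update q k T) ↔ ((v k : ℕ) ≤ e k + p k ∧ (e k : ℕ) ≤ v k + T) ∧
    ∀ j, j ≠ k → (v j : ℕ) ≤ e j + p j ∧ (e j : ℕ) ≤ v j + q j := by
  rw [mem_bx]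
  constructor
  · intro h
    refine ⟨by simpa using h k, fun j hj => by simpa [Function.update_of_ne hj] using h j⟩
  · rintro ⟨h0, h⟩ j
    by_cases hj : j = k
    · subst hj; simpa using h0
    · simpa [Function.update_of_ne hj] using h j hj

lemma bx_update_sub (v : ∀ k, Fin (N k)) (k : Fin d) (T T' : ℕ) (p q : Fin d → ℕ) (hT : T' ≤ T) :
    bx v p (Function.update q k T') ⊆ bx v p (Function.update q k T) := by
  intro e
  rw [mem_bx_update, mem_bx_update]
  rintro ⟨h1, h2⟩
  exact ⟨⟨h1.1, by omega⟩, h2⟩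

lemma lay_eq (v : ∀ k, Fin (N k)) (k : Fin d) (T T' : ℕ) (p q : Fin d → ℕ) :
    lay v k T T' p q = bx v p (Function.update q k T) \ bx v p (Function.update q k T') := by
  ext e
  rw [Finset.mem_sdiff, mem_lay, mem_bx_update, mem_bx_update]
  constructor
  · rintro ⟨h1, h2⟩
    exact ⟨⟨⟨by omega, h1.2⟩, h2⟩, fun h => by omega⟩
  · rintro ⟨⟨h1, h2⟩, h3⟩
    refine ⟨⟨?_, h1.2⟩, h2⟩
    by_contra h
    exact h3 ⟨⟨h1.1, by omega⟩, h2⟩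

lemma lay_sum (v : ∀ k, Fin (N k)) (k : Fin d) (T T' : ℕ) (p q : Fin d → ℕ) (hT : T' ≤ T)
    (g : (∀ k, Fin (N k)) → ℝ) :
    ∑ e ∈ lay v k T T' p q, g e =
      ∑ e ∈ bx v p (Function.update q k T), g e - ∑ e ∈ bx v p (Function.update q k T'), g e := by
  rw [lay_eq, Finset.sum_sdiff_eq_sub (bx_update_sub v k T T' p q hT)]

lemma lay_sub (v : ∀ k, Fin (N k)) (k : Fin d) (T T' : ℕ) (p q p' q' : Fin d → ℕ)
    (h : ∀ j, j ≠ k → p' j ≤ p j ∧ q' j ≤ q j) : lay v k T T' p' q' ⊆ lay v k T T' p q := by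
  intro e
  rw [mem_lay, mem_lay]
  rintro ⟨h1, h2⟩
  refine ⟨h1, fun j hj => ?_⟩
  have := h2 j hj
  have := h j hj
  omega

lemma lay_card (v : ∀ k, Fin (N k)) (k : Fin d) (T T' : ℕ) (p q : Fin d → ℕ)
    (hp : ∀ j, j ≠ k → p j ≤ v j) (hq : ∀ j, j ≠ k → v j + q j < N j) (hT : v k + T < N k)
    (hTT : T' ≤ T) :
    ((lay v k T T' p q).card : ℝ) = ((T:ℝ) - T') * ∏ j ∈ Finset.univ.erase k, ((p j : ℝ) + q j + 1) := by
  have : lay v k T T' p q = Fintype.piFinset (fun j => if j = k then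
      Finset.univ.filter (fun i : Fin (N j) => (v j : ℕ) + T' < i ∧ (i:ℕ) ≤ v j + T) else
      ivl (v j) (p j) (q j)) := by
    ext e
    rw [mem_lay, Fintype.mem_piFinset]
    constructor
    · rintro ⟨h1, h2⟩ j
      by_cases hj : j = k
      · subst hj; simpa using h1
      · simpa [hj, mem_ivl] using h2 j hj
    · intro h
      refine ⟨by simpa using h k, fun j hj => by simpa [hj, mem_ivl] using h j⟩
  rw [this, Fintype.card_piFinset, ← Finset.mul_prod_erase _ _ (Finset.mem_univ k)]
  push_cast
  congr 1
  · rw [if_pos rfl, card_eq_of_Ico _ (v k + T' + 1) (v k + T + 1) (by omega)]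
    · rw [← Nat.cast_sub hTT]; congr 1; omega
    · intro i; simp only [Finset.mem_filter, Finset.mem_univ, true_and]; omega
  · refine Finset.prod_congr rfl fun j hj => ?_
    have hj := Finset.ne_of_mem_erase hj
    rw [if_neg hj, ivl_card _ _ _ (hp j hj) (hq j hj)]
    push_cast; rfl

variable {Ω : Type*} [mΩ : MeasurableSpace Ω] {P : Measure Ω} [IsProbabilityMeasure P]

lemma master' (ξ : (∀ k, Fin (N k)) → Ω → ℝ)
    (hind : iIndepFun ξ P) (hm : ∀ i, Measurable (ξ i)) (σ : ℝ)
    (hcheb : ∀ (A : Finset (∀ k, Fin (N k))) (x : ℝ), 0 < x →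
      P.real {ω | x ≤ |∑ i ∈ A, ξ i ω|} ≤ σ ^ 2 * A.card / x ^ 2)
    (v : ∀ k, Fin (N k)) (M : Fin d → ℝ) (hM : ∀ k, 1 ≤ M k) (k : Fin d) (T : ℕ) (hT : 1 ≤ T)
    (C : ℝ) (hC : 0 ≤ C) (X : ℝ) (hX : 0 < X) :
    P.real {ω | ∃ p q : Fin d → ℕ, (∀ j, j ≠ k → (p j : ℝ) ≤ C * M j ∧ (q j : ℝ) ≤ C * M j) ∧
        p k ≤ T ∧ q k ≤ T ∧
        3 * (2 * C + 1) ^ d * X * √(∏ l, Function.update M k (T:ℝ) l) < |∑ e ∈ bx v p q, ξ e ω|} ≤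
      1152 ^ d * σ ^ 2 / X ^ 2 := by
  have hT' : (1:ℝ) ≤ T := by exact_mod_cast hT
  have hM' : ∀ l, 1 ≤ Function.update M k (T:ℝ) l := by
    intro l
    by_cases h : l = k
    · subst h; simpa using hT
    · simpa [Function.update_of_ne h] using hM l
  set M' := Function.update M k (T:ℝ) with hM'd
  have hpos : 0 < ∏ l, M' l := Finset.prod_pos fun l _ => by linarith [hM' l]
  have hs : 0 < √(∏ l, M' l) := Real.sqrt_pos.2 hpos
  have h := master ξ hind hm σ hcheb v M' hM' (X / √(∏ l, M' l)) (by positivity)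
  rw [div_pow, Real.sq_sqrt hpos.le, div_mul_cancel₀ _ hpos.ne'] at h
  refine le_trans (measureReal_mono ?_ (measure_ne_top _ _)) h
  rintro ω ⟨p, q, hpq, hpk, hqk, hlt⟩
  refine ⟨p, q, le_trans ?_ hlt.le⟩
  have hb : ∏ l, max ((p l : ℝ) + q l + 1) (M' l) ≤ 3 * (2 * C + 1) ^ d * ∏ l, M' l := by
    calc ∏ l, max ((p l : ℝ) + q l + 1) (M' l) ≤
        ∏ l, ((if l = k then 3 else 1) * (2 * C + 1) * M' l) := by
          refine Finset.prod_le_prod (fun l _ => le_max_of_le_right (by linarith [hM' l])) fun l _ => ?_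
          by_cases hl : l = k
          · subst hl
            simp only [if_true, hM'd, Function.update_self]
            have h1 : (p l:ℝ) ≤ T := by exact_mod_cast hpk
            have h2 : (q l:ℝ) ≤ T := by exact_mod_cast hqk
            have : 0 ≤ C * T := by positivity
            apply max_le <;> nlinarith
          · have := hpq l hl
            have h3 := hM l
            simp only [hl, if_false, hM'd, Function.update_of_ne hl]
            have : 0 ≤ C * M l := by positivity
            apply max_le <;> nlinarith
      _ = 3 * (2 * C + 1) ^ d * ∏ l, M' l := by
          rw [Finset.prod_mul_distrib, Finset.prod_mul_distrib]
          simp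
  calc X / √(∏ l, M' l) * ∏ l, max ((p l : ℝ) + q l + 1) (M' l)
      ≤ X / √(∏ l, M' l) * (3 * (2 * C + 1) ^ d * ∏ l, M' l) := by gcongr
    _ = 3 * (2 * C + 1) ^ d * X * ((∏ l, M' l) / √(∏ l, M' l)) := by ring
    _ = _ := by rw [Real.div_sqrt]
end


section
variable {d : ℕ} {N : Fin d → ℕ}

lemma lay_sum_zero (v : ∀ k, Fin (N k)) (k : Fin d) (T T' : ℕ) (p q : Fin d → ℕ) (hT : T' ≤ T)
    {g : (∀ k, Fin (N k)) → ℝ} :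
      ∑ e ∈ bx v (Function.update p k 0) (Function.update q k T), g e -
      ∑ e ∈ bx v (Function.update p k 0) (Function.update q k T'), g e =
      ∑ e ∈ lay v k T T' p q, g e := by
  rw [← lay_sum v k T T' (Function.update p k 0) q hT]
  refine Finset.sum_congr ?_ fun _ _ => rfl
  ext e
  rw [mem_lay, mem_lay]
  refine and_congr_right fun _ => forall_congr' fun j => forall_congr' fun hj => ?_
  rw [Function.update_of_ne hj]

/-- admissible side lengths -/
def adm (M : Fin d → ℝ) (C : ℝ) (k : Fin d) (bp bq p q : Fin d → ℕ) : Prop :=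
  ∀ j, j ≠ k → (bp j ≤ p j ∧ (p j : ℝ) ≤ C * M j) ∧ (bq j ≤ q j ∧ (q j : ℝ) ≤ C * M j)

noncomputable def tauk (M : Fin d → ℝ) (k : Fin d) (T : ℕ) : ℝ := √(∏ l, Function.update M k (T:ℝ) l)

lemma tauk_eq (M : Fin d → ℝ) (k : Fin d) (T : ℕ) :
    tauk M k T = √((T:ℝ) * ∏ l ∈ Finset.univ.erase k, M l) := by
  rw [tauk, ← Finset.mul_prod_erase _ _ (Finset.mem_univ k), Function.update_self]
  congr 2
  refine Finset.prod_congr rfl fun j hj => ?_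
  rw [Function.update_of_ne (Finset.ne_of_mem_erase hj)]

def layBad {Ω : Type*} (ξ : (∀ k, Fin (N k)) → Ω → ℝ) (v : ∀ k, Fin (N k)) (M : Fin d → ℝ) (C B : ℝ)
    (k : Fin d) (T T' : ℕ) (bp bq : Fin d → ℕ) : Set Ω :=
  {ω | ∃ θ : {θ : (Fin d → ℕ) × (Fin d → ℕ) // adm M C k bp bq θ.1 θ.2},
    B * tauk M k T ≤ |∑ e ∈ lay v k T T' θ.1.1 θ.1.2 \ lay v k T T' bp bq, ξ e ω|}

def layG {Ω : Type*} (ξ : (∀ k, Fin (N k)) → Ω → ℝ) (v : ∀ k, Fin (N k)) (M : Fin d → ℝ) (C B : ℝ)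
    (k : Fin d) (T T' : ℕ) (bp bq : Fin d → ℕ) : Set Ω :=
  {ω | ∑ e ∈ lay v k T T' bp bq, ξ e ω ≤ - (2 * B * tauk M k T)} ∩
  (layBad ξ v M C B k T T' bp bq)ᶜ

lemma layG_bound {Ω : Type*} (ξ : (∀ k, Fin (N k)) → Ω → ℝ) (v : ∀ k, Fin (N k)) (M : Fin d → ℝ) (C B : ℝ)
    (k : Fin d) (T T' : ℕ) (bp bq : Fin d → ℕ) (ω : Ω) (hω : ω ∈ layG ξ v M C B k T T' bp bq)
    (p q : Fin d → ℕ) (h : adm M C k bp bq p q) :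
    ∑ e ∈ lay v k T T' p q, ξ e ω ≤ - (B * tauk M k T) := by
  have h1 := hω.1
  have h2 := hω.2
  simp only [Set.mem_ofPred_eq] at h1
  simp only [layBad, Set.mem_compl_iff, Set.mem_ofPred_eq, not_exists, not_le] at h2
  have h3 := h2 ⟨(p, q), h⟩
  rw [Finset.sum_sdiff_eq_sub (lay_sub v k T T' p q bp bq fun j hj => ⟨(h j hj).1.1, (h j hj).2.1⟩)] at h3
  have := (abs_lt.1 h3).2
  linarith

variable {Ω : Type*} [mΩ : MeasurableSpace Ω] {P : Measure Ω} [IsProbabilityMeasure P]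

lemma layG_meas (ξ : (∀ k, Fin (N k)) → Ω → ℝ) (v : ∀ k, Fin (N k)) (M : Fin d → ℝ) (C B : ℝ)
    (k : Fin d) (T T' : ℕ) (bp bq : Fin d → ℕ) :
    MeasurableSet[sgA ξ {e | (v k : ℕ) + T' < e k ∧ (e k : ℕ) ≤ v k + T}] (layG ξ v M C B k T T' bp bq) := by
  have hsub : ∀ p q, ((lay v k T T' p q : Finset _) : Set (∀ k, Fin (N k))) ⊆
      {e | (v k : ℕ) + T' < e k ∧ (e k : ℕ) ≤ v k + T} := by
    intro p q e he
    exact ((mem_lay _ _ _ _ _ _ _).1 he).1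
  refine MeasurableSet.inter (m := sgA ξ {e | (v k : ℕ) + T' < e k ∧ (e k : ℕ) ≤ v k + T}) ?_ ?_
  · exact (sgA_sum ξ (lay v k T T' bp bq) (hsub _ _)) measurableSet_Iic
  · refine MeasurableSet.compl (m := sgA ξ {e | (v k : ℕ) + T' < e k ∧ (e k : ℕ) ≤ v k + T}) ?_
    exact meas_ex_ge _ (fun θ => sgA_sum ξ _ (fun e he => hsub _ _ (Finset.sdiff_subset he))) _

lemma one_layer (ξ : (∀ k, Fin (N k)) → Ω → ℝ)
    (hind : iIndepFun ξ P) (hm : ∀ i, Measurable (ξ i)) (σ : ℝ)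
    (hcheb : ∀ (A : Finset (∀ k, Fin (N k))) (x : ℝ), 0 < x →
      P.real {ω | x ≤ |∑ i ∈ A, ξ i ω|} ≤ σ ^ 2 * A.card / x ^ 2)
    (pr K' : ℝ) (hpr : 0 < pr) (hK' : 0 < K') (D0 : ℕ)
    (hclt : ∀ A : Finset (∀ k, Fin (N k)), D0 ≤ A.card →
      pr ≤ P.real {ω | ∑ i ∈ A, ξ i ω ≤ - K' * √A.card})
    (v : ∀ k, Fin (N k)) (M : Fin d → ℝ) (hM : ∀ k, 1 ≤ M k) (k : Fin d) (T T' : ℕ) (hT : 1 ≤ T)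
    (hTT : 2 * T' ≤ T) (hTD : 2 * D0 ≤ T) (hvT : v k + T < N k)
    (C : ℝ) (hC : 0 ≤ C) (X : ℝ) (hX : 0 < X) (hXs : 1152 ^ d * σ ^ 2 / X ^ 2 ≤ 1 / 2)
    (b : ℝ) (hb : 0 < b) (hb1 : b ≤ 1)
    (hK2 : 2 * (13 * (2 * C + 1) ^ d * X) ≤ K' * √(b ^ d / 2))
    (bp bq : Fin d → ℕ) (hbp : ∀ j, j ≠ k → bp j ≤ v j) (hbq : ∀ j, j ≠ k → v j + bq j < N j)
    (hbb : ∀ j, j ≠ k → b * M j ≤ (bp j : ℝ) + bq j + 1)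
    (hbC : ∀ j, j ≠ k → (bp j : ℝ) ≤ C * M j ∧ (bq j : ℝ) ≤ C * M j) :
    pr / 2 ≤ P.real (layG ξ v M C (13 * (2 * C + 1) ^ d * X) k T T' bp bq) := by
  set B := 13 * (2 * C + 1) ^ d * X with hB
  have hT'T : T' ≤ T := by omega
  have hTr : (1:ℝ) ≤ T := by exact_mod_cast hT
  have hC1 : 0 < (2 * C + 1) ^ d := by positivity
  have hMe : 0 < ∏ l ∈ Finset.univ.erase k, M l := Finset.prod_pos fun l _ => by linarith [hM l]
  have hτ : 0 < tauk M k T := by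
    rw [tauk_eq]; exact Real.sqrt_pos.2 (by positivity)
  have hind2 := sgA_indep (P := P) ξ hind hm
    (A := ((lay v k T T' bp bq : Finset _) : Set (∀ k, Fin (N k))))
    (B := ((lay v k T T' bp bq : Finset _) : Set (∀ k, Fin (N k)))ᶜ) disjoint_compl_right
    (E := {ω | ∑ e ∈ lay v k T T' bp bq, ξ e ω ≤ - (2 * B * tauk M k T)})
    (F := (layBad ξ v M C B k T T' bp bq)ᶜ)
    ((sgA_sum ξ (lay v k T T' bp bq) subset_rfl) measurableSet_Iic)
    (MeasurableSet.compl (m := sgA ξ ((lay v k T T' bp bq : Finset _) : Set (∀ k, Fin (N k)))ᶜ)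
      (meas_ex_ge _ (fun θ => sgA_sum ξ _ (fun e he => (Finset.mem_sdiff.1 he).2)) _))
  rw [layG, hind2]
  have hbadm : MeasurableSet (layBad ξ v M C B k T T' bp bq) :=
    meas_ex_ge _ (fun θ => Finset.measurable_fun_sum _ fun i _ => hm i) _
  have h1 : pr ≤ P.real {ω | ∑ e ∈ lay v k T T' bp bq, ξ e ω ≤ - (2 * B * tauk M k T)} := by
    have hcard := lay_card v k T T' bp bq hbp hbq hvT hT'T
    have hT2 : (T:ℝ) / 2 ≤ (T:ℝ) - T' := by
      have : (2:ℝ) * T' ≤ T := by exact_mod_cast hTT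
      linarith
    have hpr1 : (1:ℝ) ≤ ∏ j ∈ Finset.univ.erase k, ((bp j : ℝ) + bq j + 1) := by
      refine Finset.one_le_prod fun j _ => ?_
      have h1 : (0:ℝ) ≤ bp j := Nat.cast_nonneg _
      have h2 : (0:ℝ) ≤ bq j := Nat.cast_nonneg _
      linarith
    have hD : D0 ≤ (lay v k T T' bp bq).card := by
      have : (D0:ℝ) ≤ (lay v k T T' bp bq).card := by
        rw [hcard]
        have : (2:ℝ) * D0 ≤ T := by exact_mod_cast hTD
        nlinarith
      exact_mod_cast this
    refine (hclt _ hD).trans (measureReal_mono ?_ (measure_ne_top _ _))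
    intro ω hω
    simp only [Set.mem_ofPred_eq] at hω ⊢
    refine hω.trans ?_
    rw [neg_mul]
    refine neg_le_neg ?_
    have hcb : (b ^ d / 2) * ((T:ℝ) * ∏ l ∈ Finset.univ.erase k, M l) ≤ ((lay v k T T' bp bq).card : ℝ) := by
      rw [hcard]
      have h2 : b ^ d * ∏ l ∈ Finset.univ.erase k, M l ≤ ∏ j ∈ Finset.univ.erase k, ((bp j : ℝ) + bq j + 1) := by
        calc b ^ d * ∏ l ∈ Finset.univ.erase k, M l ≤
            b ^ (Finset.univ.erase k).card * ∏ l ∈ Finset.univ.erase k, M l := by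
              refine mul_le_mul_of_nonneg_right ?_ hMe.le
              refine pow_le_pow_of_le_one hb.le hb1 ?_
              exact (Finset.card_le_univ _).trans (by simp)
          _ = ∏ j ∈ Finset.univ.erase k, (b * M j) := by
              rw [Finset.prod_mul_distrib, Finset.prod_const]
          _ ≤ _ := Finset.prod_le_prod (fun j _ => by have := hM j; positivity)
              fun j hj => hbb j (Finset.ne_of_mem_erase hj)
      calc (b ^ d / 2) * ((T:ℝ) * ∏ l ∈ Finset.univ.erase k, M l) =
          (T / 2) * (b ^ d * ∏ l ∈ Finset.univ.erase k, M l) := by ring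
        _ ≤ _ := mul_le_mul hT2 h2 (by positivity) (by linarith)
    have h4 : √(b ^ d / 2) * tauk M k T ≤ √((lay v k T T' bp bq).card : ℝ) := by
      rw [tauk_eq, ← Real.sqrt_mul (by positivity)]
      exact Real.sqrt_le_sqrt hcb
    calc 2 * B * tauk M k T ≤ (K' * √(b ^ d / 2)) * tauk M k T := by gcongr
      _ = K' * (√(b ^ d / 2) * tauk M k T) := by ring
      _ ≤ _ := by gcongr
  have h2 : P.real (layBad ξ v M C B k T T' bp bq) ≤ 1 / 2 := by
    refine le_trans (measureReal_mono ?_ (measure_ne_top _ _))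
      ((master' ξ hind hm σ hcheb v M hM k T hT C hC X hX).trans hXs)
    rintro ω ⟨⟨⟨p, q⟩, h⟩, hω⟩
    simp only at h hω
    rw [Finset.sum_sdiff_eq_sub (lay_sub v k T T' p q bp bq fun j hj => ⟨(h j hj).1.1, (h j hj).2.1⟩),
      ← lay_sum_zero v k T T' p q hT'T, ← lay_sum_zero v k T T' bp bq hT'T] at hω
    by_contra hcon
    simp only [Set.mem_ofPred_eq, not_exists, not_and, not_lt] at hcon
    have key : ∀ (p q : Fin d → ℕ) (t : ℕ), t ≤ T →
        (∀ j, j ≠ k → (p j : ℝ) ≤ C * M j ∧ (q j : ℝ) ≤ C * M j) →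
        |∑ e ∈ bx v (Function.update p k 0) (Function.update q k t), ξ e ω| ≤
          3 * (2 * C + 1) ^ d * X * tauk M k T := by
      intro p q t ht hpq
      refine hcon _ _ (fun j hj => ?_) (by simp) (by simpa using ht)
      rw [Function.update_of_ne hj, Function.update_of_ne hj]
      exact hpq j hj
    have hpq : ∀ j, j ≠ k → (p j : ℝ) ≤ C * M j ∧ (q j : ℝ) ≤ C * M j :=
      fun j hj => ⟨(h j hj).1.2, (h j hj).2.2⟩
    have a1 := abs_le.1 (key p q T le_rfl hpq)
    have a2 := abs_le.1 (key p q T' hT'T hpq)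
    have a3 := abs_le.1 (key bp bq T le_rfl hbC)
    have a4 := abs_le.1 (key bp bq T' hT'T hbC)
    have hpos : 0 < (2 * C + 1) ^ d * X * tauk M k T := by positivity
    have e1 : B * tauk M k T = 13 * ((2 * C + 1) ^ d * X * tauk M k T) := by rw [hB]; ring
    have e2 : 3 * (2 * C + 1) ^ d * X * tauk M k T = 3 * ((2 * C + 1) ^ d * X * tauk M k T) := by ring
    rw [e2] at a1 a2 a3 a4
    rw [e1] at hω
    rcases le_abs.1 hω with h | h <;> linarith [a1.1, a1.2, a2.1, a2.2, a3.1, a3.2, a4.1, a4.2]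
  have h3 : 1 / 2 ≤ P.real (layBad ξ v M C B k T T' bp bq)ᶜ := by
    rw [probReal_compl_eq_one_sub hbadm]; linarith
  calc pr / 2 = pr * (1 / 2) := by ring
    _ ≤ _ := mul_le_mul h1 h3 (by norm_num) measureReal_nonneg
end


section
variable {d : ℕ} {N : Fin d → ℕ}
variable {Ω : Type*} [mΩ : MeasurableSpace Ω] {P : Measure Ω} [IsProbabilityMeasure P]

lemma seq_layers (ξ : (∀ k, Fin (N k)) → Ω → ℝ)
    (hind : iIndepFun ξ P) (hm : ∀ i, Measurable (ξ i)) (v : ∀ k, Fin (N k)) (M : Fin d → ℝ)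
    (C B : ℝ) (k : Fin d) (T : ℕ → ℕ) (bp bq : Fin d → ℕ) (r : ℝ) (hr1 : r ≤ 1) (m : ℕ)
    (hT : ∀ i < m, T (i + 1) ≤ T i)
    (hG : ∀ i < m, r ≤ P.real (layG ξ v M C B k (T i) (T (i + 1)) bp bq)) :
    MeasurableSet[sgA ξ {e | (v k : ℕ) + T m < e k}]
      {ω | ∀ i < m, ω ∉ layG ξ v M C B k (T i) (T (i + 1)) bp bq} ∧
    P.real {ω | ∀ i < m, ω ∉ layG ξ v M C B k (T i) (T (i + 1)) bp bq} ≤ (1 - r) ^ m := by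
  induction m with
  | zero =>
    constructor
    · simp
    · simp
  | succ m ih =>
    obtain ⟨ih1, ih2⟩ := ih (fun i hi => hT i (by omega)) (fun i hi => hG i (by omega))
    have e : {ω | ∀ i < m + 1, ω ∉ layG ξ v M C B k (T i) (T (i + 1)) bp bq} =
        {ω | ∀ i < m, ω ∉ layG ξ v M C B k (T i) (T (i + 1)) bp bq} ∩
          (layG ξ v M C B k (T m) (T (m + 1)) bp bq)ᶜ := by
      ext ω
      simp only [Set.mem_ofPred_eq, Set.mem_inter_iff, Set.mem_compl_iff]
      constructor
      · intro h
        exact ⟨fun i hi => h i (by omega), h m (by omega)⟩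
      · rintro ⟨h1, h2⟩ i hi
        rcases Nat.lt_succ_iff_lt_or_eq.1 hi with h | rfl
        · exact h1 i h
        · exact h2
    have hmm := layG_meas ξ v M C B k (T m) (T (m + 1)) bp bq
    have hmc := MeasurableSet.compl
      (m := sgA ξ {e | (v k : ℕ) + T (m + 1) < e k ∧ (e k : ℕ) ≤ v k + T m}) hmm
    have hTm := hT m (by omega)
    rw [e]
    constructor
    · refine MeasurableSet.inter (m := sgA ξ {e | (v k : ℕ) + T (m + 1) < e k}) ?_ ?_
      · refine sgA_mono ξ ?_ _ ih1
        intro e he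
        simp only [Set.mem_ofPred_eq] at he ⊢
        omega
      · refine sgA_mono ξ ?_ _ hmc
        intro e he
        simp only [Set.mem_ofPred_eq] at he ⊢
        omega
    · rw [sgA_indep ξ hind hm ?_ ih1 hmc, pow_succ,
        probReal_compl_eq_one_sub (sgA_le ξ hm _ _ hmm)]
      · have := hG m (by omega)
        have h1 := measureReal_le_one (μ := P) (s := layG ξ v M C B k (T m) (T (m + 1)) bp bq)
        exact mul_le_mul ih2 (by linarith) (by linarith) (pow_nonneg (by linarith) _)
      · rw [Set.disjoint_left]
        intro e h1 h2
        simp only [Set.mem_ofPred_eq] at h1 h2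
        omega

/-- the favourable event of Lemma Neg -/
def negGood (ξ : (∀ k, Fin (N k)) → Ω → ℝ) (v : ∀ k, Fin (N k)) (M : Fin d → ℝ) (C Kst t0 b' : ℝ)
    (k : Fin d) (bp bq : Fin d → ℕ) (ω : Ω) : Prop :=
  ∃ t : ℕ, b' * M k ≤ t ∧ (t:ℝ) ≤ t0 * M k ∧ ∀ p q, adm M C k bp bq p q →
    (p k : ℝ) ≤ b' * M k → (q k : ℝ) ≤ b' * M k →
    ∑ e ∈ bx v p (Function.update q k t), ξ e ω ≤ - (Kst * (t / M k) * √(∏ l, M l)) ∧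
    ∑ e ∈ bx v p (Function.update q k t), ξ e ω - ∑ e ∈ bx v p q, ξ e ω ≤
      - (Kst * (t / M k) * √(∏ l, M l))

lemma neg_scale (ξ : (∀ k, Fin (N k)) → Ω → ℝ) (v : ∀ k, Fin (N k)) (M : Fin d → ℝ)
    (hM : ∀ k, 1 ≤ M k) (C Kst t0 b' ts B W : ℝ) (hKst : 0 < Kst) (hts : ts ≤ t0) (hB : 0 < B)
    (hts0 : 0 < ts) (hts2 : ts ≤ (B / (2 * Kst)) ^ 2) (hW : 0 < W)
    (k : Fin d) (bp bq : Fin d → ℕ) (ω : Ω) (T T' : ℕ) (ρ : ℝ) (hρ : 0 < ρ)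
    (hTr : (T':ℝ) ≤ 2 * ρ * T) (hTT : T' ≤ T) (hWρ : W * √(2 * ρ) ≤ B / 4)
    (hTts : (T:ℝ) ≤ ts * M k) (hTb : b' * M k ≤ T)
    (hT'b : ∀ x : ℕ, (x:ℝ) ≤ b' * M k → x ≤ T')
    (hG : ω ∈ layG ξ v M C B k T T' bp bq)
    (hL : ∀ p q : Fin d → ℕ, (∀ j, j ≠ k → (p j : ℝ) ≤ C * M j ∧ (q j : ℝ) ≤ C * M j) →
        p k ≤ T' → q k ≤ T' → |∑ e ∈ bx v p q, ξ e ω| ≤ W * tauk M k T') :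
    negGood ξ v M C Kst t0 b' k bp bq ω := by
  have hMk : 0 < M k := by linarith [hM k]
  have hMe : 0 < ∏ l ∈ Finset.univ.erase k, M l := Finset.prod_pos fun l _ => by linarith [hM l]
  refine ⟨T, hTb, hTts.trans (by gcongr), ?_⟩
  have hMp : ∏ l, M l = M k * ∏ l ∈ Finset.univ.erase k, M l :=
    (Finset.mul_prod_erase _ _ (Finset.mem_univ k)).symm
  have hτ : tauk M k T = √T * √(∏ l ∈ Finset.univ.erase k, M l) := by
    rw [tauk_eq, Real.sqrt_mul (by positivity)]
  have hτ' : W * tauk M k T' ≤ B / 4 * tauk M k T := by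
    rw [tauk_eq, tauk_eq]
    calc W * √((T':ℝ) * ∏ l ∈ Finset.univ.erase k, M l) ≤
        W * √((2 * ρ) * ((T:ℝ) * ∏ l ∈ Finset.univ.erase k, M l)) := by
          refine mul_le_mul_of_nonneg_left (Real.sqrt_le_sqrt ?_) hW.le
          nlinarith
      _ = (W * √(2 * ρ)) * √((T:ℝ) * ∏ l ∈ Finset.univ.erase k, M l) := by
          rw [Real.sqrt_mul (by positivity), mul_assoc]
      _ ≤ _ := by gcongr
  have hfin : Kst * (T / M k) * √(∏ l, M l) ≤ B / 2 * tauk M k T := by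
    rw [hMp, Real.sqrt_mul hMk.le, hτ]
    have h1 : (T:ℝ) / M k ≤ ts := by rw [div_le_iff₀ hMk]; exact hTts
    have h2 : √((T:ℝ) / M k) ≤ B / (2 * Kst) := by
      rw [Real.sqrt_le_left (by positivity)]
      exact h1.trans hts2
    have h3 : (T:ℝ) / M k * √(M k) = √T * √((T:ℝ) / M k) := by
      rw [Real.sqrt_div (by positivity)]
      have e1 := Real.mul_self_sqrt (Nat.cast_nonneg T : (0:ℝ) ≤ T)
      have e2 := Real.mul_self_sqrt hMk.le
      have e3 := Real.sqrt_pos.2 hMk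
      rw [mul_div_assoc', e1, div_mul_eq_mul_div, div_eq_div_iff hMk.ne' e3.ne', mul_assoc, e2]
    calc Kst * (T / M k) * (√(M k) * √(∏ l ∈ Finset.univ.erase k, M l)) =
        Kst * ((T:ℝ) / M k * √(M k)) * √(∏ l ∈ Finset.univ.erase k, M l) := by ring
      _ = (Kst * √((T:ℝ) / M k)) * (√T * √(∏ l ∈ Finset.univ.erase k, M l)) := by rw [h3]; ring
      _ ≤ (Kst * (B / (2 * Kst))) * (√T * √(∏ l ∈ Finset.univ.erase k, M l)) := by gcongr
      _ = _ := by field_simp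
  intro p q hpq hp hq
  have h1 := layG_bound ξ v M C B k T T' bp bq ω hG p q hpq
  rw [lay_sum v k T T' p q hTT] at h1
  have hpq' : ∀ j, j ≠ k → (p j : ℝ) ≤ C * M j ∧ (q j : ℝ) ≤ C * M j :=
    fun j hj => ⟨(hpq j hj).1.2, (hpq j hj).2.2⟩
  have h2 := abs_le.1 (hL p q hpq' (hT'b _ hp) (hT'b _ hq))
  have h3 := abs_le.1 (hL p (Function.update q k T')
    (fun j hj => by rw [Function.update_of_ne hj]; exact hpq' j hj) (hT'b _ hp) (by simp))
  have h4 : 0 ≤ tauk M k T := Real.sqrt_nonneg _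
  have h5 := mul_nonneg hB.le h4
  constructor
  · linarith [h3.1, h3.2]
  · linarith [h2.1, h2.2, h3.1, h3.2]
end


lemma exX (A ε : ℝ) (hA : 0 < A) (hε : 0 < ε) : ∃ X : ℝ, 0 < X ∧ A / X ^ 2 ≤ ε := by
  refine ⟨√(A / ε), Real.sqrt_pos.2 (by positivity), ?_⟩
  rw [Real.sq_sqrt (by positivity)]
  field_simp
  rfl

set_option maxHeartbeats 1600000 in
lemma neg_event (μ : Measure ℝ) [IsProbabilityMeasure μ] (σ : ℝ) (hσ : 0 < σ)
    (hmean : ∫ x, x ∂μ = 0) (hvar : ∫ x, x ^ 2 ∂μ = σ ^ 2)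
    (hL2 : Integrable (fun x : ℝ => x ^ 2) μ) (d : ℕ)
    (C b Kst t0 η : ℝ) (hC : 0 ≤ C) (hb : 0 < b) (hb1 : b ≤ 1) (hKst : 0 < Kst) (ht0 : 0 < t0)
    (hη : 0 < η) :
    ∃ b' : ℝ, 0 < b' ∧ b' ≤ t0 ∧ ∃ D : ℝ, ∀ {Ω : Type*} [MeasurableSpace Ω] (P : Measure Ω)
      [IsProbabilityMeasure P] (N : Fin d → ℕ) (ξ : (∀ k, Fin (N k)) → Ω → ℝ)
      (_ : iIndepFun ξ P) (_ : ∀ i, Measurable (ξ i)) (_ : ∀ i, P.map (ξ i) = μ)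
      (v : ∀ k, Fin (N k)) (M : Fin d → ℝ) (_ : ∀ k, 1 ≤ M k) (k : Fin d) (_ : D ≤ M k)
      (bp bq : Fin d → ℕ) (_ : ∀ j, j ≠ k → bp j ≤ v j) (_ : ∀ j, j ≠ k → v j + bq j < N j)
      (_ : ∀ j, j ≠ k → b * M j ≤ (bp j : ℝ) + bq j + 1)
      (_ : ∀ j, j ≠ k → (bp j : ℝ) ≤ C * M j ∧ (bq j : ℝ) ≤ C * M j)
      (_ : (v k : ℝ) + t0 * M k < N k),
      P.real {ω | ¬ negGood ξ v M C Kst t0 b' k bp bq ω} ≤ η := by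
  have hA : 0 < 1152 ^ d * σ ^ 2 := by positivity
  have hC1 : 0 < (2 * C + 1) ^ d := by positivity
  obtain ⟨X0, hX0, hX0s⟩ := exX _ (1 / 2) hA (by norm_num)
  obtain ⟨B, hB⟩ : ∃ B, B = 13 * (2 * C + 1) ^ d * X0 := ⟨_, rfl⟩
  have hBp : 0 < B := by rw [hB]; positivity
  have hsb : 0 < √(b ^ d / 2) := Real.sqrt_pos.2 (by positivity)
  obtain ⟨pr, hpr, D0, hclt⟩ := clt_lower μ σ hσ hmean hvar hL2 (2 * B / √(b ^ d / 2))
  obtain ⟨r, hrd⟩ : ∃ r, r = min (pr / 2) (1/2) := ⟨_, rfl⟩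
  have hr : 0 < r := by rw [hrd]; positivity
  have hr1 : r ≤ 1 / 2 := by rw [hrd]; exact min_le_right _ _
  have hrp : r ≤ pr / 2 := by rw [hrd]; exact min_le_left _ _
  obtain ⟨m, hm⟩ := exists_pow_lt_of_lt_one (show 0 < η / 2 by positivity) (show 1 - r < 1 by linarith)
  obtain ⟨X1, hX1, hX1s⟩ := exX _ (η / (2 * (m + 1))) hA (by positivity)
  obtain ⟨W, hW⟩ : ∃ W, W = 3 * (2 * C + 1) ^ d * X1 := ⟨_, rfl⟩
  have hWp : 0 < W := by rw [hW]; positivity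
  obtain ⟨ρ, hρ, hρ1, hWρ⟩ : ∃ ρ : ℝ, 0 < ρ ∧ ρ ≤ 1 / 4 ∧ W * √(2 * ρ) ≤ B / 4 := by
    refine ⟨min (1/4) ((B / (4 * W)) ^ 2 / 2), by positivity, min_le_left _ _, ?_⟩
    have h1 : √(2 * min (1/4) ((B / (4 * W)) ^ 2 / 2)) ≤ B / (4 * W) := by
      rw [Real.sqrt_le_left (by positivity)]
      have := min_le_right (1/4) ((B / (4 * W)) ^ 2 / 2)
      linarith
    calc _ ≤ W * (B / (4 * W)) := by gcongr
      _ = _ := by field_simp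
  obtain ⟨ts, hts0, hts, hts2⟩ : ∃ ts : ℝ, 0 < ts ∧ ts ≤ t0 ∧ ts ≤ (B / (2 * Kst)) ^ 2 :=
    ⟨min t0 ((B / (2 * Kst)) ^ 2), by positivity, min_le_left _ _, min_le_right _ _⟩
  have hρm : ∀ i, ρ ^ i ≤ 1 := fun i => pow_le_one₀ hρ.le (by linarith)
  have hb'0 : 0 < ts * ρ ^ m := by positivity
  refine ⟨ts * ρ ^ m, hb'0, ?_, (4 * D0 + 4) / (ts * ρ ^ m), ?_⟩
  · exact (mul_le_of_le_one_right hts0.le (hρm m)).trans hts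
  intro Ω _ P _ N ξ hind hξm hlaw v M hM k hD bp bq hbp hbq hbb hbC hvk
  have hcheb := cheb_sum μ σ hmean hvar hL2 ξ hind hξm hlaw
  have hMk : 0 < M k := by linarith [hM k]
  rw [div_le_iff₀ hb'0] at hD
  obtain ⟨y, hy⟩ : ∃ y : ℕ → ℝ, ∀ i, y i = ts * ρ ^ i * M k := ⟨_, fun _ => rfl⟩
  have hD0 : (0:ℝ) ≤ D0 := Nat.cast_nonneg _
  have hym : ∀ i ≤ m, 4 * D0 + 4 ≤ y i := by
    intro i hi
    rw [hy]
    have : ρ ^ m ≤ ρ ^ i := pow_le_pow_of_le_one hρ.le (by linarith) hi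
    have : ts * ρ ^ m * M k ≤ ts * ρ ^ i * M k := by gcongr
    linarith
  have hys : ∀ i, y (i + 1) = ρ * y i := by intro i; rw [hy, hy]; ring
  obtain ⟨T, hT⟩ : ∃ T : ℕ → ℕ, ∀ i, T i = ⌊y i⌋₊ := ⟨_, fun _ => rfl⟩
  have hypos : ∀ i, 0 ≤ y i := fun i => by rw [hy]; positivity
  have hTle : ∀ i, (T i : ℝ) ≤ y i := fun i => by rw [hT]; exact Nat.floor_le (hypos i)
  have hTge : ∀ i ≤ m, y i / 2 ≤ T i := by
    intro i hi
    have := Nat.lt_floor_add_one (y i)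
    rw [← hT] at this
    have := hym i hi
    linarith
  have hstep : ∀ i < m, (T (i+1) : ℝ) ≤ 2 * ρ * T i := by
    intro i hi
    have h1 := hTle (i+1)
    rw [hys] at h1
    have h2 := hTge i hi.le
    calc _ ≤ ρ * y i := h1
      _ ≤ ρ * (2 * T i) := mul_le_mul_of_nonneg_left (by linarith) hρ.le
      _ = _ := by ring
  have hstep2 : ∀ i < m, 2 * T (i + 1) ≤ T i := by
    intro i hi
    have h1 := hstep i hi
    have h2 : (0:ℝ) ≤ T i := Nat.cast_nonneg _
    have h3 := mul_le_mul_of_nonneg_right hρ1 h2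
    have : (2:ℝ) * T (i+1) ≤ T i := by linarith
    exact_mod_cast this
  have hTD : ∀ i ≤ m, 2 * D0 + 2 ≤ T i := by
    intro i hi
    have h1 := hTge i hi
    have h2 := hym i hi
    have : (2:ℝ) * D0 + 2 ≤ T i := by linarith
    exact_mod_cast this
  have hyts : ∀ i, y i ≤ ts * M k := by
    intro i
    rw [hy]
    have := hρm i
    have : ts * ρ ^ i ≤ ts := mul_le_of_le_one_right hts0.le (hρm i)
    gcongr
  have hTN : ∀ i, v k + T i < N k := by
    intro i
    have h1 := hTle i
    have h2 := hyts i
    have h3 : ts * M k ≤ t0 * M k := by gcongr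
    have : (v k : ℝ) + T i < N k := by linarith
    exact_mod_cast this
  have hseq := (seq_layers ξ hind hξm v M C B k T bp bq r (by linarith) m
    (fun i hi => by have := hstep2 i hi; omega) (fun i hi => by
      refine hrp.trans ?_
      rw [hB]
      refine one_layer ξ hind hξm σ hcheb pr (2 * B / √(b ^ d / 2)) hpr (by positivity) D0
        (fun A hA => hclt P ξ hind hξm hlaw A hA) v M hM k (T i) (T (i+1)) ?_ (hstep2 i hi) ?_ (hTN i)
        C hC X0 hX0 hX0s b hb hb1 ?_ bp bq hbp hbq hbb hbC
      · have := hTD i hi.le; omega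
      · have := hTD i hi.le; omega
      · rw [← hB, div_mul_cancel₀ _ hsb.ne'])).2
  obtain ⟨F, hF⟩ : ∃ F : ℕ → Set Ω, ∀ i, F i = {ω | ∃ p q : Fin d → ℕ,
      (∀ j, j ≠ k → (p j : ℝ) ≤ C * M j ∧ (q j : ℝ) ≤ C * M j) ∧ p k ≤ T (i+1) ∧ q k ≤ T (i+1) ∧
        3 * (2 * C + 1) ^ d * X1 * √(∏ l, Function.update M k (T (i+1):ℝ) l) < |∑ e ∈ bx v p q, ξ e ω|} :=
    ⟨_, fun _ => rfl⟩
  have hFp : ∀ i < m, P.real (F i) ≤ η / (2 * (m + 1)) := by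
    intro i hi
    rw [hF]
    exact (master' ξ hind hξm σ hcheb v M hM k (T (i+1)) (by have := hTD (i+1) hi; omega) C hC X1 hX1).trans hX1s
  have hsub : {ω | ¬ negGood ξ v M C Kst t0 (ts * ρ ^ m) k bp bq ω} ⊆
      {ω | ∀ i < m, ω ∉ layG ξ v M C B k (T i) (T (i + 1)) bp bq} ∪ ⋃ i ∈ Finset.range m, F i := by
    intro ω hω
    by_contra hcon
    simp only [Set.mem_union, Set.mem_ofPred_eq, Set.mem_iUnion, Finset.mem_range, not_or, not_forall,
      not_exists, not_not] at hcon
    obtain ⟨⟨i, hi, hG⟩, hnF⟩ := hcon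
    apply hω
    refine neg_scale ξ v M hM C Kst t0 (ts * ρ ^ m) ts B W hKst hts hBp hts0 hts2 hWp k bp bq ω (T i) (T (i+1))
      ρ hρ (hstep i hi) (by have := hstep2 i hi; omega) hWρ ((hTle i).trans (hyts i)) ?_ ?_ hG ?_
    · have h1 := hTge i hi.le
      have h3 : ts * ρ ^ m * M k ≤ ts * ρ ^ (i+1) * M k := by
        have : ρ ^ m ≤ ρ ^ (i+1) := pow_le_pow_of_le_one hρ.le (by linarith) hi
        gcongr
      rw [← hy (i+1), hys] at h3
      have := mul_le_mul_of_nonneg_right hρ1 (hypos i)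
      have := hypos i
      linarith
    · intro x hx
      rw [hT]
      apply Nat.le_floor
      refine hx.trans ?_
      rw [hy]
      have : ρ ^ m ≤ ρ ^ (i+1) := pow_le_pow_of_le_one hρ.le (by linarith) hi
      gcongr
    · intro p q hpq hp hq
      have := hnF i hi
      rw [hF] at this
      simp only [Set.mem_ofPred_eq, not_exists, not_and, not_lt] at this
      rw [hW]
      exact this p q hpq hp hq
  calc _ ≤ P.real ({ω | ∀ i < m, ω ∉ layG ξ v M C B k (T i) (T (i + 1)) bp bq} ∪ ⋃ i ∈ Finset.range m, F i) :=
        measureReal_mono hsub (measure_ne_top _ _)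
    _ ≤ (1 - r) ^ m + ∑ i ∈ Finset.range m, P.real (F i) :=
        (measureReal_union_le _ _).trans (add_le_add hseq (measureReal_biUnion_finset_le _ _))
    _ ≤ η / 2 + ∑ i ∈ Finset.range m, η / (2 * (m + 1)) := by
        gcongr with i hi
        exact hFp i (Finset.mem_range.1 hi)
    _ ≤ η := by
        simp only [Finset.sum_const, Finset.card_range, nsmul_eq_mul]
        have : (m:ℝ) * (η / (2 * (m + 1))) ≤ η / 2 := by
          rw [mul_div_assoc', div_le_div_iff₀ (by positivity) (by norm_num)]
          linarith
        linarith


section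
variable {d : ℕ} {N : Fin d → ℕ}

lemma bx_card (v : ∀ k, Fin (N k)) (p q : Fin d → ℕ) (hp : ∀ j, p j ≤ v j) (hq : ∀ j, v j + q j < N j) :
    ((bx v p q).card : ℝ) = ∏ j, ((p j : ℝ) + q j + 1) := by
  rw [bx, Fintype.card_piFinset]
  push_cast
  refine Finset.prod_congr rfl fun j _ => ?_
  rw [ivl_card _ _ _ (hp j) (hq j)]
  push_cast; rfl

lemma bx_card_pos (v : ∀ k, Fin (N k)) (p q : Fin d → ℕ) : 0 < ((bx v p q).card : ℝ) := by
  have : (bx v p q).Nonempty := ⟨v, by rw [mem_bx]; intro k; omega⟩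
  exact_mod_cast this.card_pos

/-- block average -/
noncomputable def Av (g : (∀ k, Fin (N k)) → ℝ) (v : ∀ k, Fin (N k)) (p q : Fin d → ℕ) : ℝ :=
  (∑ e ∈ bx v p q, g e) / (bx v p q).card

def MM (μ : Fin d → ℝ) : Fin d → ℝ := fun j => max 1 (μ j)

lemma MM_ge (μ : Fin d → ℝ) (j : Fin d) : 1 ≤ MM μ j := le_max_left _ _

noncomputable def ww (μ : Fin d → ℝ) : ℝ := (√(∏ j, MM μ j))⁻¹

lemma PM_pos (μ : Fin d → ℝ) : 0 < ∏ j, MM μ j :=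
  Finset.prod_pos fun j _ => by linarith [MM_ge μ j]

lemma ww_pos (μ : Fin d → ℝ) : 0 < ww μ :=
  inv_pos.2 (Real.sqrt_pos.2 (PM_pos μ))

lemma ww_mul (μ : Fin d → ℝ) : ww μ * ∏ j, MM μ j = √(∏ j, MM μ j) := by
  have h := Real.mul_self_sqrt (PM_pos μ).le
  have h2 := Real.sqrt_pos.2 (PM_pos μ)
  rw [ww]
  rw [inv_mul_eq_div, Real.div_sqrt]

lemma noise_le (ξ : (∀ k, Fin (N k)) → ℝ) (v : ∀ k, Fin (N k)) (μ : Fin d → ℝ) (X : ℝ) (hX : 0 < X)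
    (hms : ∀ p q : Fin d → ℕ, |∑ e ∈ bx v p q, ξ e| ≤ X * ww μ * ∏ l, max ((p l : ℝ) + q l + 1) (MM μ l))
    (p q : Fin d → ℕ) (hp : ∀ j, p j ≤ v j) (hq : ∀ j, v j + q j < N j) (b : ℝ) (hb : 0 < b) (hb1 : b ≤ 1)
    (hbM : ∀ j, b * μ j ≤ (p j : ℝ) + q j + 1) :
    |∑ e ∈ bx v p q, ξ e| ≤ (X / b ^ d * ww μ) * (bx v p q).card := by
  refine (hms p q).trans ?_
  rw [bx_card v p q hp hq]
  have hw := ww_pos μ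
  have h : ∏ l, max ((p l : ℝ) + q l + 1) (MM μ l) ≤ (∏ j, ((p j : ℝ) + q j + 1)) / b ^ d := by
    have e : (∏ j, ((p j : ℝ) + q j + 1)) / b ^ d = ∏ j, (((p j : ℝ) + q j + 1) / b) := by
      rw [Finset.prod_div_distrib]; simp
    rw [e]
    refine Finset.prod_le_prod (fun l _ => le_max_of_le_right (by linarith [MM_ge μ l])) fun l _ => ?_
    have h1 : (0:ℝ) ≤ p l := Nat.cast_nonneg _
    have h2 : (0:ℝ) ≤ q l := Nat.cast_nonneg _
    rw [le_div_iff₀ hb]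
    have h3 := hbM l
    rcases max_choice ((p l : ℝ) + q l + 1) (MM μ l) with h | h <;> rw [h]
    · nlinarith
    · rcases max_choice 1 (μ l) with h' | h' <;> rw [MM, h']
      · linarith
      · linarith
  calc X * ww μ * ∏ l, max ((p l : ℝ) + q l + 1) (MM μ l) ≤
      X * ww μ * ((∏ j, ((p j : ℝ) + q j + 1)) / b ^ d) := by gcongr
    _ = _ := by ring

lemma frac_card (v : ∀ k, Fin (N k)) (p q : Fin d → ℕ) (k : Fin d) (B : Finset (Fin (N k)))
    (hB : B ⊆ ivl (v k) (p k) (q k)) (h3 : (ivl (v k) (p k) (q k)).card ≤ 3 * B.card) :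
    (bx v p q).card ≤ 3 * ((bx v p q).filter (fun e => e k ∈ B)).card := by
  have e : (bx v p q).filter (fun e => e k ∈ B) =
      Fintype.piFinset (Function.update (fun j => ivl (v j) (p j) (q j)) k B) := by
    ext e
    simp only [Finset.mem_filter, bx, Fintype.mem_piFinset]
    constructor
    · rintro ⟨h1, h2⟩ j
      by_cases hj : j = k
      · subst hj; simpa using h2
      · simpa [Function.update_of_ne hj] using h1 j
    · intro h
      have hk : e k ∈ B := by simpa using h k
      refine ⟨fun j => ?_, hk⟩
      by_cases hj : j = k
      · subst hj; exact hB hk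
      · simpa [Function.update_of_ne hj] using h j
  rw [e, bx, Fintype.card_piFinset, Fintype.card_piFinset,
    ← Finset.mul_prod_erase _ _ (Finset.mem_univ k), ← Finset.mul_prod_erase _ _ (Finset.mem_univ k),
    Function.update_self, ← mul_assoc]
  refine Nat.mul_le_mul h3 (le_of_eq (Finset.prod_congr rfl fun j hj => ?_))
  rw [Function.update_of_ne (Finset.ne_of_mem_erase hj)]

lemma sum_frac (f : (∀ k, Fin (N k)) → ℝ) (v : ∀ k, Fin (N k)) (p q : Fin d → ℕ) (k : Fin d)
    (B : Finset (Fin (N k)))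
    (hB : B ⊆ ivl (v k) (p k) (q k)) (h3 : (ivl (v k) (p k) (q k)).card ≤ 3 * B.card)
    (K1 K2 : ℝ) (hK : 0 ≤ K1 + K2) (h1 : ∀ e ∈ bx v p q, f e ≤ K1)
    (h2 : ∀ e ∈ bx v p q, e k ∈ B → f e ≤ -K2) :
    ∑ e ∈ bx v p q, f e ≤ (K1 - (K1 + K2) / 3) * (bx v p q).card := by
  have h4 := frac_card v p q k B hB h3
  have h5 : ((bx v p q).card : ℝ) ≤ 3 * ((bx v p q).filter (fun e => e k ∈ B)).card := by exact_mod_cast h4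
  calc ∑ e ∈ bx v p q, f e ≤ ∑ e ∈ bx v p q, (K1 - if e k ∈ B then (K1 + K2) else 0) := by
        refine Finset.sum_le_sum fun e he => ?_
        by_cases h : e k ∈ B
        · simp only [h, if_true]; linarith [h2 e he h]
        · simp only [h, if_false]; linarith [h1 e he]
    _ = K1 * (bx v p q).card - (K1 + K2) * ((bx v p q).filter (fun e => e k ∈ B)).card := by
        rw [Finset.sum_sub_distrib, ← Finset.sum_filter]
        simp [mul_comm]
        try ring
    _ ≤ _ := by nlinarith

lemma low_count {m : ℕ} (v : Fin m) (p q : ℕ) (hp : p ≤ v) (hq : v + q < m) (R : ℝ) (μ : ℝ) (hR : 0 ≤ R * μ)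
    (h : 3 * (R * μ) ≤ p) (hq1 : q + 1 ≤ p) :
    (ivl v p q).card ≤ 3 * ((ivl v p q).filter (fun i : Fin m => ((i:ℕ):ℝ) + R * μ < ((v:ℕ):ℝ))).card := by
  rw [ivl_card v p q hp hq, card_eq_of_Ico _ (v - p) (v - ⌊R * μ⌋₊) (by omega)]
  · have h1 := Nat.floor_le hR
    have : 3 * (⌊R * μ⌋₊ : ℝ) ≤ p := by linarith
    have : 3 * ⌊R * μ⌋₊ ≤ p := by exact_mod_cast this
    omega
  · intro i
    rw [Finset.mem_filter, mem_ivl]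
    have key : ((i:ℕ):ℝ) + R * μ < ((v:ℕ):ℝ) ↔ (i:ℕ) < v - ⌊R * μ⌋₊ := by
      constructor
      · intro h
        have h1 := Nat.floor_le hR
        have : ((i:ℕ):ℝ) + ⌊R * μ⌋₊ < (v:ℕ) := by linarith
        have : (i:ℕ) + ⌊R * μ⌋₊ < v := by exact_mod_cast this
        omega
      · intro h
        have h1 := Nat.lt_floor_add_one (R * μ)
        have : (i:ℕ) + (⌊R * μ⌋₊ + 1) ≤ v := by omega
        have : ((i:ℕ):ℝ) + (⌊R * μ⌋₊ + 1) ≤ (v:ℕ) := by exact_mod_cast this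
        linarith
    rw [key]
    omega

lemma up_count {m : ℕ} (v : Fin m) (p q : ℕ) (hp : p ≤ v) (hq : v + q < m) (R : ℝ) (μ : ℝ) (hR : 0 ≤ R * μ)
    (h : 3 * (R * μ) ≤ q) (hq1 : p + 1 ≤ q) :
    (ivl v p q).card ≤ 3 * ((ivl v p q).filter (fun i : Fin m => ((v:ℕ):ℝ) + R * μ < ((i:ℕ):ℝ))).card := by
  rw [ivl_card v p q hp hq, card_eq_of_Ico _ (v + ⌊R * μ⌋₊ + 1) (v + q + 1) (by omega)]
  · have h1 := Nat.floor_le hR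
    have : 3 * (⌊R * μ⌋₊ : ℝ) ≤ q := by linarith
    have : 3 * ⌊R * μ⌋₊ ≤ q := by exact_mod_cast this
    omega
  · intro i
    rw [Finset.mem_filter, mem_ivl]
    have key : ((v:ℕ):ℝ) + R * μ < ((i:ℕ):ℝ) ↔ (v:ℕ) + ⌊R * μ⌋₊ < i := by
      constructor
      · intro h
        have h1 := Nat.floor_le hR
        have : ((v:ℕ):ℝ) + ⌊R * μ⌋₊ < (i:ℕ) := by linarith
        exact_mod_cast this
      · intro h
        have h1 := Nat.lt_floor_add_one (R * μ)
        have : (v:ℕ) + (⌊R * μ⌋₊ + 1) ≤ i := by omega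
        have : ((v:ℕ):ℝ) + (⌊R * μ⌋₊ + 1) ≤ (i:ℕ) := by exact_mod_cast this
        linarith
    rw [key]
    omega

def UpB (f : (∀ k, Fin (N k)) → ℝ) (v : ∀ k, Fin (N k)) (μ : Fin d → ℝ) (C K : ℝ) : Prop :=
  ∀ e, (∀ j, (e j : ℝ) ≤ v j + C * μ j) → f e ≤ K
def LoB (f : (∀ k, Fin (N k)) → ℝ) (v : ∀ k, Fin (N k)) (μ : Fin d → ℝ) (C K : ℝ) : Prop :=
  ∀ e, (∀ j, (v j : ℝ) ≤ e j + C * μ j) → -K ≤ f e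
def DnB (f : (∀ k, Fin (N k)) → ℝ) (v : ∀ k, Fin (N k)) (μ : Fin d → ℝ) (C K R : ℝ) : Prop :=
  ∀ e, (∀ j, (e j : ℝ) ≤ v j + C * μ j) → (∃ k, (e k : ℝ) + R * μ k < v k) → f e ≤ -K
def UuB (f : (∀ k, Fin (N k)) → ℝ) (v : ∀ k, Fin (N k)) (μ : Fin d → ℝ) (C K R : ℝ) : Prop :=
  ∀ e, (∀ j, (v j : ℝ) ≤ e j + C * μ j) → (∃ k, (v k : ℝ) + R * μ k < e k) → K ≤ f e

lemma bx_up (v : ∀ k, Fin (N k)) (μ : Fin d → ℝ) (C : ℝ) (p q : Fin d → ℕ) (hq : ∀ j, (q j:ℝ) ≤ C * μ j)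
    (e) (he : e ∈ bx v p q) : ∀ j, (e j : ℝ) ≤ v j + C * μ j := by
  intro j
  have h1 := ((mem_bx v p q e).1 he j).2
  have : ((e j : ℕ):ℝ) ≤ (v j : ℕ) + q j := by exact_mod_cast h1
  linarith [hq j]
lemma bx_lo (v : ∀ k, Fin (N k)) (μ : Fin d → ℝ) (C : ℝ) (p q : Fin d → ℕ) (hp : ∀ j, (p j:ℝ) ≤ C * μ j)
    (e) (he : e ∈ bx v p q) : ∀ j, (v j : ℝ) ≤ e j + C * μ j := by
  intro j
  have h1 := ((mem_bx v p q e).1 he j).1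
  have : ((v j : ℕ):ℝ) ≤ (e j : ℕ) + p j := by exact_mod_cast h1
  linarith [hp j]

lemma Av_le (f ξ : (∀ k, Fin (N k)) → ℝ) (v : ∀ k, Fin (N k)) (p q : Fin d → ℕ) (A B : ℝ)
    (hf : ∑ e ∈ bx v p q, f e ≤ A * (bx v p q).card) (hξ : ∑ e ∈ bx v p q, ξ e ≤ B * (bx v p q).card) :
    Av (fun e => f e + ξ e) v p q ≤ A + B := by
  rw [Av, div_le_iff₀ (bx_card_pos v p q), Finset.sum_add_distrib]
  linarith

lemma le_Av (f ξ : (∀ k, Fin (N k)) → ℝ) (v : ∀ k, Fin (N k)) (p q : Fin d → ℕ) (A B : ℝ)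
    (hf : A * (bx v p q).card ≤ ∑ e ∈ bx v p q, f e) (hξ : B * (bx v p q).card ≤ ∑ e ∈ bx v p q, ξ e) :
    A + B ≤ Av (fun e => f e + ξ e) v p q := by
  rw [Av, le_div_iff₀ (bx_card_pos v p q), Finset.sum_add_distrib]
  linarith

lemma sum_le_const (f : (∀ k, Fin (N k)) → ℝ) (s : Finset (∀ k, Fin (N k))) (K : ℝ) (h : ∀ e ∈ s, f e ≤ K) :
    ∑ e ∈ s, f e ≤ K * s.card := by
  have := Finset.sum_le_card_nsmul s f K h
  rw [nsmul_eq_mul] at this; linarith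
lemma const_le_sum (f : (∀ k, Fin (N k)) → ℝ) (s : Finset (∀ k, Fin (N k))) (K : ℝ) (h : ∀ e ∈ s, K ≤ f e) :
    K * s.card ≤ ∑ e ∈ s, f e := by
  have := Finset.card_nsmul_le_sum s f K h
  rw [nsmul_eq_mul] at this; linarith
end


section
variable {d : ℕ} {N : Fin d → ℕ}

structure SetUp (v : ∀ k, Fin (N k)) (μ : Fin d → ℝ) : Prop where
  h01 : ∀ j, μ j = 0 ∨ 1 ≤ μ j
  hv : ∀ j, μ j ≤ v j
  hN : ∀ j, (v j : ℝ) + μ j < N j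

noncomputable def fl (μ : Fin d → ℝ) : Fin d → ℕ := fun j => ⌊μ j⌋₊

lemma SetUp.nn {v : ∀ k, Fin (N k)} {μ : Fin d → ℝ} (h : SetUp v μ) (j) : 0 ≤ μ j := by
  rcases h.h01 j with h | h <;> linarith

lemma SetUp.fl_le {v : ∀ k, Fin (N k)} {μ : Fin d → ℝ} (h : SetUp v μ) (j) : (fl μ j : ℝ) ≤ μ j :=
  Nat.floor_le (h.nn j)

lemma lt_fl (μ : Fin d → ℝ) (j) : μ j < fl μ j + 1 := Nat.lt_floor_add_one _

lemma SetUp.fl_v {v : ∀ k, Fin (N k)} {μ : Fin d → ℝ} (h : SetUp v μ) (j) : fl μ j ≤ v j := by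
  have := (h.fl_le j).trans (h.hv j)
  exact_mod_cast this

lemma SetUp.leN {v : ∀ k, Fin (N k)} {μ : Fin d → ℝ} (h : SetUp v μ) (j) (t : ℕ) (ht : (t:ℝ) ≤ μ j) :
    (v j : ℕ) + t < N j := by
  have : ((v j : ℕ):ℝ) + t < N j := by linarith [h.hN j]
  exact_mod_cast this

lemma SetUp.fl_N {v : ∀ k, Fin (N k)} {μ : Fin d → ℝ} (h : SetUp v μ) (j) : (v j : ℕ) + fl μ j < N j :=
  h.leN j _ (h.fl_le j)

lemma SetUp.MM_eq {v : ∀ k, Fin (N k)} {μ : Fin d → ℝ} (h : SetUp v μ) (j) (h0 : 0 < μ j) : MM μ j = μ j := by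
  rcases h.h01 j with h | h
  · linarith
  · exact max_eq_right h

lemma MM_le (μ : Fin d → ℝ) (j) : μ j ≤ MM μ j := le_max_right _ _

variable (f ξ : (∀ k, Fin (N k)) → ℝ) (v : ∀ k, Fin (N k)) (μ : Fin d → ℝ)

def HMS (ξ : (∀ k, Fin (N k)) → ℝ) (v : ∀ k, Fin (N k)) (μ : Fin d → ℝ) (X : ℝ) : Prop :=
  ∀ p q : Fin d → ℕ, |∑ e ∈ bx v p q, ξ e| ≤ X * ww μ * ∏ l, max ((p l : ℝ) + q l + 1) (MM μ l)

lemma stp1 (hs : SetUp v μ) (K X : ℝ) (hX : 0 < X) (hms : HMS ξ v μ X) (hlo : LoB f v μ 1 (K * ww μ))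
    (q : Fin d → ℕ) (hq : ∀ j, v j + q j < N j) :
    -((K + X) * ww μ) ≤ Av (fun e => f e + ξ e) v (fl μ) q := by
  have h1 := noise_le ξ v μ X hX hms (fl μ) q hs.fl_v hq 1 one_pos le_rfl (fun j => by
    have := lt_fl μ j
    have : (0:ℝ) ≤ q j := Nat.cast_nonneg _
    linarith)
  have h2 := const_le_sum f (bx v (fl μ) q) (-(K * ww μ)) (fun e he =>
    hlo e (bx_lo v μ 1 _ _ (fun j => by linarith [hs.fl_le j]) e he))
  have h3 := le_Av f ξ v (fl μ) q _ (-(X * ww μ)) h2 (by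
    have := (abs_le.1 h1).1
    rw [one_pow, div_one] at this
    linarith)
  linarith

lemma stp2 (hs : SetUp v μ) (K1 K2 R C1 X : ℝ) (hX : 0 < X) (hms : HMS ξ v μ X)
    (hK : 0 ≤ K1 + K2) (hR : 0 ≤ R) (hC : 3 * R ≤ C1) (hC2 : 2 ≤ C1)
    (hup : UpB f v μ 1 (K1 * ww μ)) (hdn : DnB f v μ 1 (K2 * ww μ) R)
    (p : Fin d → ℕ) (hp : ∀ j, p j ≤ v j) (k : Fin d) (hk : C1 * μ k < p k) :
    Av (fun e => f e + ξ e) v p (fl μ) ≤ (K1 - (K1 + K2) / 3 + X) * ww μ := by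
  have hw := ww_pos μ
  have hn := hs.nn k
  have h1 := noise_le ξ v μ X hX hms p (fl μ) hp hs.fl_N 1 one_pos le_rfl (fun j => by
    have := lt_fl μ j
    have : (0:ℝ) ≤ p j := Nat.cast_nonneg _
    linarith)
  have hb : ∀ e ∈ bx v p (fl μ), ∀ j, (e j : ℝ) ≤ v j + 1 * μ j :=
    bx_up v μ 1 p (fl μ) (fun j => by linarith [hs.fl_le j])
  have hRC := mul_le_mul_of_nonneg_right hC hn
  have hC2' := mul_le_mul_of_nonneg_right hC2 hn
  have hpk : fl μ k + 1 ≤ p k := by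
    have hf := hs.fl_le k
    have : (fl μ k : ℝ) < p k := by linarith
    exact_mod_cast this
  have h2 := sum_frac f v p (fl μ) k _ (Finset.filter_subset _ _)
    (low_count (v k) (p k) (fl μ k) (hp k) (hs.fl_N k) R (μ k) (mul_nonneg hR hn) (by linarith) hpk)
    (K1 * ww μ) (K2 * ww μ) (by rw [← add_mul]; exact mul_nonneg hK hw.le) (fun e he => hup e (hb e he))
    (fun e he hek => hdn e (hb e he) ⟨k, (Finset.mem_filter.1 hek).2⟩)
  have h3 := Av_le f ξ v p (fl μ) _ (X * ww μ) h2 (by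
    have := (abs_le.1 h1).2
    rw [one_pow, div_one] at this
    linarith)
  linarith

lemma prod_bd (M : Fin d → ℝ) (hM : ∀ j, 1 ≤ M j) (k : Fin d) (g : Fin d → ℝ) (A c : ℝ) (hA : 1 ≤ A) (hc : 0 ≤ c)
    (hg0 : ∀ j, 0 ≤ g j)
    (hg : ∀ j, j ≠ k → g j ≤ A * M j) :
    c * ∏ j ∈ Finset.univ.erase k, g j ≤ (c / M k) * (A ^ d * ∏ j, M j) := by
  have hMk : 0 < M k := by linarith [hM k]
  have h1 : ∏ j ∈ Finset.univ.erase k, g j ≤ ∏ j ∈ Finset.univ.erase k, (A * M j) :=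
    Finset.prod_le_prod (fun j _ => hg0 j) fun j hj => hg j (Finset.ne_of_mem_erase hj)
  have h2 : ∏ j ∈ Finset.univ.erase k, (A * M j) ≤ A ^ d * (∏ j, M j) / M k := by
    rw [le_div_iff₀ hMk]
    have e : A ^ d * ∏ j, M j = ∏ j, (A * M j) := by
      rw [Finset.prod_mul_distrib]; simp
    rw [e, ← Finset.prod_erase_mul _ _ (Finset.mem_univ k)]
    refine mul_le_mul_of_nonneg_left (by nlinarith) (Finset.prod_nonneg fun j _ => ?_)
    have := hM j
    positivity
  calc c * ∏ j ∈ Finset.univ.erase k, g j ≤ c * (A ^ d * (∏ j, M j) / M k) := by gcongr; exact h1.trans h2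
    _ = _ := by ring

lemma stp3 {Ω : Type*} (ξ : (∀ k, Fin (N k)) → Ω → ℝ) (ω : Ω) (hs : SetUp v μ) (K1 C1 b' Kst : ℝ)
    (hb : 0 < b') (hKst : 0 < Kst) (hC1 : 1 ≤ C1)
    (hup : UpB f v μ 1 (K1 * ww μ)) (p : Fin d → ℕ) (hp : ∀ j, p j ≤ v j) (hpC : ∀ j, (p j : ℝ) ≤ C1 * μ j)
    (k : Fin d) (hpk : (p k : ℝ) < b' * μ k)
    (hng : negGood ξ v (MM μ) C1 Kst 1 b' k (fun _ => 0) (fl μ) ω) :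
    ∃ t : ℕ, b' * μ k ≤ t ∧ (t:ℝ) ≤ μ k ∧
      Av (fun e => f e + ξ e ω) v p (Function.update (fl μ) k t) ≤
        (K1 - Kst / (3 * (C1 + 2) ^ d)) * ww μ := by
  have hw := ww_pos μ
  have hPM := PM_pos μ
  have hk0 : 0 < μ k := by
    have : (0:ℝ) ≤ p k := Nat.cast_nonneg _
    by_contra h
    have := hs.nn k
    have : μ k = 0 := by linarith
    rw [this] at hpk
    linarith
  have hMk := hs.MM_eq k hk0
  obtain ⟨t, ht1, ht2, ht⟩ := hng
  rw [hMk] at ht1 ht2 ht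
  rw [one_mul] at ht2
  refine ⟨t, ht1, ht2, ?_⟩
  have hMC : ∀ j, MM μ j ≤ C1 * MM μ j := fun j => by
    have := MM_ge μ j
    nlinarith
  have h1 := (ht p (Function.update (fl μ) k 0) (by
    intro j hj
    rw [Function.update_of_ne hj]
    refine ⟨⟨Nat.zero_le _, ?_⟩, le_rfl, ?_⟩
    · exact (hpC j).trans (mul_le_mul_of_nonneg_left (MM_le μ j) (by linarith))
    · exact (hs.fl_le j).trans ((MM_le μ j).trans (hMC j))) hpk.le (by simp; positivity)).1
  rw [Function.update_idem] at h1
  have htpos : 0 < (t:ℝ) := lt_of_lt_of_le (by positivity) ht1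
  have ht1' : (1:ℝ) ≤ t := by exact_mod_cast (by exact_mod_cast htpos : 0 < t)
  have hqN : ∀ j, v j + Function.update (fl μ) k t j < N j := by
    intro j
    by_cases hj : j = k
    · subst hj; simpa using hs.leN j t ht2
    · rw [Function.update_of_ne hj]; exact hs.fl_N j
  have hq1 : ∀ j, ((Function.update (fl μ) k t j : ℕ) : ℝ) ≤ 1 * μ j := by
    intro j
    by_cases hj : j = k
    · subst hj; simpa using ht2
    · rw [Function.update_of_ne hj]; linarith [hs.fl_le j]
  have hcard : ((bx v p (Function.update (fl μ) k t)).card : ℝ) ≤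
      (3 * t / μ k) * ((C1 + 2) ^ d * ∏ j, MM μ j) := by
    rw [bx_card v p _ hp hqN, ← Finset.mul_prod_erase _ _ (Finset.mem_univ k)]
    rw [Function.update_self]
    have h2 := prod_bd (MM μ) (MM_ge μ) k (fun j => (p j : ℝ) + (Function.update (fl μ) k t j : ℕ) + 1) (C1 + 2)
      (3 * t) (by linarith) (by linarith) (fun j => by positivity) (by
        intro j hj
        have := MM_ge μ j
        have := hq1 j
        have := hpC j
        have h5 := mul_le_mul_of_nonneg_left (MM_le μ j) (show 0 ≤ C1 by linarith)
        have := MM_le μ j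
        linarith)
    rw [hMk] at h2
    refine le_trans ?_ h2
    refine mul_le_mul_of_nonneg_right (by linarith) (Finset.prod_nonneg fun j _ => by positivity)
  have h2 := sum_le_const f (bx v p (Function.update (fl μ) k t)) (K1 * ww μ)
    (fun e he => hup e (bx_up v μ 1 p _ hq1 e he))
  have h3 := Av_le f (fun e => ξ e ω) v p (Function.update (fl μ) k t) _ (-(Kst / (3 * (C1 + 2) ^ d) * ww μ)) h2 (by
    refine h1.trans ?_
    rw [← ww_mul]
    have hA : 0 < (C1 + 2) ^ d := by positivity
    have h4 := mul_le_mul_of_nonneg_left hcard (show 0 ≤ Kst / (3 * (C1 + 2) ^ d) * ww μ by positivity)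
    have e : Kst / (3 * (C1 + 2) ^ d) * ww μ * (3 * t / μ k * ((C1 + 2) ^ d * ∏ j, MM μ j)) =
      Kst * (t / μ k) * (ww μ * ∏ j, MM μ j) := by
      field_simp
    linarith)
  linarith

lemma stp4 (hs : SetUp v μ) (K1 K3 K4 R C1 C2 b X : ℝ) (hX : 0 < X) (hms : HMS ξ v μ X)
    (hb : 0 < b) (hb1 : b ≤ 1)
    (hK : 0 ≤ K3 + K4) (hR : 0 ≤ R) (hC : 3 * R ≤ C2) (hC2 : C1 + 1 ≤ C2)
    (hup : UpB f v μ 1 (K1 * ww μ)) (hlo : LoB f v μ C1 (K3 * ww μ))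
    (huu : UuB f v μ C1 (K4 * ww μ) R) (hK4 : K1 + K3 + 2 * (X / b ^ d) ≤ (K3 + K4) / 3)
    (p q : Fin d → ℕ) (hp : ∀ j, p j ≤ v j) (hpb : ∀ j, b * μ j ≤ p j) (hpC : ∀ j, (p j : ℝ) ≤ C1 * μ j)
    (hq : ∀ j, v j + q j < N j)
    (k : Fin d) (hk : C2 * μ k < q k) :
    Av (fun e => f e + ξ e) v p (fl μ) ≤ Av (fun e => f e + ξ e) v p q := by
  have hw := ww_pos μ
  have hn := hs.nn k
  have h1 := noise_le ξ v μ X hX hms p (fl μ) hp hs.fl_N b hb hb1 (fun j => by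
    have := hpb j
    have : (0:ℝ) ≤ fl μ j := Nat.cast_nonneg _
    linarith)
  have h2 := noise_le ξ v μ X hX hms p q hp hq b hb hb1 (fun j => by
    have := hpb j
    have : (0:ℝ) ≤ q j := Nat.cast_nonneg _
    linarith)
  have h3 := sum_le_const f (bx v p (fl μ)) (K1 * ww μ)
    (fun e he => hup e (bx_up v μ 1 p _ (fun j => by linarith [hs.fl_le j]) e he))
  have h4 := Av_le f ξ v p (fl μ) _ _ h3 (abs_le.1 h1).2
  have hb' : ∀ e ∈ bx v p q, ∀ j, (v j : ℝ) ≤ e j + C1 * μ j := bx_lo v μ C1 p q hpC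
  have hRC := mul_le_mul_of_nonneg_right hC hn
  have hC2' := mul_le_mul_of_nonneg_right hC2 hn
  have hpk : p k + 1 ≤ q k := by
    have := hpC k
    have : (p k : ℝ) < q k := by linarith
    exact_mod_cast this
  have h5 := sum_frac (fun e => - f e) v p q k _ (Finset.filter_subset _ _)
    (up_count (v k) (p k) (q k) (hp k) (hq k) R (μ k) (mul_nonneg hR hn) (by linarith) hpk)
    (K3 * ww μ) (K4 * ww μ) (by rw [← add_mul]; exact mul_nonneg hK hw.le)
    (fun e he => by linarith [hlo e (hb' e he)])
    (fun e he hek => by linarith [huu e (hb' e he) ⟨k, (Finset.mem_filter.1 hek).2⟩])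
  rw [Finset.sum_neg_distrib] at h5
  have h6 := le_Av f ξ v p q (-(K3 * ww μ - (K3 * ww μ + K4 * ww μ) / 3)) (-(X / b ^ d * ww μ)) (by linarith)
    (by linarith [(abs_le.1 h2).1])
  have h7 := mul_le_mul_of_nonneg_right hK4 hw.le
  linarith

lemma stp5 {Ω : Type*} (ξ : (∀ k, Fin (N k)) → Ω → ℝ) (ω : Ω) (hs : SetUp v μ) (K3 K5 C1 C2 b b' Kst X : ℝ)
    (hX : 0 < X) (hms : HMS (fun e => ξ e ω) v μ X)
    (hb : 0 < b) (hb1 : b < 1) (hb' : 0 < b') (hKst : 0 < Kst) (hC1 : 1 ≤ C1) (hC12 : C1 ≤ C2)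
    (hlo : LoB f v μ C1 (K3 * ww μ)) (hup : UpB f v μ C2 (K5 * ww μ))
    (hK : K5 + K3 + X / b ^ d ≤ Kst / (2 * C2 + 1) ^ d)
    (p q : Fin d → ℕ) (hp : ∀ j, p j ≤ v j) (hpb : ∀ j, b * μ j ≤ p j) (hpC : ∀ j, (p j : ℝ) ≤ C1 * μ j)
    (hq : ∀ j, v j + q j < N j) (hqC : ∀ j, (q j : ℝ) ≤ C2 * μ j)
    (k : Fin d) (hqk : (q k : ℝ) < b' * μ k)
    (hng : negGood ξ v (MM μ) C2 Kst 1 b' k (fun j => ⌊b * MM μ j⌋₊) (fun _ => 0) ω) :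
    ∃ t : ℕ, b' * μ k ≤ t ∧ (t:ℝ) ≤ μ k ∧
      Av (fun e => f e + ξ e ω) v p (Function.update q k t) ≤ Av (fun e => f e + ξ e ω) v p q := by
  have hw := ww_pos μ
  have hPM := PM_pos μ
  have hk0 : 0 < μ k := by
    have : (0:ℝ) ≤ q k := Nat.cast_nonneg _
    by_contra h
    have := hs.nn k
    have : μ k = 0 := by linarith
    rw [this] at hqk
    linarith
  have hMk := hs.MM_eq k hk0
  obtain ⟨t, ht1, ht2, ht⟩ := hng
  rw [hMk] at ht1 ht2 ht
  rw [one_mul] at ht2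
  refine ⟨t, ht1, ht2, ?_⟩
  have htpos : 0 < (t:ℝ) := lt_of_lt_of_le (by positivity) ht1
  have hqt : q k ≤ t := by
    have : (q k : ℝ) ≤ t := by linarith
    exact_mod_cast this
  have h1 := (ht (Function.update p k 0) q (by
    intro j hj
    rw [Function.update_of_ne hj]
    refine ⟨⟨?_, ?_⟩, Nat.zero_le _, ?_⟩
    · beta_reduce
      rcases hs.h01 j with h | h
      · have : MM μ j = 1 := by rw [MM, h]; simp
        rw [this, mul_one, Nat.floor_eq_zero.2 hb1]; exact Nat.zero_le _
      · have : MM μ j = μ j := max_eq_right h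
        rw [this]
        exact Nat.floor_le_of_le (hpb j)
    · refine (hpC j).trans ((mul_le_mul_of_nonneg_left (MM_le μ j) (by linarith)).trans ?_)
      exact mul_le_mul_of_nonneg_right hC12 (by linarith [MM_ge μ j])
    · exact (hqC j).trans (mul_le_mul_of_nonneg_left (MM_le μ j) (by linarith))) (by simp; positivity) hqk.le).2
  have hL : lay v k t (q k) (Function.update p k 0) q = lay v k t (q k) p q := by
    refine Finset.Subset.antisymm (lay_sub _ _ _ _ _ _ _ _ ?_) (lay_sub _ _ _ _ _ _ _ _ ?_) <;>
    · intro j hj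
      rw [Function.update_of_ne hj]
      exact ⟨le_rfl, le_rfl⟩
  have h2 := lay_sum v k t (q k) (Function.update p k 0) q hqt (fun e => ξ e ω)
  rw [Function.update_eq_self, hL] at h2
  rw [← h2] at h1
  have hcard : ((lay v k t (q k) p q).card : ℝ) ≤ (t / μ k) * ((2 * C2 + 1) ^ d * ∏ j, MM μ j) := by
    rw [lay_card v k t (q k) p q (fun j _ => hp j) (fun j _ => hq j) (hs.leN k t ht2) hqt]
    have h3 := prod_bd (MM μ) (MM_ge μ) k (fun j => (p j : ℝ) + (q j : ℕ) + 1) (2 * C2 + 1)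
      t (by linarith) (by linarith) (fun j => by positivity) (by
        intro j hj
        have := MM_ge μ j
        have := hqC j
        have := hpC j
        have h5 := mul_le_mul_of_nonneg_left (MM_le μ j) (show 0 ≤ C2 by linarith)
        have h6 := mul_le_mul_of_nonneg_right hC12 (hs.nn j)
        linarith)
    rw [hMk] at h3
    refine le_trans ?_ h3
    have : (0:ℝ) ≤ q k := Nat.cast_nonneg _
    refine mul_le_mul_of_nonneg_right (by linarith) (Finset.prod_nonneg fun j _ => by positivity)
  have h3 := sum_le_const f (lay v k t (q k) p q) (K5 * ww μ) (fun e he => hup e (by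
    intro j
    have hm := (mem_lay v k t (q k) p q e).1 he
    by_cases hj : j = k
    · subst hj
      have : ((e j : ℕ):ℝ) ≤ (v j : ℕ) + t := by exact_mod_cast hm.1.2
      have := mul_le_mul_of_nonneg_right (show 1 ≤ C2 by linarith) (hs.nn j)
      linarith
    · have : ((e j : ℕ):ℝ) ≤ (v j : ℕ) + q j := by exact_mod_cast (hm.2 j hj).2
      linarith [hqC j]))
  have hA : 0 < (2 * C2 + 1) ^ d := by
    have : 0 < 2 * C2 + 1 := by linarith
    positivity
  have h4 : ∑ e ∈ lay v k t (q k) p q, ξ e ω ≤ -(Kst / (2 * C2 + 1) ^ d * ww μ) * (lay v k t (q k) p q).card := by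
    refine h1.trans ?_
    rw [← ww_mul]
    have h4 := mul_le_mul_of_nonneg_left hcard (show 0 ≤ Kst / (2 * C2 + 1) ^ d * ww μ by positivity)
    have e : Kst / (2 * C2 + 1) ^ d * ww μ * (t / μ k * ((2 * C2 + 1) ^ d * ∏ j, MM μ j)) =
      Kst * (t / μ k) * (ww μ * ∏ j, MM μ j) := by
      field_simp
    linarith
  have h5 := noise_le (fun e => ξ e ω) v μ X hX hms p q hp hq b hb hb1.le (fun j => by
    have := hpb j
    have : (0:ℝ) ≤ q j := Nat.cast_nonneg _
    linarith)
  have h6 := const_le_sum f (bx v p q) (-(K3 * ww μ)) (fun e he => hlo e (bx_lo v μ C1 _ _ hpC e he))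
  have h7 := le_Av f (fun e => ξ e ω) v p q _ (-(X / b ^ d * ww μ)) h6 (by linarith [(abs_le.1 h5).1])
  set a := Av (fun e => f e + ξ e ω) v p q with ha
  have hsum : ∑ e ∈ bx v p q, (f e + ξ e ω) = a * (bx v p q).card := by
    rw [ha, Av, div_mul_cancel₀ _ (bx_card_pos v p q).ne']
  have h8 := lay_sum v k t (q k) p q hqt (fun e => f e + ξ e ω)
  have h9 := lay_sum v k t (q k) p q hqt (fun e => (1:ℝ))
  simp only [Finset.sum_const, nsmul_eq_mul, mul_one] at h9
  rw [Function.update_eq_self] at h8 h9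
  rw [Finset.sum_add_distrib] at h8
  have h10 : ((bx v p (Function.update q k t)).card : ℝ) = (bx v p q).card + (lay v k t (q k) p q).card := by
    linarith
  rw [Av, div_le_iff₀ (bx_card_pos v p _), h10, mul_add, ← hsum]
  have h11 : (K5 * ww μ - Kst / (2 * C2 + 1) ^ d * ww μ) * (lay v k t (q k) p q).card ≤
      a * (lay v k t (q k) p q).card := by
    refine mul_le_mul_of_nonneg_right ?_ (Nat.cast_nonneg _)
    have := mul_le_mul_of_nonneg_right hK hw.le
    linarith
  linarith

def Cl (μ : Fin d → ℝ) (b C : ℝ) (p : Fin d → ℕ) : Prop := ∀ j, b * μ j ≤ p j ∧ (p j : ℝ) ≤ C * μ j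

lemma stp5_iter (A : (Fin d → ℕ) → ℝ) (b' C2 : ℝ) (hC2 : 1 ≤ C2) (hs : SetUp v μ)
    (step : ∀ q : Fin d → ℕ, (∀ j, v j + q j < N j) → (∀ j, (q j : ℝ) ≤ C2 * μ j) → ∀ k, (q k : ℝ) < b' * μ k →
      ∃ t : ℕ, b' * μ k ≤ t ∧ (t:ℝ) ≤ μ k ∧ A (Function.update q k t) ≤ A q) :
    ∀ (m : ℕ) (q : Fin d → ℕ), (Finset.univ.filter (fun k => (q k : ℝ) < b' * μ k)).card ≤ m →
      (∀ j, v j + q j < N j) → (∀ j, (q j : ℝ) ≤ C2 * μ j) →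
      ∃ q' : Fin d → ℕ, Cl μ b' C2 q' ∧ (∀ j, v j + q' j < N j) ∧ A q' ≤ A q := by
  intro m
  induction m with
  | zero =>
    intro q h0 hq hqC
    refine ⟨q, fun j => ⟨?_, hqC j⟩, hq, le_rfl⟩
    have := Finset.card_eq_zero.1 (Nat.le_zero.1 h0)
    rw [Finset.filter_eq_empty_iff] at this
    exact not_lt.1 (this (Finset.mem_univ j))
  | succ m ih =>
    intro q h0 hq hqC
    by_cases h : ∃ k, (q k : ℝ) < b' * μ k
    · obtain ⟨k, hk⟩ := h
      obtain ⟨t, ht1, ht2, ht3⟩ := step q hq hqC k hk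
      obtain ⟨q', h1, h2, h3⟩ := ih (Function.update q k t) (by
        have hss : (Finset.univ.filter (fun k' => ((Function.update q k t k' : ℕ) : ℝ) < b' * μ k')) ⊂
            Finset.univ.filter (fun k => (q k : ℝ) < b' * μ k) := by
          refine Finset.ssubset_iff_of_subset (fun j hj => ?_) |>.2 ⟨k, by simpa using hk, by simpa using ht1⟩
          simp only [Finset.mem_filter, Finset.mem_univ, true_and] at hj ⊢
          by_cases hjk : j = k
          · subst hjk; exact hk
          · rwa [Function.update_of_ne hjk] at hj
        have := Finset.card_lt_card hss
        omega) (by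
        intro j
        by_cases hj : j = k
        · subst hj; simpa using hs.leN j t ht2
        · rw [Function.update_of_ne hj]; exact hq j) (by
        intro j
        by_cases hj : j = k
        · subst hj
          have := mul_le_mul_of_nonneg_right hC2 (hs.nn j)
          simp only [Function.update_self]
          linarith
        · rw [Function.update_of_ne hj]; exact hqC j)
      exact ⟨q', h1, h2, h3.trans ht3⟩
    · push Not at h
      exact ⟨q, fun j => ⟨h j, hqC j⟩, hq, le_rfl⟩

def Good (A : (Fin d → ℕ) → (Fin d → ℕ) → ℝ) (v : ∀ k, Fin (N k)) (μ : Fin d → ℝ) (b C : ℝ) : Prop :=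
  ∃ (a : ℝ) (p1 : Fin d → ℕ), Cl μ b C p1 ∧ (∀ j, p1 j ≤ v j) ∧ (∀ q : Fin d → ℕ, (∀ j, v j + q j < N j) → a ≤ A p1 q) ∧
    ∀ p : Fin d → ℕ, (∀ j, p j ≤ v j) → (∃ q, Cl μ b C q ∧ (∀ j, v j + q j < N j) ∧ A p q < a) ∨
      (Cl μ b C p ∧ ∀ q : Fin d → ℕ, (∀ j, v j + q j < N j) → ∃ q', Cl μ b C q' ∧ (∀ j, v j + q' j < N j) ∧ A p q' ≤ A p q)

lemma Cl_mono {μ : Fin d → ℝ} (h0 : ∀ j, 0 ≤ μ j) {b b' C C' : ℝ} (hb : b' ≤ b) (hC : C ≤ C') {p : Fin d → ℕ}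
    (h : Cl μ b C p) : Cl μ b' C' p := fun j =>
  ⟨(mul_le_mul_of_nonneg_right hb (h0 j)).trans (h j).1, (h j).2.trans (mul_le_mul_of_nonneg_right hC (h0 j))⟩

lemma SetUp.fl_Cl {v : ∀ k, Fin (N k)} {μ : Fin d → ℝ} (hs : SetUp v μ) (b C : ℝ) (hb : b ≤ 1 / 2) (hC : 1 ≤ C) :
    Cl μ b C (fl μ) := by
  intro j
  have h0 := hs.nn j
  have hf := hs.fl_le j
  have h1 := mul_le_mul_of_nonneg_right hb h0
  have h2 := mul_le_mul_of_nonneg_right hC h0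
  refine ⟨?_, by linarith⟩
  rcases hs.h01 j with h | h
  · rw [h]; simp
  · have h3 := lt_fl μ j
    have : (1:ℝ) ≤ fl μ j := by
      have : 1 ≤ fl μ j := (Nat.one_le_floor_iff _).2 h
      exact_mod_cast this
    linarith

theorem good_det {Ω : Type*} (ξ : (∀ k, Fin (N k)) → Ω → ℝ) (ω : Ω) (hs : SetUp v μ)
    (X K1 K2 K3 K4 K5 R R' C1 C2 b1 b2 Ks1 Ks2 : ℝ) (hX : 0 < X)
    (hK12 : 0 ≤ K1 + K2) (hR : 0 ≤ R) (hRC : 3 * R ≤ C1) (hC1 : 2 ≤ C1)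
    (hK2 : K1 - (K1 + K2) / 3 + X < -(K1 + X))
    (hKs1 : 0 < Ks1) (hKs1' : K1 - Ks1 / (3 * (C1 + 2) ^ d) < -(K1 + X))
    (hb1 : 0 < b1) (hb12 : b1 ≤ 1 / 2)
    (hK34 : 0 ≤ K3 + K4) (hR' : 0 ≤ R') (hRC' : 3 * R' ≤ C2) (hC2 : C1 + 1 ≤ C2)
    (hK4 : K1 + K3 + 2 * (X / b1 ^ d) ≤ (K3 + K4) / 3)
    (hb2 : 0 < b2) (hb22 : b2 ≤ 1 / 2) (hKs2 : 0 < Ks2) (hKs2' : K5 + K3 + X / b1 ^ d ≤ Ks2 / (2 * C2 + 1) ^ d)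
    (hms : HMS (fun e => ξ e ω) v μ X)
    (hup : UpB f v μ 1 (K1 * ww μ)) (hlo : LoB f v μ 1 (K1 * ww μ)) (hdn : DnB f v μ 1 (K2 * ww μ) R)
    (hlo' : LoB f v μ C1 (K3 * ww μ)) (huu : UuB f v μ C1 (K4 * ww μ) R') (hup' : UpB f v μ C2 (K5 * ww μ))
    (hn1 : ∀ k, 0 < μ k → ∃ b', b1 ≤ b' ∧ negGood ξ v (MM μ) C1 Ks1 1 b' k (fun _ => 0) (fl μ) ω)
    (hn2 : ∀ k, 0 < μ k → ∃ b', b2 ≤ b' ∧ negGood ξ v (MM μ) C2 Ks2 1 b' k (fun j => ⌊b1 * MM μ j⌋₊) (fun _ => 0) ω) :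
    Good (Av (fun e => f e + ξ e ω) v) v μ (min b1 b2) C2 := by
  have hw := ww_pos μ
  have hmin : min b1 b2 ≤ 1 / 2 := (min_le_left _ _).trans hb12
  have hflC := hs.fl_Cl (min b1 b2) C2 hmin (by linarith)
  have hpos : ∀ (b' : ℝ) (k) (x : ℕ), (x:ℝ) < b' * μ k → 0 < μ k := by
    intro b' k x hx
    have := hs.nn k
    rcases this.eq_or_lt with h | h
    · rw [← h, mul_zero] at hx
      have : (0:ℝ) ≤ x := Nat.cast_nonneg _
      linarith
    · exact h
  refine ⟨-((K1 + X) * ww μ), fl μ, hflC, hs.fl_v,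
    fun q hq => stp1 f _ v μ hs K1 X hX hms hlo q hq, fun p hp => ?_⟩
  by_cases hA : ∃ k, C1 * μ k < p k
  · left
    obtain ⟨k, hk⟩ := hA
    refine ⟨fl μ, hflC, hs.fl_N, (stp2 f _ v μ hs K1 K2 R C1 X hX hms hK12 hR hRC hC1 hup hdn p hp k hk).trans_lt ?_⟩
    have := mul_lt_mul_of_pos_right hK2 hw
    linarith
  push Not at hA
  by_cases hB : ∃ k, (p k : ℝ) < b1 * μ k
  · left
    obtain ⟨k, hk⟩ := hB
    have hk0 := hpos _ _ _ hk
    obtain ⟨b', hbb, hn⟩ := hn1 k hk0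
    obtain ⟨t, ht1, ht2, ht3⟩ := stp3 f v μ ξ ω hs K1 C1 b' Ks1 (by linarith) hKs1 (by linarith) hup p hp hA k
      (hk.trans_le (mul_le_mul_of_nonneg_right hbb hk0.le)) hn
    refine ⟨_, ?_, ?_, ht3.trans_lt ?_⟩
    · intro j
      by_cases hj : j = k
      · subst hj
        simp only [Function.update_self]
        have h5 := mul_le_mul_of_nonneg_right (show 1 ≤ C2 by linarith) (hs.nn j)
        have h6 := mul_le_mul_of_nonneg_right ((min_le_left b1 b2).trans hbb) (hs.nn j)
        constructor <;> linarith
      · rw [Function.update_of_ne hj]; exact hflC j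
    · intro j
      by_cases hj : j = k
      · subst hj; simpa using hs.leN j t ht2
      · rw [Function.update_of_ne hj]; exact hs.fl_N j
    · have := mul_lt_mul_of_pos_right hKs1' hw
      linarith
  push Not at hB
  right
  refine ⟨Cl_mono hs.nn (min_le_left b1 b2) (by linarith) (fun j => ⟨hB j, hA j⟩), fun q hq => ?_⟩
  by_cases hD : ∃ k, C2 * μ k < q k
  · obtain ⟨k, hk⟩ := hD
    exact ⟨fl μ, hflC, hs.fl_N, stp4 f _ v μ hs K1 K3 K4 R' C1 C2 b1 X hX hms hb1 (by linarith) hK34 hR' hRC' hC2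
      hup hlo' huu hK4 p q hp hB hA hq k hk⟩
  push Not at hD
  obtain ⟨q', h1, h2, h3⟩ := stp5_iter v μ (fun q => Av (fun e => f e + ξ e ω) v p q) b2 C2 (by linarith) hs
    (fun q hq hqC k hk => by
      have hk0 := hpos _ _ _ hk
      obtain ⟨b', hbb, hn⟩ := hn2 k hk0
      obtain ⟨t, ht1, ht2, ht3⟩ := stp5 f v μ ξ ω hs K3 K5 C1 C2 b1 b' Ks2 X hX hms hb1 (by linarith) (by linarith)
        hKs2 (by linarith) (by linarith) hlo' hup' hKs2' p q hp hB hA hq hqC k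
        (hk.trans_le (mul_le_mul_of_nonneg_right hbb hk0.le)) hn
      exact ⟨t, (mul_le_mul_of_nonneg_right hbb hk0.le).trans ht1, ht2, ht3⟩) _ q le_rfl hq hD
  exact ⟨q', Cl_mono hs.nn (min_le_right b1 b2) le_rfl h1, h2, h3⟩
end


section
variable {d : ℕ} {N : Fin d → ℕ}

lemma UpB.mono {f : (∀ k, Fin (N k)) → ℝ} {v : ∀ k, Fin (N k)} {μ : Fin d → ℝ} {C K K' : ℝ} (hK : K ≤ K')
    (h : UpB f v μ C (K * ww μ)) : UpB f v μ C (K' * ww μ) := fun e he =>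
  (h e he).trans (mul_le_mul_of_nonneg_right hK (ww_pos μ).le)

lemma LoB.mono {f : (∀ k, Fin (N k)) → ℝ} {v : ∀ k, Fin (N k)} {μ : Fin d → ℝ} {C K K' : ℝ} (hK : K ≤ K')
    (h : LoB f v μ C (K * ww μ)) : LoB f v μ C (K' * ww μ) := fun e he =>
  (neg_le_neg (mul_le_mul_of_nonneg_right hK (ww_pos μ).le)).trans (h e he)

lemma DnB.mono {f : (∀ k, Fin (N k)) → ℝ} {v : ∀ k, Fin (N k)} {μ : Fin d → ℝ} {C K R R' : ℝ} (h0 : ∀ j, 0 ≤ μ j)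
    (hR : R ≤ R') (h : DnB f v μ C K R) : DnB f v μ C K R' := fun e he ⟨k, hk⟩ =>
  h e he ⟨k, lt_of_le_of_lt (by linarith [mul_le_mul_of_nonneg_right hR (h0 k)]) hk⟩

lemma UuB.mono {f : (∀ k, Fin (N k)) → ℝ} {v : ∀ k, Fin (N k)} {μ : Fin d → ℝ} {C K R R' : ℝ} (h0 : ∀ j, 0 ≤ μ j)
    (hR : R ≤ R') (h : UuB f v μ C K R) : UuB f v μ C K R' := fun e he ⟨k, hk⟩ =>
  h e he ⟨k, lt_of_le_of_lt (by linarith [mul_le_mul_of_nonneg_right hR (h0 k)]) hk⟩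

lemma neg1 {Ω : Type*} [MeasurableSpace Ω] {P : Measure Ω} [IsProbabilityMeasure P] (v : ∀ k, Fin (N k))
    (m : Fin d → ℝ) (hs : SetUp v m) (ξ : (∀ k, Fin (N k)) → Ω → ℝ) (C1 Ks b' D η : ℝ) (hC : 1 ≤ C1)
    (hη : 0 ≤ η) (hD : ∀ j, m j = 0 ∨ D ≤ m j)
    (H : ∀ (k : Fin d) (_ : D ≤ MM m k)
      (bp bq : Fin d → ℕ) (_ : ∀ j, j ≠ k → bp j ≤ v j) (_ : ∀ j, j ≠ k → v j + bq j < N j)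
      (_ : ∀ j, j ≠ k → 1 * MM m j ≤ (bp j : ℝ) + bq j + 1)
      (_ : ∀ j, j ≠ k → (bp j : ℝ) ≤ C1 * MM m j ∧ (bq j : ℝ) ≤ C1 * MM m j)
      (_ : (v k : ℝ) + 1 * MM m k < N k),
      P.real {ω | ¬ negGood ξ v (MM m) C1 Ks 1 b' k bp bq ω} ≤ η) (k : Fin d) :
    P.real {ω | 0 < m k ∧ ¬ negGood ξ v (MM m) C1 Ks 1 b' k (fun _ => 0) (fl m) ω} ≤ η := by
  by_cases hk : 0 < m k
  · refine (measureReal_mono (fun ω h => h.2) (measure_ne_top _ _)).trans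
      (H k ?_ _ _ (fun j _ => Nat.zero_le _) (fun j _ => hs.fl_N j) (fun j _ => ?_) (fun j _ => ⟨?_, ?_⟩) ?_)
    · rw [hs.MM_eq k hk]
      rcases hD k with h | h
      · linarith
      · exact h
    · have := lt_fl m j
      have h0 : (0:ℝ) ≤ fl m j := Nat.cast_nonneg _
      rw [one_mul, MM]
      push_cast
      exact max_le (by linarith) (by linarith)
    · have := MM_ge m j
      push_cast
      positivity
    · have := MM_ge m j
      have := hs.fl_le j
      have := MM_le m j
      nlinarith
    · rw [one_mul, hs.MM_eq k hk]; exact hs.hN k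
  · simp [hk, hη]

lemma neg2 {Ω : Type*} [MeasurableSpace Ω] {P : Measure Ω} [IsProbabilityMeasure P] (v : ∀ k, Fin (N k))
    (m : Fin d → ℝ) (hs : SetUp v m) (ξ : (∀ k, Fin (N k)) → Ω → ℝ) (C1 Ks b b' D η : ℝ) (hC : 1 ≤ C1)
    (hb : 0 < b) (hb1 : b < 1)
    (hη : 0 ≤ η) (hD : ∀ j, m j = 0 ∨ D ≤ m j)
    (H : ∀ (k : Fin d) (_ : D ≤ MM m k)
      (bp bq : Fin d → ℕ) (_ : ∀ j, j ≠ k → bp j ≤ v j) (_ : ∀ j, j ≠ k → v j + bq j < N j)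
      (_ : ∀ j, j ≠ k → b * MM m j ≤ (bp j : ℝ) + bq j + 1)
      (_ : ∀ j, j ≠ k → (bp j : ℝ) ≤ C1 * MM m j ∧ (bq j : ℝ) ≤ C1 * MM m j)
      (_ : (v k : ℝ) + 1 * MM m k < N k),
      P.real {ω | ¬ negGood ξ v (MM m) C1 Ks 1 b' k bp bq ω} ≤ η) (k : Fin d) :
    P.real {ω | 0 < m k ∧ ¬ negGood ξ v (MM m) C1 Ks 1 b' k (fun j => ⌊b * MM m j⌋₊) (fun _ => 0) ω} ≤ η := by
  by_cases hk : 0 < m k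
  · have hM0 : ∀ j, 0 ≤ b * MM m j := fun j => by
      have := MM_ge m j
      positivity
    refine (measureReal_mono (fun ω h => h.2) (measure_ne_top _ _)).trans
      (H k ?_ _ _ (fun j _ => ?_) (fun j _ => (v j).2) (fun j _ => ?_) (fun j _ => ⟨?_, ?_⟩) ?_)
    · rw [hs.MM_eq k hk]
      rcases hD k with h | h
      · linarith
      · exact h
    · rcases hs.h01 j with h | h
      · have : MM m j = 1 := by rw [MM, h]; simp
        rw [this, mul_one, Nat.floor_eq_zero.2 hb1]; exact Nat.zero_le _
      · have : MM m j = m j := max_eq_right h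
        rw [this]
        refine Nat.floor_le_of_le (le_trans ?_ (hs.hv j))
        nlinarith
    · have := Nat.lt_floor_add_one (b * MM m j)
      push_cast
      linarith
    · have := MM_ge m j
      have := Nat.floor_le (hM0 j)
      nlinarith
    · have := MM_ge m j
      push_cast
      positivity
    · rw [one_mul, hs.MM_eq k hk]; exact hs.hN k
  · simp [hk, hη]

lemma hms_prob {Ω : Type*} [MeasurableSpace Ω] {P : Measure Ω} [IsProbabilityMeasure P] (v : ∀ k, Fin (N k))
    (m : Fin d → ℝ) (ξ : (∀ k, Fin (N k)) → Ω → ℝ) (σ : ℝ)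
    (hind : iIndepFun ξ P) (hm : ∀ i, Measurable (ξ i))
    (hcheb : ∀ (A : Finset (∀ k, Fin (N k))) (x : ℝ), 0 < x →
      P.real {ω | x ≤ |∑ i ∈ A, ξ i ω|} ≤ σ ^ 2 * A.card / x ^ 2) (X : ℝ) (hX : 0 < X) :
    P.real {ω | ¬ HMS (fun e => ξ e ω) v m X} ≤ 1152 ^ d * σ ^ 2 / X ^ 2 := by
  have hw := ww_pos m
  have h := master ξ hind hm σ hcheb v (MM m) (MM_ge m) (X * ww m) (by positivity)
  have e : (X * ww m) ^ 2 * ∏ l, MM m l = X ^ 2 := by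
    rw [mul_pow, mul_assoc, sq (ww m), mul_assoc, ww_mul, ww, inv_mul_cancel₀, mul_one]
    exact (Real.sqrt_pos.2 (PM_pos m)).ne'
  rw [e] at h
  refine le_trans (measureReal_mono ?_ (measure_ne_top _ _)) h
  intro ω hω
  rw [Set.mem_ofPred_eq, HMS] at hω
  push Not at hω
  obtain ⟨p, q, hpq⟩ := hω
  exact ⟨p, q, hpq.le⟩
end

theorem prob_good (μ : Measure ℝ) [IsProbabilityMeasure μ] (σ : ℝ) (hσ : 0 < σ)
    (hmean : ∫ x, x ∂μ = 0) (hvar : ∫ x, x ^ 2 ∂μ = σ ^ 2)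
    (hL2 : Integrable (fun x : ℝ => x ^ 2) μ) {d : ℕ} {Ω : Type*} [MeasurableSpace Ω] (P : Measure Ω)
    [IsProbabilityMeasure P] (N : ℕ → Fin d → ℕ) (ξ : ∀ n, (∀ k, Fin (N n k)) → Ω → ℝ)
    (hind : ∀ n, iIndepFun (ξ n) P) (hmeas : ∀ n i, Measurable (ξ n i)) (hlaw : ∀ n i, P.map (ξ n i) = μ)
    (v : ∀ n k, Fin (N n k)) (m : ℕ → Fin d → ℝ) (f : ∀ n, (∀ k, Fin (N n k)) → ℝ)
    (hs : ∀ᶠ n in atTop, SetUp (v n) (m n))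
    (hD : ∀ D : ℝ, ∀ᶠ n in atTop, ∀ j, m n j = 0 ∨ D ≤ m n j)
    (hU : ∀ C : ℝ, ∃ K : ℝ, ∀ᶠ n in atTop, UpB (f n) (v n) (m n) C (K * ww (m n)))
    (hL : ∀ C : ℝ, ∃ K : ℝ, ∀ᶠ n in atTop, LoB (f n) (v n) (m n) C (K * ww (m n)))
    (hDn : ∀ C K : ℝ, ∃ R : ℝ, ∀ᶠ n in atTop, DnB (f n) (v n) (m n) C (K * ww (m n)) R)
    (hUu : ∀ C K : ℝ, ∃ R : ℝ, ∀ᶠ n in atTop, UuB (f n) (v n) (m n) C (K * ww (m n)) R)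
    (η : ℝ) (hη : 0 < η) :
    ∃ b C : ℝ, 0 < b ∧ b ≤ 1 ∧ 1 ≤ C ∧ ∀ᶠ n in atTop,
      P.real {ω | ¬ Good (Av (fun e => f n e + ξ n e ω) (v n)) (v n) (m n) b C} ≤ η := by
  set η' : ℝ := η / (2 * d + 1) with hη'
  have hη'0 : 0 < η' := by positivity
  obtain ⟨X, hX, hXb⟩ := exX (1152 ^ d * σ ^ 2) η' (by positivity) hη'0
  obtain ⟨Ka, hKa⟩ := hU 1
  obtain ⟨Kb, hKb⟩ := hL 1
  obtain ⟨K1, hK1a, hK1b, hK10⟩ : ∃ K1, Ka ≤ K1 ∧ Kb ≤ K1 ∧ 0 ≤ K1 :=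
    ⟨max (max Ka Kb) 0, le_max_of_le_left (le_max_left _ _), le_max_of_le_left (le_max_right _ _), le_max_right _ _⟩
  obtain ⟨R0, hR0⟩ := hDn 1 (5 * K1 + 6 * X + 1)
  obtain ⟨R, hRR, hR⟩ : ∃ R, R0 ≤ R ∧ 0 ≤ R := ⟨max R0 0, le_max_left _ _, le_max_right _ _⟩
  obtain ⟨C1, hC1a, hC1b⟩ : ∃ C1, 3 * R ≤ C1 ∧ 2 ≤ C1 := ⟨max (3 * R) 2, le_max_left _ _, le_max_right _ _⟩
  have hp1 : 0 < (C1 + 2) ^ d := by positivity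
  set Ks1 : ℝ := 3 * (C1 + 2) ^ d * (2 * K1 + X + 1) with hKs1
  have hKs1p : 0 < Ks1 := by positivity
  obtain ⟨ba, hba, -, D1, hneg1⟩ := neg_event μ σ hσ hmean hvar hL2 d C1 1 Ks1 1 η' (by linarith) one_pos le_rfl
    hKs1p one_pos hη'0
  obtain ⟨b1, hb1, hb1a, hb1h⟩ : ∃ b1, 0 < b1 ∧ b1 ≤ ba ∧ b1 ≤ 1 / 2 :=
    ⟨min ba (1/2), lt_min hba (by norm_num), min_le_left _ _, min_le_right _ _⟩
  obtain ⟨Kc, hKc⟩ := hL C1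
  obtain ⟨K3, hK3a, hK30⟩ : ∃ K, Kc ≤ K ∧ 0 ≤ K := ⟨max Kc 0, le_max_left _ _, le_max_right _ _⟩
  have hXb0 : 0 < X / b1 ^ d := by positivity
  set K4 : ℝ := 3 * (K1 + K3 + 2 * (X / b1 ^ d)) with hK4
  obtain ⟨R0', hR0'⟩ := hUu C1 K4
  obtain ⟨R', hRR', hR'⟩ : ∃ R, R0' ≤ R ∧ 0 ≤ R := ⟨max R0' 0, le_max_left _ _, le_max_right _ _⟩
  obtain ⟨C2, hC2a, hC2b⟩ : ∃ C2, 3 * R' ≤ C2 ∧ C1 + 1 ≤ C2 :=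
    ⟨max (3 * R') (C1 + 1), le_max_left _ _, le_max_right _ _⟩
  obtain ⟨Kd, hKd⟩ := hU C2
  obtain ⟨K5, hK5a, hK50⟩ : ∃ K, Kd ≤ K ∧ 0 ≤ K := ⟨max Kd 0, le_max_left _ _, le_max_right _ _⟩
  have hp2 : 0 < (2 * C2 + 1) ^ d := by
    have : 0 < 2 * C2 + 1 := by linarith
    positivity
  set Ks2 : ℝ := (2 * C2 + 1) ^ d * (K5 + K3 + X / b1 ^ d) with hKs2
  have hKs2p : 0 < Ks2 := by positivity
  obtain ⟨bb, hbb, -, D2, hneg2⟩ := neg_event μ σ hσ hmean hvar hL2 d C2 b1 Ks2 1 η' (by linarith) hb1 (by linarith)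
    hKs2p one_pos hη'0
  obtain ⟨b2, hb2, hb2a, hb2h⟩ : ∃ b2, 0 < b2 ∧ b2 ≤ bb ∧ b2 ≤ 1 / 2 :=
    ⟨min bb (1/2), lt_min hbb (by norm_num), min_le_left _ _, min_le_right _ _⟩
  refine ⟨min b1 b2, C2, lt_min hb1 hb2, (min_le_left _ _).trans (by linarith), by linarith, ?_⟩
  filter_upwards [hs, hD D1, hD D2, hKa, hKb, hR0, hKc, hR0', hKd] with n hs hD1 hD2 hKa hKb hR0 hKc hR0' hKd
  have hsub : {ω | ¬ Good (Av (fun e => f n e + ξ n e ω) (v n)) (v n) (m n) (min b1 b2) C2} ⊆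
      {ω | ¬ HMS (fun e => ξ n e ω) (v n) (m n) X} ∪
      ((⋃ k : Fin d, {ω | 0 < m n k ∧ ¬ negGood (ξ n) (v n) (MM (m n)) C1 Ks1 1 ba k (fun _ => 0) (fl (m n)) ω}) ∪
       (⋃ k : Fin d, {ω | 0 < m n k ∧ ¬ negGood (ξ n) (v n) (MM (m n)) C2 Ks2 1 bb k
          (fun j => ⌊b1 * MM (m n) j⌋₊) (fun _ => 0) ω})) := by
    intro ω hω
    by_contra hcon
    simp only [Set.mem_union, Set.mem_iUnion, Set.mem_ofPred_eq, not_or, not_exists, not_and, not_not] at hcon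
    obtain ⟨h1, h2, h3⟩ := hcon
    refine hω (good_det (f n) (v n) (m n) (ξ n) ω hs X K1 (5 * K1 + 6 * X + 1) K3 K4 K5 R R' C1 C2 b1 b2 Ks1 Ks2 hX
      (by linarith) hR hC1a hC1b (by linarith) hKs1p ?_ hb1 hb1h (by positivity) hR' hC2a hC2b (by rw [hK4]; linarith)
      hb2 hb2h hKs2p ?_ h1 (hKa.mono hK1a) (hKb.mono hK1b) (hR0.mono hs.nn hRR) (hKc.mono hK3a) (hR0'.mono hs.nn hRR')
      (hKd.mono hK5a) (fun k hk => ⟨ba, hb1a, h2 k hk⟩) (fun k hk => ⟨bb, hb2a, h3 k hk⟩))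
    · rw [hKs1, mul_div_cancel_left₀ _ (by positivity)]; linarith
    · rw [hKs2, mul_div_cancel_left₀ _ hp2.ne']
  have hcheb := cheb_sum (P := P) μ σ hmean hvar hL2 (ξ n) (hind n) (hmeas n) (hlaw n)
  have e1 := (hms_prob (P := P) (v n) (m n) (ξ n) σ (hind n) (hmeas n) hcheb X hX).trans hXb
  have e2 : P.real (⋃ k : Fin d, {ω | 0 < m n k ∧ ¬ negGood (ξ n) (v n) (MM (m n)) C1 Ks1 1 ba k (fun _ => 0) (fl (m n)) ω}) ≤ d * η' := by
    refine (measureReal_iUnion_fintype_le _).trans ?_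
    refine (Finset.sum_le_sum fun k _ => neg1 (v n) (m n) hs (ξ n) C1 Ks1 ba D1 η' (by linarith) hη'0.le hD1
      (fun k hk bp bq => hneg1 P (N n) (ξ n) (hind n) (hmeas n) (hlaw n) (v n) (MM (m n)) (MM_ge _) k hk bp bq) k).trans ?_
    simp
  have e3 : P.real (⋃ k : Fin d, {ω | 0 < m n k ∧ ¬ negGood (ξ n) (v n) (MM (m n)) C2 Ks2 1 bb k
          (fun j => ⌊b1 * MM (m n) j⌋₊) (fun _ => 0) ω}) ≤ d * η' := by
    refine (measureReal_iUnion_fintype_le _).trans ?_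
    refine (Finset.sum_le_sum fun k _ => neg2 (v n) (m n) hs (ξ n) C2 Ks2 b1 bb D2 η' (by linarith) hb1 (by linarith)
      hη'0.le hD2
      (fun k hk bp bq => hneg2 P (N n) (ξ n) (hind n) (hmeas n) (hlaw n) (v n) (MM (m n)) (MM_ge _) k hk bp bq) k).trans ?_
    simp
  refine (measureReal_mono hsub (measure_ne_top _ _)).trans ((measureReal_union_le _ _).trans
    ((add_le_add e1 ((measureReal_union_le _ _).trans (add_le_add e2 e3))).trans (le_of_eq ?_)))
  rw [hη']
  field_simp
  ring


section
open Polynomial in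
lemma poly_rep (m : ℕ) (x : ℝ) (z : ℕ → ℝ) (hz : Function.Injective z) (p : ℝ[X]) (hp : p.natDegree ≤ m) :
    p.eval x = ∑ i ∈ Finset.range (m + 1), p.eval (z i) * (Lagrange.basis (Finset.range (m + 1)) z i).eval x := by
  have h := Lagrange.eq_interpolate_of_eval_eq (s := Finset.range (m + 1)) (v := z) (fun i => p.eval (z i)) hz.injOn
    (f := p) (by
      rw [Finset.card_range]
      exact lt_of_le_of_lt (degree_le_natDegree) (by exact_mod_cast Nat.lt_succ_of_le hp)) (fun i _ => rfl)
  conv_lhs => rw [h]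
  rw [Lagrange.interpolate_apply, eval_finsetSum]
  simp

open Polynomial in
lemma poly_ext (m : ℕ) : ∃ Λ : ℝ, 0 ≤ Λ ∧ ∀ p : ℝ[X], p.natDegree ≤ m → ∀ B : ℝ,
    (∀ i : ℕ, i ≤ m → |p.eval (-(i:ℝ))| ≤ B) → |p.eval 1| ≤ Λ * B := by
  refine ⟨∑ i ∈ Finset.range (m + 1), |(Lagrange.basis (Finset.range (m + 1)) (fun i : ℕ => -(i:ℝ)) i).eval 1|,
    Finset.sum_nonneg fun _ _ => abs_nonneg _, fun p hp B hB => ?_⟩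
  rw [poly_rep m 1 (fun i : ℕ => -(i:ℝ)) (fun a b h => by simpa using h) p hp, Finset.sum_mul]
  refine (Finset.abs_sum_le_sum_abs _ _).trans (Finset.sum_le_sum fun i hi => ?_)
  rw [abs_mul, mul_comm]
  exact mul_le_mul_of_nonneg_left (hB i (by simpa [Nat.lt_succ_iff] using hi)) (abs_nonneg _)

open Polynomial in
lemma poly_cont (m : ℕ) (δ : ℝ) (hδ : 0 < δ) : ∃ ε : ℝ, 0 < ε ∧ ε ≤ 1 ∧ ∀ p : ℝ[X], p.natDegree ≤ m → ∀ B : ℝ,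
    (∀ i : ℕ, i ≤ m → |p.eval (i:ℝ)| ≤ B) → |p.eval ε - p.eval 0| ≤ δ * B := by
  set z : ℕ → ℝ := fun i => (i:ℝ)
  have hz : Function.Injective z := fun a b h => by simpa [z] using h
  set g : ℝ → ℝ := fun x => ∑ i ∈ Finset.range (m + 1), |(Lagrange.basis (Finset.range (m + 1)) z i).eval x -
    (Lagrange.basis (Finset.range (m + 1)) z i).eval 0|
  have hg : Continuous g := by
    refine continuous_finsetSum _ fun i _ => ?_
    exact ((Polynomial.continuous _).sub continuous_const).abs
  have hg0 : g 0 = 0 := by simp [g]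
  have h1 : ∀ᶠ x in nhds (0:ℝ), g x < δ := by
    have := hg.tendsto 0
    rw [hg0] at this
    exact this.eventually (gt_mem_nhds hδ)
  obtain ⟨r, hr, hr1⟩ := Metric.eventually_nhds_iff.1 h1
  refine ⟨min (r / 2) 1, by positivity, min_le_right _ _, fun p hp B hB => ?_⟩
  have hε : g (min (r/2) 1) < δ := hr1 (by
    rw [Real.dist_eq, sub_zero, abs_of_pos (by positivity)]
    exact lt_of_le_of_lt (min_le_left _ _) (by linarith))
  set ε := min (r / 2) 1
  rw [poly_rep m ε z hz p hp, poly_rep m 0 z hz p hp, ← Finset.sum_sub_distrib]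
  have hB0 : 0 ≤ B := (abs_nonneg _).trans (hB 0 (Nat.zero_le _))
  refine le_trans ?_ (mul_le_mul_of_nonneg_right hε.le hB0)
  rw [Finset.sum_mul]
  refine (Finset.abs_sum_le_sum_abs _ _).trans (Finset.sum_le_sum fun i hi => ?_)
  rw [← mul_sub, abs_mul, mul_comm]
  exact mul_le_mul_of_nonneg_left (hB i (by simpa [Nat.lt_succ_iff] using hi)) (abs_nonneg _)

structure Loc (d s : ℕ) (α : Fin d → ℕ) (f : (Fin d → ℝ) → ℝ) (x0 : Fin d → ℝ) (T : (Fin d → ℝ) → ℝ)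
    (a : Fin d → ℝ) (m : ℕ) : Prop where
  hx : ∀ k, x0 k ∈ Set.Ioo (0:ℝ) 1
  mono : MonotoneOn f (Set.Icc (0 : Fin d → ℝ) 1)
  hα : ∀ k : Fin d, (k:ℕ) < s → 1 ≤ α k
  poly : ∀ u w : Fin d → ℝ, ∃ p : Polynomial ℝ, p.natDegree ≤ m ∧ ∀ t, p.eval t = T (u + t • w)
  axis : ∀ k : Fin d, (k:ℕ) < s → ∀ t, T (Pi.single k t) = a k * t ^ α k
  ane : ∀ k : Fin d, (k:ℕ) < s → a k ≠ 0
  indep : ∀ u w : Fin d → ℝ, (∀ k : Fin d, (k:ℕ) < s → u k = w k) → T u = T w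
  appr : ∀ L : ℝ, 0 < L → ∀ ε : ℝ, 0 < ε → ∀ᶠ ω in nhdsWithin (0:ℝ) (Set.Ioi 0), ∀ x ∈ Set.Icc (0 : Fin d → ℝ) 1,
    (∀ k : Fin d, (k:ℕ) < s → |x k - x0 k| ≤ L * ω ^ ((α k : ℝ)⁻¹)) → |f x - f x0 - T (x - x0)| ≤ ε * ω

variable {d s : ℕ} {α : Fin d → ℕ} {f : (Fin d → ℝ) → ℝ} {x0 : Fin d → ℝ} {T : (Fin d → ℝ) → ℝ} {a : Fin d → ℝ} {m : ℕ}

lemma Loc.refl (h : Loc d s α f x0 T a m) :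
    Loc d s α (fun x => - f (1 - x)) (1 - x0) (fun u => - T (- u)) (fun k => -((-1) ^ α k * a k)) m where
  hx k := by
    have := h.hx k
    simp only [Pi.sub_apply, Pi.one_apply]
    constructor <;> linarith [this.1, this.2]
  mono := by
    intro x hx y hy hxy
    have : f (1 - y) ≤ f (1 - x) := h.mono ⟨by simpa using hy.2, by simpa using hy.1⟩
      ⟨by simpa using hx.2, by simpa using hx.1⟩ (sub_le_sub_left hxy 1)
    simp only
    linarith
  hα := h.hα
  poly := by
    intro u w
    obtain ⟨p, hp, he⟩ := h.poly (-u) (-w)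
    refine ⟨-p, by simpa using hp, fun t => ?_⟩
    rw [Polynomial.eval_neg, he]
    congr 2
    simp [add_comm]
  axis := by
    intro k hk t
    have : - (Pi.single k t : Fin d → ℝ) = Pi.single k (-t) := by rw [Pi.single_neg]
    rw [this, h.axis k hk, neg_pow]
    ring
  ane := by
    intro k hk
    have := h.ane k hk
    simp [this]
  indep := by
    intro u w huw
    rw [h.indep (-u) (-w) (fun k hk => by simp [huw k hk])]
  appr := by
    intro L hL ε hε
    filter_upwards [h.appr L hL ε hε] with ω hω x hx hxk
    have h1 := hω (1 - x) ⟨by simpa using hx.2, by simpa using hx.1⟩ (fun k hk => by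
      have := hxk k hk
      rw [Pi.sub_apply, Pi.one_apply] at this ⊢
      rwa [abs_sub_comm, show x0 k - (1 - x k) = x k - (1 - x0 k) by ring])
    have e : -(x - (1 - x0)) = 1 - x - x0 := by ring
    have e2 : (1 : Fin d → ℝ) - (1 - x0) = x0 := by ring
    simp only [e, e2]
    rw [← abs_neg]
    convert h1 using 2
    ring

/-- scaling map -/
noncomputable def sc (s : ℕ) (α : Fin d → ℕ) (ω : ℝ) (h : Fin d → ℝ) : Fin d → ℝ :=
  fun k => if (k:ℕ) < s then ω ^ ((α k : ℝ)⁻¹) * h k else 0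

lemma sc_lin (ω t : ℝ) (u w : Fin d → ℝ) : sc s α ω (u + t • w) = sc s α ω u + t • sc s α ω w := by
  ext k
  simp only [sc, Pi.add_apply, Pi.smul_apply, smul_eq_mul]
  split_ifs <;> ring

lemma rp0 (k : ℕ) (hk : 1 ≤ k) : Tendsto (fun ω : ℝ => ω ^ ((k : ℝ)⁻¹)) (nhdsWithin (0:ℝ) (Set.Ioi 0)) (nhds 0) := by
  have hpos : 0 < (k:ℝ)⁻¹ := inv_pos.2 (by exact_mod_cast hk)
  have := (Real.continuousAt_rpow_const 0 ((k:ℝ)⁻¹) (Or.inr hpos.le)).tendsto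
  rw [Real.zero_rpow hpos.ne'] at this
  exact this.mono_left nhdsWithin_le_nhds

lemma Loc.inb (h : Loc d s α f x0 T a m) (L : ℝ) : ∀ᶠ ω in nhdsWithin (0:ℝ) (Set.Ioi 0),
    ∀ k : Fin d, (k:ℕ) < s → L * ω ^ ((α k : ℝ)⁻¹) ≤ x0 k ∧ L * ω ^ ((α k : ℝ)⁻¹) ≤ 1 - x0 k := by
  rw [eventually_all]
  intro k
  by_cases hk : (k:ℕ) < s
  · have h1 : Tendsto (fun ω : ℝ => L * ω ^ ((α k : ℝ)⁻¹)) (nhdsWithin (0:ℝ) (Set.Ioi 0)) (nhds 0) := by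
      simpa using (rp0 (α k) (h.hα k hk)).const_mul L
    have h2 := (h.hx k).1
    have h3 := (h.hx k).2
    filter_upwards [h1.eventually (gt_mem_nhds h2), h1.eventually (gt_mem_nhds (sub_pos.2 h3))] with ω h4 h5 _
    exact ⟨h4.le, h5.le⟩
  · exact Eventually.of_forall fun ω hk' => absurd hk' hk

/-- the point with the first `s` coordinates scaled by `h`, other coordinates equal to `y` -/
noncomputable def pt (s : ℕ) (α : Fin d → ℕ) (x0 : Fin d → ℝ) (ω : ℝ) (h : Fin d → ℝ) (y : Fin d → ℝ) : Fin d → ℝ :=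
  fun k => if (k:ℕ) < s then x0 k + ω ^ ((α k : ℝ)⁻¹) * h k else y k

lemma Loc.key (h : Loc d s α f x0 T a m) (L : ℝ) (hL : 0 < L) (ε : ℝ) (hε : 0 < ε) :
    ∀ᶠ ω in nhdsWithin (0:ℝ) (Set.Ioi 0), ∀ u y : Fin d → ℝ, (∀ k : Fin d, (k:ℕ) < s → |u k| ≤ L) →
      y ∈ Set.Icc (0 : Fin d → ℝ) 1 → pt s α x0 ω u y ∈ Set.Icc (0 : Fin d → ℝ) 1 ∧
      |f (pt s α x0 ω u y) - f x0 - T (sc s α ω u)| ≤ ε * ω := by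
  filter_upwards [h.appr L hL ε hε, h.inb L, self_mem_nhdsWithin] with ω h1 h2 h0 u y hu hy
  have h0' : 0 < ω := h0
  have hb : ∀ k : Fin d, (k:ℕ) < s → |ω ^ ((α k : ℝ)⁻¹) * u k| ≤ L * ω ^ ((α k : ℝ)⁻¹) := by
    intro k hk
    have := Real.rpow_pos_of_pos h0' ((α k : ℝ)⁻¹)
    rw [abs_mul, abs_of_pos this, mul_comm]
    exact mul_le_mul_of_nonneg_right (hu k hk) this.le
  have hmem : pt s α x0 ω u y ∈ Set.Icc (0 : Fin d → ℝ) 1 := by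
    constructor <;> intro k <;> simp only [pt, Pi.zero_apply, Pi.one_apply] <;> split_ifs with hk
    · linarith [(abs_le.1 (hb k hk)).1, (h2 k hk).1]
    · exact hy.1 k
    · linarith [(abs_le.1 (hb k hk)).2, (h2 k hk).2]
    · exact hy.2 k
  refine ⟨hmem, ?_⟩
  have h3 := h1 _ hmem (fun k hk => by
    simp only [pt, if_pos hk, add_sub_cancel_left]
    exact hb k hk)
  rw [h.indep (pt s α x0 ω u y - x0) (sc s α ω u) (fun k hk => by simp [pt, sc, hk])] at h3
  exact h3

lemma sc_single (ω t : ℝ) (k : Fin d) (hk : (k:ℕ) < s) :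
    sc s α ω (Pi.single k t) = Pi.single k (ω ^ ((α k : ℝ)⁻¹) * t) := by
  ext j
  by_cases hj : j = k
  · subst hj; simp [sc, hk]
  · simp [sc, hj]

lemma Loc.T_single (h : Loc d s α f x0 T a m) (ω t : ℝ) (hω : 0 < ω) (k : Fin d) (hk : (k:ℕ) < s) :
    T (sc s α ω (Pi.single k t)) = a k * t ^ α k * ω := by
  rw [sc_single ω t k hk, h.axis k hk, mul_pow, ← Real.rpow_natCast, ← Real.rpow_mul hω.le,
    inv_mul_cancel₀, Real.rpow_one]
  · ring
  · have := h.hα k hk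
    positivity

lemma pt_mono (ω : ℝ) (hω : 0 < ω) (u w y : Fin d → ℝ) (huw : u ≤ w) : pt s α x0 ω u y ≤ pt s α x0 ω w y := by
  intro k
  simp only [pt]
  split_ifs
  · have := mul_le_mul_of_nonneg_left (huw k) (Real.rpow_pos_of_pos hω ((α k : ℝ)⁻¹)).le
    linarith
  · exact le_rfl

lemma Loc.x0mem (h : Loc d s α f x0 T a m) : x0 ∈ Set.Icc (0 : Fin d → ℝ) 1 :=
  ⟨fun k => (h.hx k).1.le, fun k => (h.hx k).2.le⟩

lemma Loc.apos (h : Loc d s α f x0 T a m) (k : Fin d) (hk : (k:ℕ) < s) : 0 < a k := by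
  refine lt_of_le_of_ne ?_ (h.ane k hk).symm
  refine le_of_forall_pos_le_add fun ε hε => ?_
  obtain ⟨ω, h1, h0⟩ := ((h.key 1 one_pos ε hε).and self_mem_nhdsWithin).exists
  have h0' : 0 < ω := h0
  obtain ⟨h2, h3⟩ := h1 (Pi.single k 1) x0 (fun j _ => by
    by_cases hj : j = k
    · subst hj; simp
    · simp [hj]) h.x0mem
  have h4 : f x0 ≤ f (pt s α x0 ω (Pi.single k 1) x0) := by
    have e : x0 = pt s α x0 ω 0 x0 := by ext j; simp [pt]
    refine h.mono h.x0mem h2 ?_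
    conv_lhs => rw [e]
    exact pt_mono ω h0' _ _ _ (by simp)
  rw [h.T_single ω 1 h0' k hk] at h3
  have h5 := (abs_le.1 h3).2
  have : 0 ≤ (a k + ε) * ω := by rw [one_pow] at h5; linarith
  exact nonneg_of_mul_nonneg_left this h0'

/-- indicator times constant -/
noncomputable def indc (A : Finset (Fin d)) (C : ℝ) : Fin d → ℝ := fun k => if k ∈ A then C else 0

lemma Loc.corner (h : Loc d s α f x0 T a m) (C : ℝ) (hC : 0 < C) (A : Finset (Fin d)) :
    ∃ K : ℝ, 0 ≤ K ∧ ∀ᶠ ω in nhdsWithin (0:ℝ) (Set.Ioi 0), |T (sc s α ω (indc A C))| ≤ K * ω := by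
  classical
  induction A using Finset.induction_on with
  | empty =>
    refine ⟨1, zero_le_one, ?_⟩
    filter_upwards [h.key 1 one_pos 1 one_pos, self_mem_nhdsWithin] with ω h1 h0
    have h0' : 0 < ω := h0
    have h2 := (h1 0 x0 (fun _ _ => by simp) h.x0mem).2
    have e : x0 = pt s α x0 ω 0 x0 := by ext j; simp [pt]
    rw [← e] at h2
    have e2 : indc (∅ : Finset (Fin d)) C = 0 := by ext; simp [indc]
    rw [e2]
    simpa using h2
  | insert k A hkA ih =>
    obtain ⟨K, hK0, hK⟩ := ih
    by_cases hk : (k:ℕ) < s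
    swap
    · refine ⟨K, hK0, ?_⟩
      filter_upwards [hK] with ω hω
      rwa [h.indep (sc s α ω (indc (insert k A) C)) (sc s α ω (indc A C)) (fun j hj => by
        have : j ≠ k := by rintro rfl; exact hk hj
        simp [sc, indc, this])]
    obtain ⟨Λ, hΛ, hext⟩ := poly_ext m
    set B : ℝ := K + |a k| * (m * C) ^ α k + 2 with hB
    have hB0 : 0 ≤ B := by positivity
    refine ⟨Λ * B, by positivity, ?_⟩
    have hLpos : 0 < (m + 1) * C := by positivity
    filter_upwards [hK, h.key ((m + 1) * C) hLpos 1 one_pos, self_mem_nhdsWithin] with ω h1 h2 h0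
    have h0' : 0 < ω := h0
    obtain ⟨p, hp, hpe⟩ := h.poly (sc s α ω (indc A C)) (sc s α ω (Pi.single k C))
    have hC1 : C ≤ (m + 1) * C := by
      have : (0:ℝ) ≤ m := Nat.cast_nonneg _
      nlinarith
    have hpi : ∀ i : ℕ, i ≤ m → |p.eval (-(i:ℝ))| ≤ B * ω := by
      intro i hi
      have him : (i:ℝ) ≤ m := by exact_mod_cast hi
      have hi0 : (0:ℝ) ≤ i := Nat.cast_nonneg _
      have hiC : (i:ℝ) * C ≤ m * C := mul_le_mul_of_nonneg_right him hC.le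
      have hiC0 : 0 ≤ (i:ℝ) * C := by positivity
      rw [hpe, ← sc_lin]
      set u : Fin d → ℝ := indc A C + (-(i:ℝ)) • Pi.single k C with hu
      have huk : u k = -(i * C) := by simp [hu, indc, hkA]
      have huj : ∀ j, j ≠ k → u j = indc A C j := fun j hj => by simp [hu, hj]
      have hind : ∀ j, 0 ≤ indc A C j ∧ indc A C j ≤ C := fun j => by
        simp only [indc]; split_ifs <;> constructor <;> linarith
      obtain ⟨hm1, e1⟩ := h2 u x0 (fun j _ => by
        by_cases hj : j = k
        · subst hj; rw [huk, abs_neg, abs_of_nonneg hiC0]; linarith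
        · rw [huj j hj, abs_of_nonneg (hind j).1]; linarith [(hind j).2]) h.x0mem
      obtain ⟨hm2, e2⟩ := h2 (indc A C) x0 (fun j _ => by
        rw [abs_of_nonneg (hind j).1]; linarith [(hind j).2]) h.x0mem
      obtain ⟨hm3, e3⟩ := h2 (Pi.single k (-(i * C))) x0 (fun j _ => by
        by_cases hj : j = k
        · subst hj; rw [Pi.single_eq_same, abs_neg, abs_of_nonneg hiC0]; linarith
        · simp [hj]; positivity) h.x0mem
      have l1 : f (pt s α x0 ω u x0) ≤ f (pt s α x0 ω (indc A C) x0) := h.mono hm1 hm2 (pt_mono ω h0' _ _ _ (by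
        intro j
        by_cases hj : j = k
        · subst hj; rw [huk]; linarith [(hind j).1]
        · rw [huj j hj]))
      have l2 : f (pt s α x0 ω (Pi.single k (-(i * C))) x0) ≤ f (pt s α x0 ω u x0) := h.mono hm3 hm1 (pt_mono ω h0' _ _ _ (by
        intro j
        by_cases hj : j = k
        · subst hj; rw [huk]; simp
        · rw [huj j hj]; simp [hj, (hind j).1]))
      rw [h.T_single ω _ h0' k hk] at e3
      have e4 : |a k * (-(i * C)) ^ α k * ω| ≤ |a k| * (m * C) ^ α k * ω := by
        rw [abs_mul, abs_mul, abs_pow, abs_neg, abs_of_nonneg hiC0, abs_of_pos h0']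
        gcongr
      rw [abs_le] at *
      have hA : 0 ≤ |a k| * (m * C) ^ α k * ω := by positivity
      have hKω : 0 ≤ K * ω := by positivity
      have : B * ω = K * ω + |a k| * (m * C) ^ α k * ω + 2 * ω := by rw [hB]; ring
      rw [this]
      constructor <;> linarith
    have := hext p hp _ hpi
    rw [hpe, ← sc_lin, one_smul] at this
    have e : indc A C + Pi.single k C = indc (insert k A) C := by
      ext j
      by_cases hj : j = k
      · subst hj; simp [indc, hkA]
      · simp [indc, hj]
    rw [e] at this
    rw [mul_assoc]
    exact this

lemma Loc.up (h : Loc d s α f x0 T a m) (C : ℝ) : ∃ K : ℝ, ∀ᶠ ω in nhdsWithin (0:ℝ) (Set.Ioi 0),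
    ∀ x ∈ Set.Icc (0 : Fin d → ℝ) 1, (∀ k : Fin d, (k:ℕ) < s → x k ≤ x0 k + C * ω ^ ((α k : ℝ)⁻¹)) →
      f x - f x0 ≤ K * ω := by
  obtain ⟨C', hCC, hC'⟩ : ∃ C', C ≤ C' ∧ 0 < C' := ⟨max C 1, le_max_left _ _, by positivity⟩
  obtain ⟨K, hK0, hK⟩ := h.corner C' hC' Finset.univ
  refine ⟨K + 1, ?_⟩
  filter_upwards [hK, h.key C' hC' 1 one_pos, self_mem_nhdsWithin] with ω h1 h2 h0 x hx hxk
  have h0' : 0 < ω := h0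
  obtain ⟨e1, e2⟩ := h2 (indc Finset.univ C') 1 (fun k _ => by simp [indc, abs_of_pos hC']) ⟨zero_le_one, le_rfl⟩
  have e3 : f x ≤ f (pt s α x0 ω (indc Finset.univ C') 1) := h.mono hx e1 (by
    intro k
    simp only [pt, indc, Finset.mem_univ, if_true]
    split_ifs with hk
    · have := mul_le_mul_of_nonneg_right hCC (Real.rpow_pos_of_pos h0' ((α k : ℝ)⁻¹)).le
      linarith [hxk k hk]
    · exact hx.2 k)
  linarith [(abs_le.1 e2).2, (abs_le.1 h1).2]

lemma Loc.dn1 (h : Loc d s α f x0 T a m) (k : Fin d) (hk : (k:ℕ) < s) : ∃ ε c : ℝ, 0 < ε ∧ 0 < c ∧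
    ∀ᶠ ω in nhdsWithin (0:ℝ) (Set.Ioi 0), ∀ x ∈ Set.Icc (0 : Fin d → ℝ) 1,
      (∀ j : Fin d, (j:ℕ) < s → j ≠ k → x j ≤ x0 j + ε * ω ^ ((α j : ℝ)⁻¹)) → x k ≤ x0 k - ω ^ ((α k : ℝ)⁻¹) →
      f x - f x0 ≤ - c * ω := by
  have ha := h.refl.apos k hk
  set a' : ℝ := -((-1) ^ α k * a k) with ha'
  have hTk : ∀ ω : ℝ, 0 < ω → T (sc s α ω (Pi.single k (-1))) = - a' * ω := fun ω hω => by
    rw [h.T_single ω _ hω k hk, ha']; ring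
  obtain ⟨K, hK⟩ := h.up m
  set B : ℝ := |K| + a' + 2 with hB
  have hB0 : 0 < B := by positivity
  obtain ⟨ε, hε, hε1, hcont⟩ := poly_cont m (a' / (4 * B)) (by positivity)
  refine ⟨ε, a' / 2, hε, by positivity, ?_⟩
  filter_upwards [hK, h.key (m + 1) (by positivity) 1 one_pos, h.key 1 one_pos (a' / 4) (by positivity),
    self_mem_nhdsWithin] with ω h1 h2 h3 h0 x hx hxj hxk
  have h0' : 0 < ω := h0
  set w : Fin d → ℝ := indc (Finset.univ.erase k) 1 with hw
  have hwk : w k = 0 := by simp [hw, indc]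
  have hwj : ∀ j, j ≠ k → w j = 1 := fun j hj => by simp [hw, indc, hj]
  set e : Fin d → ℝ := Pi.single k (-1) with he
  have hek : e k = -1 := by simp [he]
  have hej : ∀ j, j ≠ k → e j = 0 := fun j hj => by simp [he, hj]
  obtain ⟨p, hp, hpe⟩ := h.poly (sc s α ω e) (sc s α ω w)
  have hm0 : (0:ℝ) ≤ m := Nat.cast_nonneg _
  have hpi : ∀ i : ℕ, i ≤ m → |p.eval (i:ℝ)| ≤ B * ω := by
    intro i hi
    have him : (i:ℝ) ≤ m := by exact_mod_cast hi
    have hi0 : (0:ℝ) ≤ i := Nat.cast_nonneg _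
    rw [hpe, ← sc_lin]
    have huk : (e + (i:ℝ) • w) k = -1 := by simp [hek, hwk]
    have huj : ∀ j, j ≠ k → (e + (i:ℝ) • w) j = i := fun j hj => by simp [hej j hj, hwj j hj]
    set u : Fin d → ℝ := e + (i:ℝ) • w with hu
    obtain ⟨hm1, e1⟩ := h2 u x0 (fun j _ => by
      by_cases hj : j = k
      · subst hj; rw [huk]; simp
      · rw [huj j hj, abs_of_nonneg hi0]; linarith) h.x0mem
    obtain ⟨hm2, e2⟩ := h2 e x0 (fun j _ => by
      by_cases hj : j = k
      · subst hj; rw [hek]; simp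
      · rw [hej j hj]; simp; linarith) h.x0mem
    have l1 : f (pt s α x0 ω e x0) ≤ f (pt s α x0 ω u x0) := h.mono hm2 hm1 (pt_mono ω h0' _ _ _ (by
      intro j
      by_cases hj : j = k
      · subst hj; rw [huk, hek]
      · rw [huj j hj, hej j hj]; exact hi0))
    have l2 := h1 _ hm1 (fun j hj' => by
      simp only [pt, if_pos hj']
      have hr := (Real.rpow_pos_of_pos h0' ((α j : ℝ)⁻¹)).le
      by_cases hj : j = k
      · subst hj; rw [huk]; nlinarith
      · rw [huj j hj]; nlinarith)
    rw [he, hTk ω h0', ← he] at e2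
    have hKω : K * ω ≤ |K| * ω := mul_le_mul_of_nonneg_right (le_abs_self K) h0'.le
    have hKω0 : 0 ≤ |K| * ω := by positivity
    have haω : 0 ≤ a' * ω := by positivity
    rw [abs_le] at *
    have : B * ω = |K| * ω + a' * ω + 2 * ω := by rw [hB]; ring
    rw [this]
    constructor <;> linarith [e1.1, e1.2, e2.1, e2.2]
  have h5 := hcont p hp _ hpi
  have h6 : a' / (4 * B) * (B * ω) = a' / 4 * ω := by field_simp
  rw [h6, hpe, hpe, zero_smul, add_zero, ← sc_lin, he, hTk ω h0', ← he] at h5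
  have huk : (e + ε • w) k = -1 := by simp [hek, hwk]
  have huj : ∀ j, j ≠ k → (e + ε • w) j = ε := fun j hj => by simp [hej j hj, hwj j hj]
  obtain ⟨hm1, e1⟩ := h3 (e + ε • w) 1 (fun j _ => by
    by_cases hj : j = k
    · subst hj; rw [huk]; simp
    · rw [huj j hj, abs_of_pos hε]; exact hε1) ⟨zero_le_one, le_rfl⟩
  have l1 : f x ≤ f (pt s α x0 ω (e + ε • w) 1) := h.mono hx hm1 (by
    intro j
    simp only [pt]
    split_ifs with hj'
    · by_cases hj : j = k
      · subst hj; rw [huk]; linarith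
      · rw [huj j hj]; linarith [hxj j hj' hj]
    · exact hx.2 j)
  linarith [(abs_le.1 e1).2, (abs_le.1 h5).2]

lemma Loc.dn2 (h : Loc d s α f x0 T a m) (C K : ℝ) (k : Fin d) (hk : (k:ℕ) < s) : ∃ R0 : ℝ, 0 < R0 ∧
    ∀ᶠ ω in nhdsWithin (0:ℝ) (Set.Ioi 0), ∀ x ∈ Set.Icc (0 : Fin d → ℝ) 1,
      (∀ j : Fin d, (j:ℕ) < s → x j ≤ x0 j + C * ω ^ ((α j : ℝ)⁻¹)) → x k ≤ x0 k - R0 * ω ^ ((α k : ℝ)⁻¹) →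
      f x - f x0 ≤ - K * ω := by
  obtain ⟨ε, c, hε, hc, hev⟩ := h.dn1 k hk
  have hαk : (0:ℝ) < α k := by exact_mod_cast h.hα k hk
  have t1 : ∀ᶠ R : ℝ in atTop, ∀ j : Fin d, (j:ℕ) < s → C ≤ ε * R ^ ((α k : ℝ) * (α j : ℝ)⁻¹) := by
    rw [eventually_all]
    intro j
    by_cases hj : (j:ℕ) < s
    · have hαj : (0:ℝ) < α j := by exact_mod_cast h.hα j hj
      have := (tendsto_rpow_atTop (y := (α k : ℝ) * (α j : ℝ)⁻¹) (by positivity)).const_mul_atTop hε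
      filter_upwards [this.eventually_ge_atTop C] with R hR _ using hR
    · exact Eventually.of_forall fun R hj' => absurd hj' hj
  have t2 : ∀ᶠ R : ℝ in atTop, K ≤ c * R ^ (α k : ℝ) :=
    ((tendsto_rpow_atTop hαk).const_mul_atTop hc).eventually_ge_atTop K
  obtain ⟨R, hR1, hR2, hR0⟩ := (t1.and (t2.and (eventually_gt_atTop 0))).exists
  refine ⟨R, hR0, ?_⟩
  have hRp : 0 < R ^ (α k : ℝ) := Real.rpow_pos_of_pos hR0 _
  have tt : Tendsto (fun ω : ℝ => R ^ (α k : ℝ) * ω) (nhdsWithin (0:ℝ) (Set.Ioi 0)) (nhdsWithin (0:ℝ) (Set.Ioi 0)) := by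
    refine tendsto_nhdsWithin_iff.2 ⟨?_, ?_⟩
    · have : Tendsto (fun ω : ℝ => R ^ (α k : ℝ) * ω) (nhds 0) (nhds (R ^ (α k : ℝ) * 0)) :=
        (continuous_const.mul continuous_id).tendsto 0
      rw [mul_zero] at this
      exact this.mono_left nhdsWithin_le_nhds
    · filter_upwards [self_mem_nhdsWithin] with ω hω
      exact mul_pos hRp hω
  filter_upwards [tt.eventually hev, self_mem_nhdsWithin] with ω h1 h0 x hx hxj hxk
  have h0' : 0 < ω := h0
  have hpw : ∀ j : Fin d, (R ^ (α k : ℝ) * ω) ^ ((α j : ℝ)⁻¹) = R ^ ((α k : ℝ) * (α j : ℝ)⁻¹) * ω ^ ((α j : ℝ)⁻¹) := fun j => by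
    rw [Real.mul_rpow hRp.le h0'.le, ← Real.rpow_mul hR0.le]
  have := h1 x hx (fun j hj _ => by
    rw [hpw, ← mul_assoc]
    have := mul_le_mul_of_nonneg_right (hR1 j hj) (Real.rpow_pos_of_pos h0' ((α j : ℝ)⁻¹)).le
    linarith [hxj j hj]) (by
    rw [hpw, mul_inv_cancel₀ hαk.ne', Real.rpow_one]; exact hxk)
  have h9 := mul_le_mul_of_nonneg_right hR2 h0'.le
  linarith

lemma Loc.dn (h : Loc d s α f x0 T a m) (C K : ℝ) : ∃ R : ℝ, 0 < R ∧
    ∀ᶠ ω in nhdsWithin (0:ℝ) (Set.Ioi 0), ∀ k : Fin d, (k:ℕ) < s → ∀ x ∈ Set.Icc (0 : Fin d → ℝ) 1,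
      (∀ j : Fin d, (j:ℕ) < s → x j ≤ x0 j + C * ω ^ ((α j : ℝ)⁻¹)) → x k ≤ x0 k - R * ω ^ ((α k : ℝ)⁻¹) →
      f x - f x0 ≤ - K * ω := by
  have : ∀ k : Fin d, ∃ R0 : ℝ, 0 < R0 ∧ ((k:ℕ) < s → 
    ∀ᶠ ω in nhdsWithin (0:ℝ) (Set.Ioi 0), ∀ x ∈ Set.Icc (0 : Fin d → ℝ) 1,
      (∀ j : Fin d, (j:ℕ) < s → x j ≤ x0 j + C * ω ^ ((α j : ℝ)⁻¹)) → x k ≤ x0 k - R0 * ω ^ ((α k : ℝ)⁻¹) →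
      f x - f x0 ≤ - K * ω) := by
    intro k
    by_cases hk : (k:ℕ) < s
    · obtain ⟨R, h1, h2⟩ := h.dn2 C K k hk
      exact ⟨R, h1, fun _ => h2⟩
    · exact ⟨1, one_pos, fun h' => absurd h' hk⟩
  choose R0 hR0 hR using this
  have hle : ∀ k, R0 k ≤ ∑ i, R0 i := fun k =>
    Finset.single_le_sum (f := R0) (fun i _ => (hR0 i).le) (Finset.mem_univ k)
  have hs0 : 0 ≤ ∑ i, R0 i := Finset.sum_nonneg (fun i _ => (hR0 i).le)
  refine ⟨∑ i, R0 i + 1, by linarith, ?_⟩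
  rw [eventually_all]
  intro k
  by_cases hk : (k:ℕ) < s
  · filter_upwards [hR k hk, self_mem_nhdsWithin] with ω h1 h0 _ x hx hxj hxk
    refine h1 x hx hxj (hxk.trans ?_)
    have := mul_le_mul_of_nonneg_right (show R0 k ≤ ∑ i, R0 i + 1 by linarith [hle k]) (Real.rpow_pos_of_pos (show 0 < ω from h0) ((α k : ℝ)⁻¹)).le
    linarith
  · exact Eventually.of_forall fun R hj' => absurd hj' hk

lemma refl_mem {x : Fin d → ℝ} (hx : x ∈ Set.Icc (0 : Fin d → ℝ) 1) : 1 - x ∈ Set.Icc (0 : Fin d → ℝ) 1 :=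
  ⟨sub_nonneg.2 hx.2, sub_le_self _ hx.1⟩

lemma Loc.lo (h : Loc d s α f x0 T a m) (C : ℝ) : ∃ K : ℝ, ∀ᶠ ω in nhdsWithin (0:ℝ) (Set.Ioi 0),
    ∀ x ∈ Set.Icc (0 : Fin d → ℝ) 1, (∀ k : Fin d, (k:ℕ) < s → x0 k ≤ x k + C * ω ^ ((α k : ℝ)⁻¹)) →
      -(K * ω) ≤ f x - f x0 := by
  obtain ⟨K, hK⟩ := h.refl.up C
  refine ⟨K, ?_⟩
  filter_upwards [hK] with ω h1 x hx hxk
  have := h1 (1 - x) (refl_mem hx) (fun k hk => by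
    have := hxk k hk
    simp only [Pi.sub_apply, Pi.one_apply]; linarith)
  simp only [sub_sub_cancel] at this
  linarith

lemma Loc.uu (h : Loc d s α f x0 T a m) (C K : ℝ) : ∃ R : ℝ, 0 < R ∧
    ∀ᶠ ω in nhdsWithin (0:ℝ) (Set.Ioi 0), ∀ k : Fin d, (k:ℕ) < s → ∀ x ∈ Set.Icc (0 : Fin d → ℝ) 1,
      (∀ j : Fin d, (j:ℕ) < s → x0 j ≤ x j + C * ω ^ ((α j : ℝ)⁻¹)) → x0 k + R * ω ^ ((α k : ℝ)⁻¹) ≤ x k →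
      K * ω ≤ f x - f x0 := by
  obtain ⟨R, hR, hK⟩ := h.refl.dn C K
  refine ⟨R, hR, ?_⟩
  filter_upwards [hK] with ω h1 k hk x hx hxk hxR
  have := h1 k hk (1 - x) (refl_mem hx) (fun k hk => by
    have := hxk k hk
    simp only [Pi.sub_apply, Pi.one_apply]; linarith) (by
    simp only [Pi.sub_apply, Pi.one_apply]; linarith)
  simp only [sub_sub_cancel] at this
  linarith
end


section
variable {d : ℕ}

lemma pderivIter_zero (k : Fin d) (f : (Fin d → ℝ) → ℝ) : pderivIter d k 0 f = f := rfl

lemma foldr_pd (j : Fin d → ℕ) (k : Fin d) (hj : ∀ l, l ≠ k → j l = 0) (f : (Fin d → ℝ) → ℝ) (L : List (Fin d))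
    (hL : L.Nodup) : L.foldr (fun k g => pderivIter d k (j k) g) f = if k ∈ L then pderivIter d k (j k) f else f := by
  induction L with
  | nil => simp
  | cons b L ih =>
    rw [List.nodup_cons] at hL
    rw [List.foldr_cons, ih hL.2]
    by_cases hb : b = k
    · subst hb
      simp [hL.1]
    · rw [hj b hb, pderivIter_zero]
      simp [Ne.symm hb]

lemma mixed_axis (j : Fin d → ℕ) (k : Fin d) (hj : ∀ l, l ≠ k → j l = 0) (f : (Fin d → ℝ) → ℝ) :
    mixedPDeriv d j f = pderivIter d k (j k) f := by
  rw [mixedPDeriv, foldr_pd j k hj f _ (List.nodup_finRange d)]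
  simp

lemma taylor_cont (s : ℕ) (α : Fin d → ℕ) (f : (Fin d → ℝ) → ℝ) (x0 : Fin d → ℝ) :
    Continuous (taylorJ0 d s α f x0) := by
  unfold taylorJ0
  refine continuous_finsetSum _ fun j _ => ?_
  split_ifs
  · refine continuous_const.mul (continuous_finsetProd _ fun k _ => ?_)
    exact ((continuous_apply k).sub continuous_const).pow _
  · exact continuous_const

lemma taylor_axis (s : ℕ) (α : Fin d → ℕ) (f : (Fin d → ℝ) → ℝ) (x0 : Fin d → ℝ) (k : Fin d) (hk : (k:ℕ) < s)
    (hα : 1 ≤ α k) (hz : ∀ j : ℕ, 1 ≤ j → j ≤ α k - 1 → pderivIter d k j f x0 = 0) (t : ℝ) :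
    taylorJ0 d s α f x0 (x0 + Pi.single k t) = f x0 +
      pderivIter d k (α k) f x0 / (Nat.factorial (α k) : ℝ) * t ^ α k := by
  unfold taylorJ0
  let z : ∀ l : Fin d, Fin (α l + 1) := fun l => 0
  let y : ∀ l : Fin d, Fin (α l + 1) := fun l => if l = k then Fin.last (α l) else 0
  have hyk : (y k : ℕ) = α k := by simp [y]
  have hyl : ∀ l, l ≠ k → (y l : ℕ) = 0 := fun l hl => by simp [y, hl]
  have hzl : ∀ l, (z l : ℕ) = 0 := fun l => by simp [z]
  have hzy : z ≠ y := by
    intro h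
    have := hzl k
    rw [h, hyk] at this
    omega
  rw [Finset.sum_eq_add z y hzy]
  · congr 1
    · rw [if_pos]
      · rw [mixed_axis _ k (fun l _ => hzl l)]
        simp [z, pderivIter_zero]
      · simp [z]
    · rw [if_pos]
      · rw [mixed_axis _ k (fun l hl => hyl l hl), hyk]
        rw [Finset.prod_eq_single k (fun l _ hl => by rw [hyl l hl]; simp) (by simp),
          Finset.prod_eq_single k (fun l _ hl => by rw [hyl l hl]; simp) (by simp), hyk]
        simp
      · refine ⟨fun l hl => hyl l (by rintro rfl; omega), ?_⟩
        rw [Finset.sum_eq_single k (fun l _ hl => by rw [hyl l hl]; simp) (by simp), hyk, if_pos hk,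
          div_self (by positivity)]
  · rintro c - ⟨hcz, hcy⟩
    split_ifs with hc
    swap
    · rfl
    by_cases hl : ∀ l, l ≠ k → (c l : ℕ) = 0
    · rw [mixed_axis _ k hl]
      have h0 : (c k : ℕ) ≠ 0 := by
        intro h0
        apply hcz
        ext l
        rw [hzl]
        by_cases h : l = k
        · subst h; exact h0
        · exact hl l h
      have h1 : (c k : ℕ) ≠ α k := by
        intro h0
        apply hcy
        ext l
        by_cases h : l = k
        · subst h; rw [h0, hyk]
        · rw [hl l h, hyl l h]
      have h2 := (c k).2
      rw [hz (c k) (by omega) (by omega)]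
      simp
    · push Not at hl
      obtain ⟨l, hlk, hl0⟩ := hl
      exact mul_eq_zero_of_right _ (Finset.prod_eq_zero (Finset.mem_univ l) (by simp [hlk, hl0]))
  · simp
  · simp

lemma taylor_poly (s : ℕ) (α : Fin d → ℕ) (f : (Fin d → ℝ) → ℝ) (x0 : Fin d → ℝ) (u w : Fin d → ℝ) :
    ∃ p : Polynomial ℝ, p.natDegree ≤ ∑ k, α k ∧ ∀ t, p.eval t = taylorJ0 d s α f x0 (x0 + (u + t • w)) := by
  refine ⟨∑ j : (∀ k : Fin d, Fin (α k + 1)),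
    if (∀ k : Fin d, s ≤ (k : ℕ) → (j k : ℕ) = 0) ∧
        (∑ k : Fin d, if (k : ℕ) < s then ((j k : ℕ) : ℝ) / (α k : ℝ) else 0) ≤ 1 then
      Polynomial.C (mixedPDeriv d (fun k => (j k : ℕ)) f x0 /
          ∏ k : Fin d, (Nat.factorial (j k : ℕ) : ℝ)) *
        ∏ k : Fin d, (Polynomial.C (w k) * Polynomial.X + Polynomial.C (u k)) ^ ((j k : ℕ))
    else 0, ?_, fun t => ?_⟩
  · refine Polynomial.natDegree_sum_le_of_forall_le _ _ fun j _ => ?_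
    split_ifs
    · refine (Polynomial.natDegree_C_mul_le _ _).trans ((Polynomial.natDegree_prod_le _ _).trans ?_)
      refine Finset.sum_le_sum fun k _ => ?_
      refine Polynomial.natDegree_pow_le.trans ?_
      calc (j k : ℕ) * (Polynomial.C (w k) * Polynomial.X + Polynomial.C (u k)).natDegree ≤ (j k : ℕ) * 1 :=
            Nat.mul_le_mul_left _ Polynomial.natDegree_linear_le
        _ ≤ α k := by have := (j k).2; omega
    · simp
  · unfold taylorJ0
    rw [Polynomial.eval_finsetSum]
    refine Finset.sum_congr rfl fun j _ => ?_
    split_ifs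
    · rw [Polynomial.eval_mul, Polynomial.eval_C, Polynomial.eval_prod]
      congr 1
      refine Finset.prod_congr rfl fun k _ => ?_
      simp
      ring
    · simp

lemma loc_of_A1 {s : ℕ} {α : Fin d → ℕ} {f₀ : (Fin d → ℝ) → ℝ} {x₀ : Fin d → ℝ}
    (hA : AssumptionA1 d s α f₀ x₀) :
    Loc d s α f₀ x₀ (fun u => taylorJ0 d s α f₀ x₀ (x₀ + u) - f₀ x₀)
      (fun k => pderivIter d k (α k) f₀ x₀ / (Nat.factorial (α k) : ℝ)) (∑ k, α k) := by
  obtain ⟨hs, hx, hm, hα, -, hder, happ⟩ := hA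
  refine ⟨hx, hm, hα, ?_, ?_, ?_, ?_, ?_⟩
  · intro u w
    obtain ⟨p, hp, he⟩ := taylor_poly s α f₀ x₀ u w
    refine ⟨p - Polynomial.C (f₀ x₀), by rwa [Polynomial.natDegree_sub_C], fun t => ?_⟩
    rw [Polynomial.eval_sub, he, Polynomial.eval_C]
  · intro k hk t
    rw [taylor_axis s α f₀ x₀ k hk (hα k hk) (hder k hk).1]
    ring
  · intro k hk
    exact div_ne_zero (hder k hk).2 (by positivity)
  · intro u w huw
    congr 1
    unfold taylorJ0
    refine Finset.sum_congr rfl fun j _ => ?_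
    split_ifs with hc
    · congr 1
      refine Finset.prod_congr rfl fun k _ => ?_
      by_cases hk : (k:ℕ) < s
      · simp [huw k hk]
      · rw [hc.1 k (by omega)]; simp
    · rfl
  · intro L hL ε hε
    have hL1 : 0 < max L 1 := by positivity
    have h1 := happ (max L 1) hL1 (fun i => (1/2:ℝ)^i) (fun i => by positivity)
      (pow_right_anti₀ (by norm_num) (by norm_num))
      (tendsto_pow_atTop_nhds_zero_of_lt_one (by norm_num) (by norm_num))
    obtain ⟨I, hI⟩ := eventually_atTop.1 (h1.eventually (gt_mem_nhds (show 0 < ε / 2 by positivity)))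
    have hmem : Set.Ioo (0:ℝ) ((1/2)^I) ∈ nhdsWithin (0:ℝ) (Set.Ioi 0) :=
      Ioo_mem_nhdsGT (by positivity)
    filter_upwards [hmem] with ω hω x hx' hxk
    obtain ⟨i, hi1, hi2⟩ := exists_nat_pow_near_of_lt_one hω.1 (hω.2.le.trans (pow_le_one₀ (by norm_num) (by norm_num)))
      (show (0:ℝ) < 1/2 by norm_num) (by norm_num)
    have hiI : I ≤ i := by
      by_contra hlt
      push Not at hlt
      have : ((1:ℝ)/2)^I ≤ (1/2)^(i+1) := pow_le_pow_of_le_one (by norm_num) (by norm_num) hlt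
      linarith [hω.2]
    have h2 := hI i hiI
    beta_reduce at h2
    have hpos : (0:ℝ) < (1/2)^i := by positivity
    rw [inv_mul_lt_iff₀ hpos] at h2
    obtain ⟨M, hM⟩ := isCompact_Icc.exists_bound_of_continuousOn (s := Set.Icc (0 : Fin d → ℝ) 1)
      (taylor_cont s α f₀ x₀).continuousOn
    have hb : BddAbove {y : ℝ | ∃ x : Fin d → ℝ, x ∈ Set.Icc (0 : Fin d → ℝ) 1 ∧
        (∀ k : Fin d, |x k - x₀ k| ≤ max L 1 * rVec d s α ((1/2)^i) k) ∧
        y = |f₀ x - taylorJ0 d s α f₀ x₀ x|} := by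
      refine ⟨|f₀ 0| + |f₀ 1| + M, ?_⟩
      rintro y ⟨x, hx, -, rfl⟩
      have a1 := hm ⟨le_rfl, zero_le_one⟩ hx hx.1
      have a2 := hm hx ⟨zero_le_one, le_rfl⟩ hx.2
      have a3 := hM x hx
      rw [Real.norm_eq_abs] at a3
      have := abs_le.1 a3
      rw [abs_le]
      constructor <;> linarith [neg_abs_le (f₀ 0), le_abs_self (f₀ 1), abs_nonneg (f₀ 0), abs_nonneg (f₀ 1)]
    have h3 := le_csSup hb (show |f₀ x - taylorJ0 d s α f₀ x₀ x| ∈ _ from ⟨x, hx', fun k => by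
      unfold rVec
      split_ifs with hk
      · refine (hxk k hk).trans ?_
        exact mul_le_mul (le_max_left _ _) (Real.rpow_le_rpow hω.1.le hi2 (by positivity)) (Real.rpow_nonneg hω.1.le _) hL1.le
      · have a1 := hx'.1 k
        have a2 := hx'.2 k
        simp only [Pi.zero_apply, Pi.one_apply] at a1 a2
        have a3 := hx k
        rw [mul_one]
        refine le_trans ?_ (le_max_right _ _)
        rw [abs_le]
        constructor <;> linarith [a3.1, a3.2], rfl⟩)
    have e : x₀ + (x - x₀) = x := by ring
    have e2 : f₀ x - f₀ x₀ - (taylorJ0 d s α f₀ x₀ x - f₀ x₀) = f₀ x - taylorJ0 d s α f₀ x₀ x := by ring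
    rw [e, e2]
    rw [pow_succ] at hi1
    nlinarith
end


section
structure LatD (d s κ : ℕ) (α : Fin d → ℕ) (x0 : Fin d → ℝ) (N : ℕ → Fin d → ℕ) (v : ∀ n k, Fin (N n k))
    (a : ℕ → Fin d → ℝ) (ω : ℕ → ℝ) (r : ℕ → Fin d → ℝ) : Prop where
  hκ : κ < s
  hx : ∀ k, x0 k ∈ Set.Ioo (0:ℝ) 1
  Npos : ∀ n k, (0:ℝ) < N n k
  a0 : ∀ n k, 0 ≤ a n k
  a1 : ∀ n k, a n k * N n k ≤ 1
  grid : ∀ n k, a n k + (v n k : ℝ) / N n k = x0 k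
  ωt : Tendsto ω atTop (nhdsWithin 0 (Set.Ioi 0))
  ω0 : ∀ n, 0 < ω n
  small : ∀ k : Fin d, (k:ℕ) < κ → Tendsto (fun n => (N n k : ℝ) * ω n ^ ((α k : ℝ)⁻¹)) atTop (nhds 0)
  big : ∀ k : Fin d, κ ≤ (k:ℕ) → Tendsto (fun n => (N n k : ℝ) * r n k) atTop atTop
  r0 : ∀ n, ∀ k : Fin d, (k:ℕ) < κ → r n k = 0
  r1 : ∀ n, ∀ k : Fin d, κ ≤ (k:ℕ) → (k:ℕ) < s → r n k = ω n ^ ((α k : ℝ)⁻¹)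
  r2 : ∀ n, ∀ k : Fin d, s ≤ (k:ℕ) → r n k = 1
  rle : ∀ n k, r n k ≤ 1
  prod : ∃ c : ℝ, 0 < c ∧ ∀ n, c * (ω n)⁻¹ ^ 2 ≤ (∏ k : Fin d, if (k:ℕ) < κ then 1 else (N n k : ℝ) * r n k) ∧
    (∏ k : Fin d, if (k:ℕ) < κ then 1 else (N n k : ℝ) * r n k) ≤ (ω n)⁻¹ ^ 2

variable {d s κ : ℕ} {α : Fin d → ℕ} {x0 : Fin d → ℝ} {N : ℕ → Fin d → ℕ} {v : ∀ n k, Fin (N n k)}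
    {a : ℕ → Fin d → ℝ} {ω : ℕ → ℝ} {r : ℕ → Fin d → ℝ}

def mm (lam : ℝ) (N : ℕ → Fin d → ℕ) (r : ℕ → Fin d → ℝ) : ℕ → Fin d → ℝ := fun n k => lam * ((N n k : ℝ) * r n k)

lemma ex_lam (hx : ∀ k, x0 k ∈ Set.Ioo (0:ℝ) 1) : ∃ lam : ℝ, 0 < lam ∧ lam ≤ 1 ∧ ∀ k, lam ≤ x0 k / 2 ∧ lam ≤ (1 - x0 k) / 2 := by
  have h1 : ∀ᶠ lam in nhdsWithin (0:ℝ) (Set.Ioi 0), ∀ k, lam ≤ x0 k / 2 ∧ lam ≤ (1 - x0 k) / 2 := by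
    rw [eventually_all]
    intro k
    have := hx k
    have h2 : (0:ℝ) < min (x0 k / 2) ((1 - x0 k) / 2) := lt_min (by linarith [this.1]) (by linarith [this.2])
    filter_upwards [Ioo_mem_nhdsGT h2] with l hl
    exact ⟨hl.2.le.trans (min_le_left _ _), hl.2.le.trans (min_le_right _ _)⟩
  obtain ⟨l, h2, h3⟩ := (h1.and (Ioo_mem_nhdsGT (show (0:ℝ) < 1 by norm_num))).exists
  exact ⟨l, h3.1, h3.2.le, h2⟩

variable (h : LatD d s κ α x0 N v a ω r)
include h

lemma LatD.rnn (n : ℕ) (k : Fin d) : 0 ≤ r n k := by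
  by_cases h1 : (k:ℕ) < κ
  · rw [h.r0 n k h1]
  · by_cases h2 : (k:ℕ) < s
    · rw [h.r1 n k (by omega) h2]; exact Real.rpow_nonneg (h.ω0 n).le _
    · rw [h.r2 n k (by omega)]; exact zero_le_one

lemma LatD.ge {lam : ℝ} (hl : 0 < lam) (D : ℝ) : ∀ᶠ n in atTop, ∀ k : Fin d, κ ≤ (k:ℕ) → D ≤ mm lam N r n k := by
  rw [eventually_all]
  intro k
  by_cases hk : κ ≤ (k:ℕ)
  · filter_upwards [((h.big k hk).const_mul_atTop hl).eventually_ge_atTop D] with n hn _ using hn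
  · exact Eventually.of_forall fun n h' => absurd h' hk

lemma LatD.zero (lam : ℝ) (n : ℕ) (k : Fin d) (hk : (k:ℕ) < κ) : mm lam N r n k = 0 := by
  simp [mm, h.r0 n k hk]

lemma LatD.hD {lam : ℝ} (hl : 0 < lam) (D : ℝ) : ∀ᶠ n in atTop, ∀ k : Fin d, mm lam N r n k = 0 ∨ D ≤ mm lam N r n k := by
  filter_upwards [h.ge hl D] with n hn k
  by_cases hk : (k:ℕ) < κ
  · exact Or.inl (h.zero lam n k hk)
  · exact Or.inr (hn k (by omega))

lemma LatD.setup {lam : ℝ} (hl : 0 < lam) (hlx : ∀ k, lam ≤ x0 k / 2 ∧ lam ≤ (1 - x0 k) / 2) :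
    ∀ᶠ n in atTop, SetUp (v n) (mm lam N r n) := by
  have h2 : ∀ᶠ n in atTop, ∀ k : Fin d, κ ≤ (k:ℕ) → 1 ≤ x0 k / 2 * ((N n k : ℝ) * r n k) := by
    rw [eventually_all]
    intro k
    by_cases hk : κ ≤ (k:ℕ)
    · filter_upwards [((h.big k hk).const_mul_atTop (show 0 < x0 k / 2 by linarith [(h.hx k).1])).eventually_ge_atTop 1] with n hn _ using hn
    · exact Eventually.of_forall fun n h' => absurd h' hk
  filter_upwards [h.hD hl 1, h2] with n h1 h2
  refine ⟨h1, fun k => ?_, fun k => ?_⟩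
  · by_cases hk : (k:ℕ) < κ
    · rw [h.zero lam n k hk]; positivity
    · have hN := h.Npos n k
      have e := h.grid n k
      have ea := h.a1 n k
      have e2 : (v n k : ℝ) = x0 k * N n k - a n k * N n k := by
        rw [← e]; field_simp; ring
      have e3 := h2 k (by omega)
      have e4 : (N n k : ℝ) * r n k ≤ N n k := mul_le_of_le_one_right hN.le (h.rle n k)
      have e5 : mm lam N r n k ≤ x0 k / 2 * N n k := by
        rw [mm]
        exact mul_le_mul (hlx k).1 e4 (mul_nonneg hN.le (h.rnn n k)) (by linarith [(h.hx k).1])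
      have e6 : x0 k / 2 * ((N n k : ℝ) * r n k) ≤ x0 k / 2 * N n k :=
        mul_le_mul_of_nonneg_left e4 (by linarith [(h.hx k).1])
      linarith
  · by_cases hk : (k:ℕ) < κ
    · rw [h.zero lam n k hk, add_zero]
      exact_mod_cast (v n k).2
    · have hN := h.Npos n k
      have e := h.grid n k
      have ea := mul_nonneg (h.a0 n k) hN.le
      have e2 : (v n k : ℝ) = x0 k * N n k - a n k * N n k := by
        rw [← e]; field_simp; ring
      have e4 : (N n k : ℝ) * r n k ≤ N n k := mul_le_of_le_one_right hN.le (h.rle n k)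
      have e5 : mm lam N r n k ≤ (1 - x0 k) / 2 * N n k := by
        rw [mm]
        exact mul_le_mul (hlx k).2 e4 (mul_nonneg hN.le (h.rnn n k)) (by linarith [(h.hx k).2])
      have e6 : 0 < (1 - x0 k) / 2 * N n k := mul_pos (by linarith [(h.hx k).2]) hN
      linarith

lemma LatD.wwb {lam : ℝ} (hl : 0 < lam) (hl1 : lam ≤ 1) : ∃ c2 : ℝ, 0 < c2 ∧
    ∀ᶠ n in atTop, ω n ≤ ww (mm lam N r n) ∧ ww (mm lam N r n) ≤ c2 * ω n := by
  obtain ⟨c, hc, hP⟩ := h.prod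
  refine ⟨(√(lam ^ d * c))⁻¹, by positivity, ?_⟩
  filter_upwards [h.ge hl 1] with n h1
  obtain ⟨p1, p2⟩ := hP n
  have hω := h.ω0 n
  have nn : ∀ k : Fin d, 0 ≤ (if (k:ℕ) < κ then 1 else (N n k : ℝ) * r n k) := fun k => by
    split_ifs
    · exact zero_le_one
    · exact mul_nonneg (h.Npos n k).le (h.rnn n k)
  have q1 : ∏ k, MM (mm lam N r n) k ≤ (ω n)⁻¹ ^ 2 := by
    refine le_trans (Finset.prod_le_prod (fun k _ => by linarith [MM_ge (mm lam N r n) k]) fun k _ => ?_) p2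
    split_ifs with hk
    · rw [MM, h.zero lam n k hk]; simp
    · rw [MM, max_eq_right (h1 k (by omega)), mm]
      exact mul_le_of_le_one_left (mul_nonneg (h.Npos n k).le (h.rnn n k)) hl1
  have q2 : lam ^ d * c * (ω n)⁻¹ ^ 2 ≤ ∏ k, MM (mm lam N r n) k := by
    calc lam ^ d * c * (ω n)⁻¹ ^ 2 = lam ^ d * (c * (ω n)⁻¹ ^ 2) := by ring
      _ ≤ lam ^ d * (∏ k : Fin d, if (k:ℕ) < κ then 1 else (N n k : ℝ) * r n k) :=
          mul_le_mul_of_nonneg_left p1 (by positivity)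
      _ = ∏ k : Fin d, (lam * if (k:ℕ) < κ then 1 else (N n k : ℝ) * r n k) := by
          rw [Finset.prod_mul_distrib]; simp
      _ ≤ _ := by
          refine Finset.prod_le_prod (fun k _ => mul_nonneg hl.le (nn k)) fun k _ => ?_
          split_ifs with hk
          · rw [mul_one]; exact hl1.trans (MM_ge _ _)
          · exact le_max_right _ _
  have s1 : √(∏ k, MM (mm lam N r n) k) ≤ (ω n)⁻¹ :=
    Real.sqrt_le_iff.2 ⟨by positivity, q1⟩
  have s2 : √(lam ^ d * c) * (ω n)⁻¹ ≤ √(∏ k, MM (mm lam N r n) k) := by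
    refine Real.le_sqrt_of_sq_le ?_
    rw [mul_pow, Real.sq_sqrt (by positivity)]
    exact q2
  have s0 : 0 < √(∏ k, MM (mm lam N r n) k) := Real.sqrt_pos.2 (PM_pos _)
  constructor
  · rw [ww, ← inv_inv (ω n)]
    exact inv_anti₀ s0 s1
  · rw [ww, ← inv_inv (ω n), ← mul_inv]
    exact inv_anti₀ (by positivity) s2

lemma LatD.xsub (n : ℕ) (e : ∀ k, Fin (N n k)) (k : Fin d) :
    (a n k + (e k : ℝ) / N n k) * N n k = x0 k * N n k + ((e k : ℝ) - v n k) := by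
  have hN := h.Npos n k
  rw [← h.grid n k]
  field_simp
  ring

lemma LatD.xmem (n : ℕ) (e : ∀ k, Fin (N n k)) : (fun k => a n k + (e k : ℝ) / N n k) ∈ Set.Icc (0 : Fin d → ℝ) 1 := by
  constructor
  · intro k
    have := h.a0 n k
    have hN := h.Npos n k
    simp only [Pi.zero_apply]
    positivity
  · intro k
    have := h.a1 n k
    have hN := h.Npos n k
    have h2 : ((e k : ℕ):ℝ) + 1 ≤ N n k := by exact_mod_cast (e k).2
    simp only [Pi.one_apply]
    rw [← mul_le_mul_iff_left₀ hN, add_mul, div_mul_cancel₀ _ hN.ne']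
    linarith

-- upper coordinate bound
lemma LatD.cu {lam : ℝ} (hl : 0 < lam) (hl1 : lam ≤ 1) (C : ℝ) (n : ℕ) (e : ∀ k, Fin (N n k)) (j : Fin d) (hj : (j:ℕ) < s)
    (he : (e j : ℝ) ≤ v n j + C * mm lam N r n j) :
    a n j + (e j : ℝ) / N n j ≤ x0 j + |C| * ω n ^ ((α j : ℝ)⁻¹) := by
  have hN := h.Npos n j
  rw [← mul_le_mul_iff_left₀ hN, h.xsub]
  have hr : r n j ≤ ω n ^ ((α j : ℝ)⁻¹) := by
    by_cases hk : (j:ℕ) < κ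
    · rw [h.r0 n j hk]; exact Real.rpow_nonneg (h.ω0 n).le _
    · exact (h.r1 n j (by omega) hj).le
  have h0 : 0 ≤ mm lam N r n j := mul_nonneg hl.le (mul_nonneg hN.le (h.rnn n j))
  have h1 : mm lam N r n j ≤ N n j * ω n ^ ((α j : ℝ)⁻¹) := by
    rw [mm]
    exact (mul_le_of_le_one_left (mul_nonneg hN.le (h.rnn n j)) hl1).trans (mul_le_mul_of_nonneg_left hr hN.le)
  have h2 : C * mm lam N r n j ≤ |C| * mm lam N r n j := mul_le_mul_of_nonneg_right (le_abs_self C) h0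
  have h3 := mul_le_mul_of_nonneg_left h1 (abs_nonneg C)
  linarith

lemma LatD.cl {lam : ℝ} (hl : 0 < lam) (hl1 : lam ≤ 1) (C : ℝ) (n : ℕ) (e : ∀ k, Fin (N n k)) (j : Fin d) (hj : (j:ℕ) < s)
    (he : (v n j : ℝ) ≤ e j + C * mm lam N r n j) :
    x0 j ≤ a n j + (e j : ℝ) / N n j + |C| * ω n ^ ((α j : ℝ)⁻¹) := by
  have hN := h.Npos n j
  rw [← mul_le_mul_iff_left₀ hN, add_mul (a n j + (e j : ℝ) / N n j), h.xsub]
  have hr : r n j ≤ ω n ^ ((α j : ℝ)⁻¹) := by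
    by_cases hk : (j:ℕ) < κ
    · rw [h.r0 n j hk]; exact Real.rpow_nonneg (h.ω0 n).le _
    · exact (h.r1 n j (by omega) hj).le
  have h0 : 0 ≤ mm lam N r n j := mul_nonneg hl.le (mul_nonneg hN.le (h.rnn n j))
  have h1 : mm lam N r n j ≤ N n j * ω n ^ ((α j : ℝ)⁻¹) := by
    rw [mm]
    exact (mul_le_of_le_one_left (mul_nonneg hN.le (h.rnn n j)) hl1).trans (mul_le_mul_of_nonneg_left hr hN.le)
  have h2 : C * mm lam N r n j ≤ |C| * mm lam N r n j := mul_le_mul_of_nonneg_right (le_abs_self C) h0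
  have h3 := mul_le_mul_of_nonneg_left h1 (abs_nonneg C)
  linarith

variable {f : (Fin d → ℝ) → ℝ} {T : (Fin d → ℝ) → ℝ} {b : Fin d → ℝ} {m : ℕ} (hf : Loc d s α f x0 T b m)
include hf

lemma LatD.hU {lam : ℝ} (hl : 0 < lam) (hl1 : lam ≤ 1) (C : ℝ) : ∃ K : ℝ, ∀ᶠ n in atTop,
    UpB (fun e : ∀ k, Fin (N n k) => f (fun k => a n k + (e k : ℝ) / N n k) - f x0) (v n) (mm lam N r n) C (K * ww (mm lam N r n)) := by
  obtain ⟨K, hK⟩ := hf.up |C|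
  obtain ⟨c2, -, hw⟩ := h.wwb hl hl1
  refine ⟨|K|, ?_⟩
  filter_upwards [h.ωt.eventually hK, hw] with n h1 h2 e he
  have h3 := h1 _ (h.xmem n e) (fun k hk => h.cu hl hl1 C n e k hk (he k))
  have h4 := mul_le_mul_of_nonneg_right (le_abs_self K) (h.ω0 n).le
  have h5 := mul_le_mul_of_nonneg_left h2.1 (abs_nonneg K)
  linarith

lemma LatD.hL {lam : ℝ} (hl : 0 < lam) (hl1 : lam ≤ 1) (C : ℝ) : ∃ K : ℝ, ∀ᶠ n in atTop,
    LoB (fun e : ∀ k, Fin (N n k) => f (fun k => a n k + (e k : ℝ) / N n k) - f x0) (v n) (mm lam N r n) C (K * ww (mm lam N r n)) := by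
  obtain ⟨K, hK⟩ := hf.lo |C|
  obtain ⟨c2, -, hw⟩ := h.wwb hl hl1
  refine ⟨|K|, ?_⟩
  filter_upwards [h.ωt.eventually hK, hw] with n h1 h2 e he
  have h3 := h1 _ (h.xmem n e) (fun k hk => h.cl hl hl1 C n e k hk (he k))
  have h4 := mul_le_mul_of_nonneg_right (le_abs_self K) (h.ω0 n).le
  have h5 := mul_le_mul_of_nonneg_left h2.1 (abs_nonneg K)
  linarith

omit hf in
lemma LatD.sm (R : ℝ) (hR : 0 < R) : ∀ᶠ n in atTop, ∀ k : Fin d, (k:ℕ) < κ → R * ω n ^ ((α k : ℝ)⁻¹) * N n k ≤ 1 := by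
  rw [eventually_all]
  intro k
  by_cases hk : (k:ℕ) < κ
  · filter_upwards [(h.small k hk).eventually (gt_mem_nhds (show 0 < R⁻¹ by positivity))] with n hn _
    have := mul_le_mul_of_nonneg_left hn.le hR.le
    rw [mul_inv_cancel₀ hR.ne'] at this
    linarith
  · exact Eventually.of_forall fun n h' => absurd h' hk

lemma LatD.hDn {lam : ℝ} (hl : 0 < lam) (hl1 : lam ≤ 1) (C K : ℝ) : ∃ R : ℝ, ∀ᶠ n in atTop,
    DnB (fun e : ∀ k, Fin (N n k) => f (fun k => a n k + (e k : ℝ) / N n k) - f x0) (v n) (mm lam N r n) C (K * ww (mm lam N r n)) R := by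
  obtain ⟨c2, hc2, hw⟩ := h.wwb hl hl1
  obtain ⟨R0, hR0, hK⟩ := hf.dn |C| (|K| * c2)
  refine ⟨max R0 1 / lam, ?_⟩
  filter_upwards [h.ωt.eventually hK, hw, h.sm R0 hR0] with n h1 h2 h6 e he hk
  obtain ⟨k, hk⟩ := hk
  have hN := h.Npos n k
  have hmm : max R0 1 / lam * mm lam N r n k = max R0 1 * (N n k * r n k) := by
    rw [mm]; field_simp
  rw [hmm] at hk
  have hr0 := h.rnn n k
  have hks : (k:ℕ) < s := by
    by_contra hks
    have h8 := h.r2 n k (by omega)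
    rw [h8, mul_one] at hk
    have h9 : ((v n k : ℕ):ℝ) < N n k := by exact_mod_cast (v n k).2
    have h10 := mul_le_mul_of_nonneg_right (le_max_right R0 1) hN.le
    have h11 : (0:ℝ) ≤ (e k : ℕ) := Nat.cast_nonneg _
    linarith
  have h3 := h1 k hks _ (h.xmem n e) (fun k hk => h.cu hl hl1 C n e k hk (he k)) (by
    rw [← mul_le_mul_iff_left₀ hN, h.xsub, sub_mul]
    by_cases hκ : (k:ℕ) < κ
    · have h7 := h6 k hκ
      rw [h.r0 n k hκ] at hk
      have : ((e k : ℕ):ℝ) + 1 ≤ (v n k : ℕ) := by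
        have : ((e k : ℕ):ℝ) < (v n k : ℕ) := by linarith
        exact_mod_cast this
      linarith
    · have h7 := h.r1 n k (by omega) hks
      rw [← h7]
      have := mul_le_mul_of_nonneg_right (le_max_left R0 1) (mul_nonneg hN.le hr0)
      linarith)
  have h4 := mul_le_mul_of_nonneg_right (le_abs_self K) (ww_pos (mm lam N r n)).le
  have h5 := mul_le_mul_of_nonneg_left h2.2 (abs_nonneg K)
  linarith

lemma LatD.hUu {lam : ℝ} (hl : 0 < lam) (hl1 : lam ≤ 1) (C K : ℝ) : ∃ R : ℝ, ∀ᶠ n in atTop,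
    UuB (fun e : ∀ k, Fin (N n k) => f (fun k => a n k + (e k : ℝ) / N n k) - f x0) (v n) (mm lam N r n) C (K * ww (mm lam N r n)) R := by
  obtain ⟨c2, hc2, hw⟩ := h.wwb hl hl1
  obtain ⟨R0, hR0, hK⟩ := hf.uu |C| (|K| * c2)
  refine ⟨max R0 1 / lam, ?_⟩
  filter_upwards [h.ωt.eventually hK, hw, h.sm R0 hR0] with n h1 h2 h6 e he hk
  obtain ⟨k, hk⟩ := hk
  have hN := h.Npos n k
  have hmm : max R0 1 / lam * mm lam N r n k = max R0 1 * (N n k * r n k) := by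
    rw [mm]; field_simp
  rw [hmm] at hk
  have hr0 := h.rnn n k
  have hks : (k:ℕ) < s := by
    by_contra hks
    have h8 := h.r2 n k (by omega)
    rw [h8, mul_one] at hk
    have h9 : ((e k : ℕ):ℝ) < N n k := by exact_mod_cast (e k).2
    have h10 := mul_le_mul_of_nonneg_right (le_max_right R0 1) hN.le
    have h11 : (0:ℝ) ≤ (v n k : ℕ) := Nat.cast_nonneg _
    linarith
  have h3 := h1 k hks _ (h.xmem n e) (fun k hk => h.cl hl hl1 C n e k hk (he k)) (by
    rw [← mul_le_mul_iff_left₀ hN, h.xsub, add_mul]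
    by_cases hκ : (k:ℕ) < κ
    · have h7 := h6 k hκ
      rw [h.r0 n k hκ] at hk
      have : ((v n k : ℕ):ℝ) + 1 ≤ (e k : ℕ) := by
        have : ((v n k : ℕ):ℝ) < (e k : ℕ) := by linarith
        exact_mod_cast this
      linarith
    · have h7 := h.r1 n k (by omega) hks
      rw [← h7]
      have := mul_le_mul_of_nonneg_right (le_max_left R0 1) (mul_nonneg hN.le hr0)
      linarith)
  have h4 := mul_le_mul_of_nonneg_right (le_abs_self K) (ww_pos (mm lam N r n)).le
  have h5 := mul_le_mul_of_nonneg_left h2.2 (abs_nonneg K)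
  linarith
end


section
variable {d s : ℕ} {α : Fin d → ℕ} {β : Fin d → ℝ} {κ : Fin d}

noncomputable def AA (s : ℕ) (α : Fin d → ℕ) (l : Fin d) : ℝ :=
  2 + ∑ k ∈ Finset.Ici l, if (k : ℕ) < s then ((α k : ℝ))⁻¹ else 0
noncomputable def BB (β : Fin d → ℝ) (l : Fin d) : ℝ := ∑ k ∈ Finset.Ici l, β k

lemma AA_pos (l : Fin d) : 0 < AA s α l := by
  have : 0 ≤ ∑ k ∈ Finset.Ici l, if (k : ℕ) < s then ((α k : ℝ))⁻¹ else 0 :=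
    Finset.sum_nonneg fun k _ => by split_ifs <;> positivity
  rw [AA]; linarith

lemma Ici_ins (l l' : Fin d) (h : (l':ℕ) = l + 1) : Finset.Ici l = insert l (Finset.Ici l') := by
  ext k
  simp only [Finset.mem_Ici, Finset.mem_insert, Fin.le_def, Fin.ext_iff]
  omega

lemma AA_succ (l l' : Fin d) (h : (l':ℕ) = l + 1) (hl : (l:ℕ) < s) : AA s α l = (α l : ℝ)⁻¹ + AA s α l' := by
  rw [AA, AA, Ici_ins l l' h, Finset.sum_insert (by rw [Finset.mem_Ici, Fin.le_def]; omega), if_pos hl]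
  ring

lemma BB_succ (l l' : Fin d) (h : (l':ℕ) = l + 1) : BB β l = β l + BB β l' := by
  rw [BB, BB, Ici_ins l l' h, Finset.sum_insert (by rw [Finset.mem_Ici, Fin.le_def]; omega)]

lemma ratio_lt (hα : ∀ k : Fin d, (k : ℕ) < s → 1 ≤ α k)
    (horder : ∀ k k' : Fin d, k ≤ k' → (k' : ℕ) < s → (α k : ℝ) * β k ≤ (α k' : ℝ) * β k')
    (hκs : (κ : ℕ) < s) (hu : ∀ l : Fin d, l ≠ κ → BB β l / AA s α l < BB β κ / AA s α κ)
    (k : Fin d) (hk : (k:ℕ) < κ) : β k < BB β κ / AA s α κ * (α k : ℝ)⁻¹ := by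
  obtain ⟨l, hl⟩ : ∃ l : Fin d, (κ:ℕ) = l + 1 := ⟨⟨κ - 1, by omega⟩, by simp; omega⟩
  have h1 := hu l (by rintro rfl; omega)
  rw [AA_succ l κ hl (by omega), BB_succ l κ hl] at h1
  have hA := AA_pos (s := s) (α := α) κ
  have hαl : (0:ℝ) < α l := by exact_mod_cast hα l (by omega)
  have hαk : (0:ℝ) < α k := by exact_mod_cast hα k (by omega)
  have h2 := horder k l (by rw [Fin.le_def]; omega) (by omega)
  set ρ := BB β κ / AA s α κ with hρ
  have hB : BB β κ = ρ * AA s α κ := by rw [hρ]; field_simp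
  rw [hB, div_lt_iff₀ (by positivity)] at h1
  have h3 : β l < ρ * (α l : ℝ)⁻¹ := by nlinarith
  have h4 : (α l : ℝ) * β l < ρ := by
    have := mul_lt_mul_of_pos_left h3 hαl
    rwa [mul_comm ρ, mul_inv_cancel_left₀ hαl.ne'] at this
  rw [← div_eq_mul_inv, lt_div_iff₀ hαk]
  linarith

lemma lt_ratio (hα : ∀ k : Fin d, (k : ℕ) < s → 1 ≤ α k) (hβ : ∀ k, 0 < β k)
    (horder : ∀ k k' : Fin d, k ≤ k' → (k' : ℕ) < s → (α k : ℝ) * β k ≤ (α k' : ℝ) * β k')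
    (hκs : (κ : ℕ) < s) (hu : ∀ l : Fin d, l ≠ κ → BB β l / AA s α l < BB β κ / AA s α κ)
    (k : Fin d) (hk : (κ:ℕ) ≤ k) (hks : (k:ℕ) < s) : BB β κ / AA s α κ * (α k : ℝ)⁻¹ < β k := by
  have hαl : (0:ℝ) < α κ := by exact_mod_cast hα κ hκs
  have hαk : (0:ℝ) < α k := by exact_mod_cast hα k hks
  have h2 := horder κ k (by rw [Fin.le_def]; omega) hks
  have hA := AA_pos (s := s) (α := α) κ
  have h3 : BB β κ / AA s α κ * (α κ : ℝ)⁻¹ < β κ := by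
    by_cases hd : (κ:ℕ) + 1 < d
    · have h1 := hu ⟨κ + 1, hd⟩ (by intro h; rw [Fin.ext_iff] at h; simp at h)
      set l : Fin d := ⟨κ + 1, hd⟩ with hl
      have e1 := AA_succ (α := α) κ l rfl hκs
      have e2 := BB_succ (β := β) κ l rfl
      have hA' := AA_pos (s := s) (α := α) l
      set ρ := BB β κ / AA s α κ with hρ
      have hB : BB β κ = ρ * AA s α κ := by rw [hρ]; field_simp
      rw [div_lt_iff₀ hA'] at h1
      have e3 : ρ * AA s α κ = ρ * (α κ : ℝ)⁻¹ + ρ * AA s α l := by rw [e1]; ring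
      linarith
    · have e : Finset.Ici κ = {κ} := by
        ext j
        simp only [Finset.mem_Ici, Finset.mem_singleton, Fin.le_def, Fin.ext_iff]
        have := j.2
        omega
      have e1 : AA s α κ = 2 + (α κ : ℝ)⁻¹ := by rw [AA, e, Finset.sum_singleton, if_pos hκs]
      have e2 : BB β κ = β κ := by rw [BB, e, Finset.sum_singleton]
      rw [e1, e2, div_mul_eq_mul_div, div_lt_iff₀ (by positivity)]
      have := hβ κ
      have : 0 < β κ * (α κ : ℝ)⁻¹ := by positivity
      nlinarith
  have h4 : BB β κ / AA s α κ < (α κ : ℝ) * β κ := by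
    rwa [← div_eq_mul_inv, div_lt_iff₀ hαl, mul_comm] at h3
  rw [← div_eq_mul_inv, div_lt_iff₀ hαk]
  linarith

lemma omegaN_eq (n : ℕ) : omegaN d s α β κ n = (n:ℝ) ^ (-(BB β κ / AA s α κ)) := by
  rw [omegaN, ← Real.rpow_mul (Nat.cast_nonneg _)]
  congr 1
  rw [BB, AA]
  ring

lemma dim_le (n : ℕ) (k : Fin d) : (latticeDim d β n k : ℝ) ≤ (n:ℝ) ^ β k :=
  Nat.floor_le (Real.rpow_nonneg (Nat.cast_nonneg _) _)

lemma le_dim (hβ : ∀ k, 0 < β k) (n : ℕ) (hn : 1 ≤ n) (k : Fin d) : (n:ℝ) ^ β k ≤ 2 * (latticeDim d β n k : ℝ) ∧ (1:ℝ) ≤ latticeDim d β n k := by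
  have h1 : (1:ℝ) ≤ (n:ℝ) ^ β k := Real.one_le_rpow (by exact_mod_cast hn) (hβ k).le
  have h2 : 1 ≤ latticeDim d β n k := Nat.le_floor (by exact_mod_cast h1)
  have h3 := Nat.lt_floor_add_one ((n:ℝ) ^ β k)
  have h4 : (1:ℝ) ≤ latticeDim d β n k := by exact_mod_cast h2
  refine ⟨?_, h4⟩
  rw [latticeDim] at *
  linarith

lemma tendsto_pow_neg (y : ℝ) (hy : y < 0) : Tendsto (fun n : ℕ => ((n + 1 : ℕ) : ℝ) ^ y) atTop (nhds 0) := by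
  have h1 : Tendsto (fun n : ℕ => ((n + 1 : ℕ) : ℝ)) atTop atTop :=
    tendsto_natCast_atTop_atTop.comp (tendsto_add_atTop_nat 1)
  have := (tendsto_rpow_neg_atTop (y := -y) (by linarith)).comp h1
  simpa [Function.comp_def] using this

lemma tendsto_pow_pos (y : ℝ) (hy : 0 < y) : Tendsto (fun n : ℕ => ((n + 1 : ℕ) : ℝ) ^ y) atTop atTop := by
  have h1 : Tendsto (fun n : ℕ => ((n + 1 : ℕ) : ℝ)) atTop atTop :=
    tendsto_natCast_atTop_atTop.comp (tendsto_add_atTop_nat 1)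
  exact (tendsto_rpow_atTop hy).comp h1

lemma mk_lat (hα : ∀ k : Fin d, (k : ℕ) < s → 1 ≤ α k) (hβ : ∀ k, 0 < β k) {x₀ : Fin d → ℝ}
    (hx : ∀ k, x₀ k ∈ Set.Ioo (0:ℝ) 1)
    (horder : ∀ k k' : Fin d, k ≤ k' → (k' : ℕ) < s → (α k : ℝ) * β k ≤ (α k' : ℝ) * β k')
    (hκs : (κ : ℕ) < s) (hu : ∀ l : Fin d, l ≠ κ → BB β l / AA s α l < BB β κ / AA s α κ)
    (a : ℕ → Fin d → ℝ)
    (ha_lb : ∀ n k, 0 ≤ a n k)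
    (ha_ub : ∀ n k, a n k + ((latticeDim d β n k : ℝ) - 1) / (latticeDim d β n k : ℝ) ≤ 1)
    (v : ∀ n k, Fin (latticeDim d β (n+1) k)) (hv : ∀ n, latticePt d β a (n+1) (v n) = x₀) :
    LatD d s κ α x₀ (fun n => latticeDim d β (n+1)) v (fun n => a (n+1)) (fun n => omegaN d s α β κ (n+1))
      (fun n => rnVec d s α β κ (n+1)) := by
  have hA := AA_pos (s := s) (α := α) κ
  have hB : 0 < BB β κ := Finset.sum_pos (fun k _ => hβ k) ⟨κ, by simp⟩
  set ρ := BB β κ / AA s α κ with hρ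
  have hρ0 : 0 < ρ := by positivity
  have hω : ∀ n, omegaN d s α β κ (n+1) = ((n + 1 : ℕ):ℝ) ^ (-ρ) := fun n => omegaN_eq (n+1)
  have hn0 : ∀ n : ℕ, (0:ℝ) < ((n + 1 : ℕ):ℝ) := fun n => by positivity
  have hn1 : ∀ n : ℕ, (1:ℝ) ≤ ((n + 1 : ℕ):ℝ) := fun n => by push_cast; linarith [(Nat.cast_nonneg n : (0:ℝ) ≤ n)]
  have hω0 : ∀ n, 0 < omegaN d s α β κ (n+1) := fun n => by rw [hω]; exact Real.rpow_pos_of_pos (hn0 n) _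
  have hωp : ∀ n k, omegaN d s α β κ (n+1) ^ ((α k : ℝ)⁻¹) = ((n + 1 : ℕ):ℝ) ^ (-(ρ * (α k : ℝ)⁻¹)) := fun n k => by
    rw [hω, ← Real.rpow_mul (hn0 n).le, neg_mul]
  have hd := fun n k => le_dim hβ (n+1) (by omega) k
  have hN : ∀ n k, (0:ℝ) < latticeDim d β (n+1) k := fun n k => by linarith [(hd n k).2]
  have hrp : ∀ n k, ¬ ((k:Fin d):ℕ) < κ → 0 < rnVec d s α β κ (n+1) k := fun n k hk => by
    rw [rnVec, if_neg hk]
    split_ifs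
    · rw [hωp]; exact Real.rpow_pos_of_pos (hn0 n) _
    · exact one_pos
  refine ⟨hκs, hx, hN, fun n => ha_lb _, fun n k => ?_, fun n k => ?_, ?_, hω0, fun k hk => ?_, fun k hk => ?_, 
    fun n k hk => ?_, fun n k hk hs => ?_, fun n k hk => ?_, fun n k => ?_, ?_⟩
  · have := ha_ub (n+1) k
    have h0 := hN n k
    rw [← mul_le_mul_iff_left₀ h0, add_mul, div_mul_cancel₀ _ h0.ne'] at this
    linarith
  · exact congrFun (hv n) k
  · refine tendsto_nhdsWithin_iff.2 ⟨?_, Eventually.of_forall hω0⟩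
    simp_rw [hω]
    exact tendsto_pow_neg _ (by linarith)
  · have h1 := ratio_lt hα horder hκs hu k hk
    refine squeeze_zero (fun n => mul_nonneg (hN n k).le (Real.rpow_nonneg (hω0 n).le _)) (fun n => ?_) 
      (tendsto_pow_neg (β k - ρ * (α k : ℝ)⁻¹) (by linarith))
    rw [hωp, sub_eq_add_neg, Real.rpow_add (hn0 n)]
    exact mul_le_mul_of_nonneg_right (dim_le _ _) (Real.rpow_nonneg (hn0 n).le _)
  · have key : ∃ y : ℝ, 0 < y ∧ ∀ n : ℕ, (1/2) * ((n + 1 : ℕ):ℝ) ^ y ≤ latticeDim d β (n+1) k * rnVec d s α β κ (n+1) k := by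
      by_cases hs : (k:ℕ) < s
      · refine ⟨β k - ρ * (α k : ℝ)⁻¹, by linarith [lt_ratio hα hβ horder hκs hu k hk hs], fun n => ?_⟩
        rw [rnVec, if_neg (by omega), if_pos hs, hωp, sub_eq_add_neg, Real.rpow_add (hn0 n), ← mul_assoc]
        exact mul_le_mul_of_nonneg_right (by linarith [(hd n k).1]) (Real.rpow_nonneg (hn0 n).le _)
      · refine ⟨β k, hβ k, fun n => ?_⟩
        rw [rnVec, if_neg (by omega), if_neg hs]
        linarith [(hd n k).1]
    obtain ⟨y, hy, hyn⟩ := key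
    exact tendsto_atTop_mono hyn ((tendsto_pow_pos y hy).const_mul_atTop (by norm_num))
  · rw [rnVec, if_pos hk]
  · rw [rnVec, if_neg (by omega), if_pos hs]
  · rw [rnVec, if_neg (by omega), if_neg (by omega)]
  · rw [rnVec]
    split_ifs
    · exact zero_le_one
    · rw [hωp]
      exact Real.rpow_le_one_of_one_le_of_nonpos (hn1 n) (by have : (0:ℝ) ≤ ρ * (α k : ℝ)⁻¹ := by positivity
                                                             linarith)
    · exact le_rfl
  · have hprod : ∀ n : ℕ, (∏ k : Fin d, if (k:ℕ) < κ then (1:ℝ) else ((n + 1 : ℕ):ℝ) ^ β k * rnVec d s α β κ (n+1) k) =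
        (omegaN d s α β κ (n+1))⁻¹ ^ 2 := by
      intro n
      have e1 : ∀ k : Fin d, (if (k:ℕ) < κ then (1:ℝ) else ((n + 1 : ℕ):ℝ) ^ β k * rnVec d s α β κ (n+1) k) =
          ((n + 1 : ℕ):ℝ) ^ (if κ ≤ k then β k - ρ * (if (k:ℕ) < s then (α k : ℝ)⁻¹ else 0) else 0) := by
        intro k
        rw [rnVec]
        by_cases hk : (k:ℕ) < κ
        · rw [if_pos hk, if_neg (by rw [Fin.le_def]; omega), Real.rpow_zero]
        · rw [if_neg hk, if_neg hk, if_pos (show κ ≤ k by rw [Fin.le_def]; omega), sub_eq_add_neg, Real.rpow_add (hn0 n)]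
          congr 1
          split_ifs
          · rw [hωp]
          · simp
      simp_rw [e1]
      rw [← Real.rpow_sum_of_pos (hn0 n), hω, ← Real.rpow_neg (hn0 n).le, neg_neg, ← Real.rpow_natCast,
        ← Real.rpow_mul (hn0 n).le]
      congr 1
      rw [← Finset.sum_filter, Finset.sum_sub_distrib, ← Finset.mul_sum]
      have e2 : Finset.univ.filter (fun k => κ ≤ k) = Finset.Ici κ := by ext; simp
      rw [e2]
      have e3 : ∑ k ∈ Finset.Ici κ, β k = ρ * AA s α κ := by rw [hρ]; field_simp; rfl
      rw [e3, AA]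
      push_cast
      ring
    have nn : ∀ n k, 0 ≤ (if ((k:Fin d):ℕ) < κ then (1:ℝ) else latticeDim d β (n+1) k * rnVec d s α β κ (n+1) k) := fun n k => by
      split_ifs with hk
      · exact zero_le_one
      · exact (mul_pos (hN n k) (hrp n k hk)).le
    refine ⟨(1/2) ^ d, by positivity, fun n => ⟨?_, ?_⟩⟩
    · rw [← hprod n]
      calc _ = ∏ k : Fin d, ((1/2) * if (k:ℕ) < κ then (1:ℝ) else ((n + 1 : ℕ):ℝ) ^ β k * rnVec d s α β κ (n+1) k) := by
            rw [Finset.prod_mul_distrib]; simp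
        _ ≤ _ := by
            refine Finset.prod_le_prod (fun k _ => ?_) fun k _ => ?_
            · split_ifs with hk
              · norm_num
              · exact mul_nonneg (by norm_num) (mul_nonneg (Real.rpow_nonneg (hn0 n).le _) (hrp n k hk).le)
            · split_ifs with hk
              · norm_num
              · rw [← mul_assoc]
                exact mul_le_mul_of_nonneg_right (by linarith [(hd n k).1]) (hrp n k hk).le
    · rw [← hprod n]
      refine Finset.prod_le_prod (fun k _ => nn n k) fun k _ => ?_
      split_ifs with hk
      · exact le_rfl
      · exact mul_le_mul_of_nonneg_right (dim_le _ _) (hrp n k hk).le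
end


section
variable {d : ℕ}

noncomputable def FF (A : (Fin d → ℕ) → (Fin d → ℕ) → ℝ) (S Q : (Fin d → ℕ) → Prop) : ℝ :=
  sSup {z : ℝ | ∃ p, S p ∧ z = sInf {w : ℝ | ∃ q, Q q ∧ w = A p q}}

lemma FF_eq (A : (Fin d → ℕ) → (Fin d → ℕ) → ℝ) (S Q S' Q' : (Fin d → ℕ) → Prop)
    (hS : {p | S p}.Finite) (hQ : {q | Q q}.Finite) (hSS : ∀ p, S' p → S p) (hQQ : ∀ q, Q' q → Q q) (q0) (hq0 : Q q0)
    (a : ℝ) (p1) (h1 : S' p1) (h1a : ∀ q, Q q → a ≤ A p1 q)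
    (h : ∀ p, S p → (∃ q, Q' q ∧ A p q < a) ∨ (S' p ∧ ∀ q, Q q → ∃ q', Q' q' ∧ A p q' ≤ A p q)) :
    FF A S Q = FF A S' Q' := by
  set I : (Fin d → ℕ) → ℝ := fun p => sInf {w : ℝ | ∃ q, Q q ∧ w = A p q} with hI
  set I' : (Fin d → ℕ) → ℝ := fun p => sInf {w : ℝ | ∃ q, Q' q ∧ w = A p q} with hI'
  obtain ⟨q0', hq0'⟩ : ∃ q, Q' q := by
    rcases h p1 (hSS _ h1) with ⟨q, hq, -⟩ | ⟨-, hh⟩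
    · exact ⟨q, hq⟩
    · obtain ⟨q', hq', -⟩ := hh q0 hq0
      exact ⟨q', hq'⟩
  have fin : ∀ p, {w : ℝ | ∃ q, Q q ∧ w = A p q}.Finite := fun p => by
    refine (hQ.image (A p)).subset ?_
    rintro w ⟨q, hq, rfl⟩
    exact ⟨q, hq, rfl⟩
  have fin' : ∀ p, {w : ℝ | ∃ q, Q' q ∧ w = A p q}.Finite := fun p => by
    refine (fin p).subset ?_
    rintro w ⟨q, hq, rfl⟩
    exact ⟨q, hQQ q hq, rfl⟩
  have Ile : ∀ p q, Q q → I p ≤ A p q := fun p q hq => csInf_le (fin p).bddBelow ⟨q, hq, rfl⟩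
  have Ile' : ∀ p q, Q' q → I' p ≤ A p q := fun p q hq => csInf_le (fin' p).bddBelow ⟨q, hq, rfl⟩
  have Imem : ∀ p, ∃ q, Q q ∧ I p = A p q := fun p =>
    Set.Nonempty.csInf_mem (s := {w : ℝ | ∃ q, Q q ∧ w = A p q}) ⟨_, q0, hq0, rfl⟩ (fin p)
  have Imem' : ∀ p, ∃ q, Q' q ∧ I' p = A p q := fun p =>
    Set.Nonempty.csInf_mem (s := {w : ℝ | ∃ q, Q' q ∧ w = A p q}) ⟨_, q0', hq0', rfl⟩ (fin' p)
  have II : ∀ p, I p ≤ I' p := fun p => by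
    obtain ⟨q, hq, e⟩ := Imem' p
    rw [e]; exact Ile p q (hQQ q hq)
  have alt : ∀ p, S p → a ≤ I' p → S' p ∧ I p = I' p := by
    intro p hp ha
    rcases h p hp with ⟨q, hq, hlt⟩ | ⟨hS', hh⟩
    · linarith [Ile' p q hq]
    · refine ⟨hS', le_antisymm (II p) ?_⟩
      obtain ⟨q, hq, e⟩ := Imem p
      obtain ⟨q', hq', hle⟩ := hh q hq
      rw [e]
      exact (Ile' p q' hq').trans hle
  have a1 : a ≤ I p1 := by
    obtain ⟨q, hq, e⟩ := Imem p1
    rw [e]; exact h1a q hq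
  have fS : {z : ℝ | ∃ p, S p ∧ z = I p}.Finite := by
    refine (hS.image I).subset ?_
    rintro w ⟨q, hq, rfl⟩
    exact ⟨q, hq, rfl⟩
  have fS' : {z : ℝ | ∃ p, S' p ∧ z = I' p}.Finite := by
    refine (hS.image I').subset ?_
    rintro w ⟨q, hq, rfl⟩
    exact ⟨q, hSS q hq, rfl⟩
  change sSup {z : ℝ | ∃ p, S p ∧ z = I p} = sSup {z : ℝ | ∃ p, S' p ∧ z = I' p}
  obtain ⟨p, hp, e⟩ := Set.Nonempty.csSup_mem (s := {z : ℝ | ∃ p, S p ∧ z = I p}) ⟨_, p1, hSS _ h1, rfl⟩ fS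
  obtain ⟨p', hp', e'⟩ := Set.Nonempty.csSup_mem (s := {z : ℝ | ∃ p, S' p ∧ z = I' p}) ⟨_, p1, h1, rfl⟩ fS'
  have g1 : I p1 ≤ sSup {z : ℝ | ∃ p, S p ∧ z = I p} := le_csSup fS.bddAbove ⟨p1, hSS _ h1, rfl⟩
  have g2 : I' p1 ≤ sSup {z : ℝ | ∃ p, S' p ∧ z = I' p} := le_csSup fS'.bddAbove ⟨p1, h1, rfl⟩
  have b1 := alt p hp (by linarith [II p])
  have b2 := alt p' (hSS _ hp') (by linarith [II p1])
  apply le_antisymm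
  · rw [e, b1.2]
    exact le_csSup fS'.bddAbove ⟨p, b1.1, rfl⟩
  · rw [e', ← b2.2]
    exact le_csSup fS.bddAbove ⟨p', hSS _ hp', rfl⟩

variable {N : Fin d → ℕ} (hN : ∀ k, (0:ℝ) < N k) (v : ∀ k, Fin (N k)) (a x0 : Fin d → ℝ)
  (hg : ∀ k, a k + (v k : ℝ) / N k = x0 k) (Y : (∀ k, Fin (N k)) → ℝ)

noncomputable def XX (N : Fin d → ℕ) (a : Fin d → ℝ) (e : ∀ k, Fin (N k)) : Fin d → ℝ := fun k => a k + (e k : ℝ) / N k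

/-- lower reach -/
noncomputable def pp (t : Fin d → ℝ) : Fin d → ℕ := fun k => min ⌊t k * N k⌋₊ (v k)
/-- upper reach -/
noncomputable def qq (t : Fin d → ℝ) : Fin d → ℕ := fun k => min ⌊t k * N k⌋₊ (N k - 1 - v k)

include hN hg in
lemma blk_mem (t u : Fin d → ℝ) (ht : ∀ k, 0 ≤ t k) (hu : ∀ k, 0 ≤ u k) (e : ∀ k, Fin (N k)) :
    XX N a e ∈ Set.Icc (fun k => x0 k - t k) (fun k => x0 k + u k) ↔ e ∈ bx v (pp v t) (qq v u) := by
  rw [mem_bx, Set.mem_Icc, Pi.le_def, Pi.le_def, ← forall_and]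
  refine forall_congr' fun k => and_congr ?_ ?_
  · have h0 := hN k
    have h1 : x0 k - t k ≤ XX N a e k ↔ ((v k : ℕ):ℝ) - (e k : ℕ) ≤ t k * N k := by
      rw [← hg, XX, ← mul_le_mul_iff_left₀ h0, sub_mul, add_mul, add_mul, div_mul_cancel₀ _ h0.ne', div_mul_cancel₀ _ h0.ne']
      constructor <;> intro h <;> linarith
    rw [h1]
    have h2 : ((v k : ℕ):ℝ) - (e k : ℕ) ≤ t k * N k ↔ (v k : ℕ) - (e k : ℕ) ≤ ⌊t k * N k⌋₊ := by
      rw [Nat.le_floor_iff (mul_nonneg (ht k) h0.le)]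
      by_cases hle : (e k : ℕ) ≤ v k
      · rw [Nat.cast_sub hle]
      · have h3 : ((v k : ℕ):ℝ) ≤ (e k : ℕ) := by exact_mod_cast (by omega : (v k : ℕ) ≤ e k)
        have h4 := mul_nonneg (ht k) h0.le
        rw [Nat.sub_eq_zero_of_le (by omega)]
        simp only [Nat.cast_zero, h4, iff_true]
        linarith
    rw [h2, pp]
    omega
  · have h0 := hN k
    have h1 : XX N a e k ≤ x0 k + u k ↔ ((e k : ℕ):ℝ) - (v k : ℕ) ≤ u k * N k := by
      rw [← hg, XX, ← mul_le_mul_iff_left₀ h0, add_mul, add_mul, add_mul, div_mul_cancel₀ _ h0.ne', div_mul_cancel₀ _ h0.ne']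
      constructor <;> intro h <;> linarith
    rw [h1]
    have h2 : ((e k : ℕ):ℝ) - (v k : ℕ) ≤ u k * N k ↔ (e k : ℕ) - (v k : ℕ) ≤ ⌊u k * N k⌋₊ := by
      rw [Nat.le_floor_iff (mul_nonneg (hu k) h0.le)]
      by_cases hle : (v k : ℕ) ≤ e k
      · rw [Nat.cast_sub hle]
      · have h3 : ((e k : ℕ):ℝ) ≤ (v k : ℕ) := by exact_mod_cast (by omega : (e k : ℕ) ≤ v k)
        have h4 := mul_nonneg (hu k) h0.le
        rw [Nat.sub_eq_zero_of_le (by omega)]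
        simp only [Nat.cast_zero, h4, iff_true]
        linarith
    rw [h2, qq]
    have := (e k).2
    omega

include hN hg in
lemma blk_avg (t u : Fin d → ℝ) (ht : ∀ k, 0 ≤ t k) (hu : ∀ k, 0 ≤ u k) :
    blockAvg (XX N a) Y (fun k => x0 k - t k) (fun k => x0 k + u k) = Av Y v (pp v t) (qq v u) := by
  have : ∀ (inst : DecidablePred fun i => XX N a i ∈ Set.Icc (fun k => x0 k - t k) (fun k => x0 k + u k)),
      Finset.univ.filter (fun i => XX N a i ∈ Set.Icc (fun k => x0 k - t k) (fun k => x0 k + u k)) = bx v (pp v t) (qq v u) := by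
    intro inst
    ext e
    rw [Finset.mem_filter]
    simp only [Finset.mem_univ, true_and]
    exact blk_mem hN v a x0 hg t u ht hu e
  rw [blockAvg, Av, this]

include hN in
lemma pp_surj (p : Fin d → ℕ) (hp : ∀ j, p j ≤ v j) : pp v (fun k => (p k : ℝ) / N k) = p := by
  ext k
  rw [pp, div_mul_cancel₀ _ (hN k).ne', Nat.floor_natCast]
  exact min_eq_left (hp k)

include hN in
lemma qq_surj (q : Fin d → ℕ) (hq : ∀ j, v j + q j < N j) : qq v (fun k => (q k : ℝ) / N k) = q := by
  ext k
  rw [qq, div_mul_cancel₀ _ (hN k).ne', Nat.floor_natCast]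
  have := hq k
  omega

lemma pp_le (t : Fin d → ℝ) (k) : pp v t k ≤ v k := min_le_right _ _
lemma qq_lt (t : Fin d → ℝ) (k) : v k + qq v t k < N k := by
  rw [qq]
  have := (v k).2
  omega

include hN hg in
lemma est_eq : maxMinEst (XX N a) Y x0 = FF (Av Y v) (fun p => ∀ j, p j ≤ v j) (fun q => ∀ j, v j + q j < N j) := by
  have inner : ∀ t : Fin d → ℝ, (∀ k, 0 ≤ t k) →
      {w : ℝ | ∃ xv : Fin d → ℝ, x0 ≤ xv ∧ (∃ i, XX N a i ∈ Set.Icc (fun k => x0 k - t k) xv) ∧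
        w = blockAvg (XX N a) Y (fun k => x0 k - t k) xv} = {w | ∃ q : Fin d → ℕ, (∀ j, v j + q j < N j) ∧ w = Av Y v (pp v t) q} := by
    intro t ht
    ext w
    constructor
    · rintro ⟨xv, hxv, -, rfl⟩
      refine ⟨qq v (fun k => xv k - x0 k), qq_lt v _, ?_⟩
      rw [← blk_avg hN v a x0 hg Y t _ ht (fun k => sub_nonneg.2 (hxv k))]
      congr 1
      ext k; ring
    · rintro ⟨q, hq, rfl⟩
      refine ⟨fun k => x0 k + (q k : ℝ) / N k, fun k => ?_, ⟨v, ?_⟩, ?_⟩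
      · have := hN k
        have : (0:ℝ) ≤ (q k : ℝ) / N k := by positivity
        linarith
      · rw [blk_mem hN v a x0 hg t _ ht (fun k => by positivity), mem_bx]
        intro k; omega
      · rw [blk_avg hN v a x0 hg Y t _ ht (fun k => by positivity), qq_surj hN v q hq]
  rw [maxMinEst, FF]
  congr 1
  ext z
  constructor
  · rintro ⟨xu, hxu, rfl⟩
    refine ⟨pp v (fun k => x0 k - xu k), pp_le v _, ?_⟩
    rw [← inner _ (fun k => sub_nonneg.2 (hxu k))]
    have e : (fun k => x0 k - (x0 k - xu k)) = xu := by ext k; ring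
    rw [e]
  · rintro ⟨p, hp, rfl⟩
    refine ⟨fun k => x0 k - (p k : ℝ) / N k, fun k => ?_, ?_⟩
    · have := hN k
      have : (0:ℝ) ≤ (p k : ℝ) / N k := by positivity
      linarith
    · rw [inner _ (fun k => by positivity), pp_surj hN v p hp]

include hN hg in
lemma estLoc_eq (r : Fin d → ℝ) (hr : ∀ k, 0 ≤ r k) (c γ : ℝ) (hc : 0 < c) :
    maxMinEstLoc (XX N a) Y x0 r c γ = FF (Av Y v)
      (fun p => ∃ h : Fin d → ℝ, (∀ k, c ^ (-γ) ≤ h k ∧ h k ≤ c) ∧ p = pp v (fun k => h k * r k))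
      (fun q => ∃ h : Fin d → ℝ, (∀ k, c ^ (-γ) ≤ h k ∧ h k ≤ c) ∧ q = qq v (fun k => h k * r k)) := by
  have nn : ∀ h : Fin d → ℝ, (∀ k, c ^ (-γ) ≤ h k ∧ h k ≤ c) → ∀ k, 0 ≤ h k * r k := fun h hh k =>
    mul_nonneg ((Real.rpow_pos_of_pos hc _).le.trans (hh k).1) (hr k)
  have inner : ∀ h1 : Fin d → ℝ, (∀ k, c ^ (-γ) ≤ h1 k ∧ h1 k ≤ c) →
      {w : ℝ | ∃ h₂ : Fin d → ℝ, (∀ k, c ^ (-γ) ≤ h₂ k ∧ h₂ k ≤ c) ∧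
      w = blockAvg (XX N a) Y (fun k => x0 k - h1 k * r k) (fun k => x0 k + h₂ k * r k)} =
      {w | ∃ q, (∃ h : Fin d → ℝ, (∀ k, c ^ (-γ) ≤ h k ∧ h k ≤ c) ∧ q = qq v (fun k => h k * r k)) ∧ w = Av Y v (pp v (fun k => h1 k * r k)) q} := by
    intro h1 hh1
    ext w
    constructor
    · rintro ⟨h2, hh2, rfl⟩
      exact ⟨_, ⟨h2, hh2, rfl⟩, blk_avg hN v a x0 hg Y _ _ (nn h1 hh1) (nn h2 hh2)⟩
    · rintro ⟨_, ⟨h2, hh2, rfl⟩, rfl⟩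
      exact ⟨h2, hh2, (blk_avg hN v a x0 hg Y _ _ (nn h1 hh1) (nn h2 hh2)).symm⟩
  rw [maxMinEstLoc, FF]
  congr 1
  ext z
  constructor
  · rintro ⟨h1, hh1, rfl⟩
    exact ⟨_, ⟨h1, hh1, rfl⟩, by rw [inner h1 hh1]⟩
  · rintro ⟨_, ⟨h1, hh1, rfl⟩, rfl⟩
    exact ⟨h1, hh1, by rw [inner h1 hh1]⟩

include hN in
lemma ex_h (r : Fin d → ℝ) (hr : ∀ k, 0 ≤ r k) (c γ lam b C : ℝ)
    (h1 : c ^ (-γ) ≤ b * lam) (h2 : C * lam ≤ c) (h3 : c ^ (-γ) ≤ 1) (h4 : 1 ≤ c) (p : Fin d → ℕ)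
    (hp : Cl (fun k => lam * (N k * r k)) b C p) :
    ∃ h : Fin d → ℝ, (∀ k, c ^ (-γ) ≤ h k ∧ h k ≤ c) ∧ (fun k => h k * r k) = fun k => (p k : ℝ) / N k := by
  refine ⟨fun k => if r k = 0 then 1 else p k / (N k * r k), fun k => ?_, ?_⟩
  · beta_reduce
    split_ifs with hk
    · exact ⟨h3, h4⟩
    · have hrk : 0 < r k := lt_of_le_of_ne (hr k) (Ne.symm hk)
      have h0 : 0 < N k * r k := mul_pos (hN k) hrk
      obtain ⟨g1, g2⟩ := hp k
      constructor
      · rw [le_div_iff₀ h0]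
        have := mul_le_mul_of_nonneg_right h1 h0.le
        linarith
      · rw [div_le_iff₀ h0]
        have := mul_le_mul_of_nonneg_right h2 h0.le
        linarith
  · ext k
    beta_reduce
    split_ifs with hk
    · obtain ⟨g1, g2⟩ := hp k
      beta_reduce at g2
      rw [hk] at g2 ⊢
      have : (p k : ℝ) = 0 := le_antisymm (by linarith) (Nat.cast_nonneg _)
      rw [this]; simp
    · have := hN k
      field_simp

include hN hg in
theorem det_eq (r : Fin d → ℝ) (hr : ∀ k, 0 ≤ r k) (c γ lam b C : ℝ)
    (h1 : c ^ (-γ) ≤ b * lam) (h2 : C * lam ≤ c) (h3 : c ^ (-γ) ≤ 1) (h4 : 1 ≤ c)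
    (hG : Good (Av Y v) v (fun k => lam * (N k * r k)) b C) :
    maxMinEst (XX N a) Y x0 = maxMinEstLoc (XX N a) Y x0 r c γ := by
  rw [est_eq hN v a x0 hg Y, estLoc_eq hN v a x0 hg Y r hr c γ (by linarith)]
  obtain ⟨A, p1, g1, g2, g3, g4⟩ := hG
  have cp : ∀ p, Cl (fun k => lam * (N k * r k)) b C p → (∀ j, p j ≤ v j) →
      ∃ h : Fin d → ℝ, (∀ k, c ^ (-γ) ≤ h k ∧ h k ≤ c) ∧ p = pp v (fun k => h k * r k) := fun p hp hv => by
    obtain ⟨h, hh, e⟩ := ex_h hN r hr c γ lam b C h1 h2 h3 h4 p hp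
    exact ⟨h, hh, by rw [e, pp_surj hN v p hv]⟩
  have cq : ∀ p, Cl (fun k => lam * (N k * r k)) b C p → (∀ j, v j + p j < N j) →
      ∃ h : Fin d → ℝ, (∀ k, c ^ (-γ) ≤ h k ∧ h k ≤ c) ∧ p = qq v (fun k => h k * r k) := fun p hp hv => by
    obtain ⟨h, hh, e⟩ := ex_h hN r hr c γ lam b C h1 h2 h3 h4 p hp
    exact ⟨h, hh, by rw [e, qq_surj hN v p hv]⟩
  refine FF_eq _ _ _ _ _ ?_ ?_ ?_ ?_ 0 ?_ A p1 (cp p1 g1 g2) g3 ?_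
  · exact (Set.finite_Iic (fun k => (v k : ℕ))).subset fun p hp k => hp k
  · exact (Set.finite_Iic (fun k => N k)).subset fun p hp k => by
      have h := (show ∀ j, v j + p j < N j from hp) k
      beta_reduce
      omega
  · rintro p ⟨h, -, rfl⟩
    exact pp_le v _
  · rintro p ⟨h, -, rfl⟩
    exact qq_lt v _
  · intro j; simp
  · intro p hp
    rcases g4 p hp with ⟨q, hq1, hq2, hq3⟩ | ⟨k1, k2⟩
    · exact Or.inl ⟨q, cq q hq1 hq2, hq3⟩
    · refine Or.inr ⟨cp p k1 hp, fun q hq => ?_⟩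
      obtain ⟨q', e1, e2, e3⟩ := k2 q hq
      exact ⟨q', cq q' e1 e2, e3⟩

lemma Good_shift (f : (∀ k, Fin (N k)) → ℝ) (z : ℝ) (μ : Fin d → ℝ) (b C : ℝ)
    (h : Good (Av (fun e => f e - z) v) v μ b C) : Good (Av f v) v μ b C := by
  have e : ∀ p q, Av (fun e => f e - z) v p q = Av f v p q - z := fun p q => by
    have := bx_card_pos v p q
    rw [Av, Av, Finset.sum_sub_distrib, Finset.sum_const, nsmul_eq_mul]
    field_simp
  obtain ⟨A, p1, g1, g2, g3, g4⟩ := h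
  simp only [e] at g3 g4
  refine ⟨A + z, p1, g1, g2, fun q hq => by linarith [g3 q hq], fun p hp => ?_⟩
  rcases g4 p hp with ⟨q, hq1, hq2, hq3⟩ | ⟨k1, k2⟩
  · exact Or.inl ⟨q, hq1, hq2, by linarith⟩
  · refine Or.inr ⟨k1, fun q hq => ?_⟩
    obtain ⟨q', e1, e2, e3⟩ := k2 q hq
    exact ⟨q', e1, e2, by linarith⟩
end


lemma iid_unpack {ι Ω : Type*} [Fintype ι] [MeasurableSpace Ω] (P : Measure Ω) [IsProbabilityMeasure P]
    (μ : Measure ℝ) [IsProbabilityMeasure μ] (ξ : ι → Ω → ℝ) (hm : ∀ i, Measurable (ξ i))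
    (h : Measure.map (fun ω i => ξ i ω) P = Measure.pi (fun _ => μ)) :
    iIndepFun ξ P ∧ ∀ i, P.map (ξ i) = μ := by
  have hl : ∀ i, P.map (ξ i) = μ := fun i => by
    have h1 := (measurePreserving_eval (fun _ : ι => μ) i).map_eq
    rw [← h, Measure.map_map (measurable_pi_apply i) (measurable_pi_lambda _ hm)] at h1
    exact h1
  refine ⟨?_, hl⟩
  rw [iIndepFun_iff_map_fun_eq_pi_map (fun i => (hm i).aemeasurable), h]
  simp only [hl]

theorem main12 (d s : ℕ) (α : Fin d → ℕ) (β : Fin d → ℝ)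
    (x₀ : Fin d → ℝ) (f₀ : (Fin d → ℝ) → ℝ)
    (hA1 : AssumptionA1 d s α f₀ x₀)
    (hβ : ∀ k, β k ∈ Set.Ioo (0 : ℝ) 1)
    (horder : ∀ k k' : Fin d, k ≤ k' → (k' : ℕ) < s →
      (α k : ℝ) * β k ≤ (α k' : ℝ) * β k')
    (a : ℕ → Fin d → ℝ)
    (ha_lb : ∀ n k, 0 ≤ a n k)
    (ha_ub : ∀ n k, a n k + ((latticeDim d β n k : ℝ) - 1) / (latticeDim d β n k : ℝ) ≤ 1)
    (hx0grid : ∀ n : ℕ, 1 ≤ n →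
      ∃ v : ∀ k : Fin d, Fin (latticeDim d β n k), latticePt d β a n v = x₀)
    (κ : Fin d) (hκs : (κ : ℕ) < s)
    (hκuniq : ∀ l : Fin d, l ≠ κ → BB β l / AA s α l < BB β κ / AA s α κ)
    (σ : ℝ) (hσ : 0 < σ)
    {Ω : Type*} [MeasurableSpace Ω] (P : Measure Ω) [IsProbabilityMeasure P]
    (μ : Measure ℝ) [IsProbabilityMeasure μ]
    (hmean : ∫ x, x ∂μ = 0) (hvar : ∫ x, x ^ 2 ∂μ = σ ^ 2)
    (hL2 : Integrable (fun x : ℝ => x ^ 2) μ)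
    (ξ : (n : ℕ) → (∀ k : Fin d, Fin (latticeDim d β n k)) → Ω → ℝ)
    (hξmeas : ∀ n i, Measurable (ξ n i))
    (hiid : ∀ n : ℕ,
      Measure.map (fun ω (i : ∀ k : Fin d, Fin (latticeDim d β n k)) => ξ n i ω) P =
        Measure.pi (fun _ => μ)) (γ : ℝ) (hγ : 1 ≤ γ) :
      Tendsto (fun c : ℝ =>
        limsup (fun n : ℕ =>
          P {ω : Ω |
            maxMinEst (latticePt d β a n)
                (fun i => f₀ (latticePt d β a n i) + ξ n i ω) x₀ ≠
              maxMinEstLoc (latticePt d β a n)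
                (fun i => f₀ (latticePt d β a n i) + ξ n i ω) x₀
                (rnVec d s α β κ n) c γ}) atTop) atTop (nhds 0) := by
  have hx := hA1.2.1
  have hα := hA1.2.2.2.1
  choose v hv using fun n : ℕ => hx0grid (n+1) (by omega)
  have hLat := mk_lat hα (fun k => (hβ k).1) hx horder hκs hκuniq a ha_lb ha_ub v hv
  obtain ⟨lam, hl, hl1, hlx⟩ := ex_lam hx
  have hf := loc_of_A1 hA1
  rw [ENNReal.tendsto_nhds_zero]
  intro ε hε
  obtain ⟨η, hη, hηε⟩ : ∃ η : ℝ, 0 < η ∧ ENNReal.ofReal η ≤ ε := by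
    by_cases ht : ε = ⊤
    · exact ⟨1, one_pos, by rw [ht]; exact le_top⟩
    · exact ⟨ε.toReal, ENNReal.toReal_pos hε.ne' ht, by rw [ENNReal.ofReal_toReal ht]⟩
  obtain ⟨b, C, hb, hb1, hC, hev⟩ := prob_good μ σ hσ hmean hvar hL2 P (fun n => latticeDim d β (n+1))
    (fun n => ξ (n+1)) (fun n => (iid_unpack P μ _ (hξmeas (n+1)) (hiid (n+1))).1) (fun n => hξmeas (n+1))
    (fun n => (iid_unpack P μ _ (hξmeas (n+1)) (hiid (n+1))).2) v (mm lam (fun n => latticeDim d β (n+1)) (fun n => rnVec d s α β κ (n+1)))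
    (fun n => fun e => f₀ (fun k => a (n+1) k + (e k:ℝ)/latticeDim d β (n+1) k) - f₀ x₀)
    (hLat.setup hl hlx) (hLat.hD hl) (hLat.hU hf hl hl1) (hLat.hL hf hl hl1)
    (hLat.hDn hf hl hl1) (hLat.hUu hf hl hl1) η hη
  have t1 : Tendsto (fun c : ℝ => c ^ (-γ)) atTop (nhds 0) := tendsto_rpow_neg_atTop (by linarith)
  filter_upwards [t1.eventually_le_const (mul_pos hb hl), t1.eventually_le_const one_pos, eventually_ge_atTop 1,
    eventually_ge_atTop (C * lam)] with c h1 h3 h4 h2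
  refine le_trans ?_ hηε
  refine limsup_le_of_le (by isBoundedDefault) ?_
  rw [← map_add_atTop_eq_nat 1, eventually_map]
  filter_upwards [hev] with n hn
  refine le_trans (measure_mono ?_) ((ENNReal.le_ofReal_iff_toReal_le (measure_ne_top _ _) hη.le).2 hn)
  intro ω hω
  refine fun hG => hω ?_
  refine det_eq (fun k => ?_) (v n) (a (n+1)) x₀ (fun k => ?_) _ _ ?_ c γ lam b C h1 h2 h3 h4 ?_
  · exact hLat.Npos n k
  · exact congrFun (hv n) k
  · exact hLat.rnn n
  · apply Good_shift (v n) _ (f₀ x₀)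
    convert hG using 3
    · unfold latticePt
      ring
    · rfl


end

/-- Proposition 6 of the paper (localization of the max–min block estimator), fixed
lattice design case: when the maximizer `κ_*` is unique and `κ_* ≤ s`, for every large
enough `γ`, `lim_{c→∞} limsup_{n→∞} P(f̂_n(x₀) ≠ f̂_{n,c}(x₀)) = 0`. -/
theorem stmt12 (d s : ℕ) (hd : 1 ≤ d) (α : Fin d → ℕ) (β : Fin d → ℝ)
    (x₀ : Fin d → ℝ) (f₀ : (Fin d → ℝ) → ℝ)
    (hA1 : AssumptionA1 d s α f₀ x₀)
    (hβ : ∀ k, β k ∈ Set.Ioo (0 : ℝ) 1) (hβsum : ∑ k : Fin d, β k = 1)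
    (horder : ∀ k k' : Fin d, k ≤ k' → (k' : ℕ) < s →
      (α k : ℝ) * β k ≤ (α k' : ℝ) * β k')
    (a : ℕ → Fin d → ℝ)
    (ha_lb : ∀ n k, 0 ≤ a n k)
    (ha_ub : ∀ n k, a n k + ((latticeDim d β n k : ℝ) - 1) / (latticeDim d β n k : ℝ) ≤ 1)
    (hx0grid : ∀ n : ℕ, 1 ≤ n →
      ∃ v : ∀ k : Fin d, Fin (latticeDim d β n k), latticePt d β a n v = x₀)
    (κ : Fin d) (hκs : (κ : ℕ) < s)
    (hκuniq : ∀ ℓ : Fin d, ℓ ≠ κ →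
      (∑ k ∈ Finset.Ici ℓ, β k) /
          (2 + ∑ k ∈ Finset.Ici ℓ, if (k : ℕ) < s then ((α k : ℝ))⁻¹ else 0) <
        (∑ k ∈ Finset.Ici κ, β k) /
          (2 + ∑ k ∈ Finset.Ici κ, if (k : ℕ) < s then ((α k : ℝ))⁻¹ else 0))
    (σ : ℝ) (hσ : 0 < σ)
    {Ω : Type*} [MeasurableSpace Ω] (P : Measure Ω) [IsProbabilityMeasure P]
    (μ : Measure ℝ) [IsProbabilityMeasure μ]
    (hmean : ∫ x, x ∂μ = 0) (hvar : ∫ x, x ^ 2 ∂μ = σ ^ 2)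
    (hL2 : Integrable (fun x : ℝ => x ^ 2) μ)
    (ξ : (n : ℕ) → (∀ k : Fin d, Fin (latticeDim d β n k)) → Ω → ℝ)
    (hξmeas : ∀ n i, Measurable (ξ n i))
    (hiid : ∀ n : ℕ,
      Measure.map (fun ω (i : ∀ k : Fin d, Fin (latticeDim d β n k)) => ξ n i ω) P =
        Measure.pi (fun _ => μ)) :
    ∃ γ₀ : ℝ, 0 < γ₀ ∧ ∀ γ : ℝ, γ₀ ≤ γ →
      Tendsto (fun c : ℝ =>
        limsup (fun n : ℕ =>
          P {ω : Ω |
            maxMinEst (latticePt d β a n)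
                (fun i => f₀ (latticePt d β a n i) + ξ n i ω) x₀ ≠
              maxMinEstLoc (latticePt d β a n)
                (fun i => f₀ (latticePt d β a n i) + ξ n i ω) x₀
                (rnVec d s α β κ n) c γ}) atTop) atTop (nhds 0) := by
  refine ⟨1, one_pos, fun γ hγ => ?_⟩
  exact main12 d s α β x₀ f₀ hA1 hβ horder a ha_lb ha_ub hx0grid κ hκs hκuniq σ hσ P μ hmean hvar hL2 ξ hξmeas hiid γ hγ
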